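/- Let L_13 = {S_13, K_6 ∪ K_6 ∪ K_1, Co(13), K_6 ∪ S_7, K_6 ∪ G_1(7), K_6 ∪ G_2(7)}. The maximum number of edges of a P-free 3-graph H on 13 vertices such that H is not contained in any member of L_13 equals 32; moreover such an H has 32 edges if and only if H is isomorphic to K_4 ∪ S_9, to K_6 ∪ K_5^{+2}, or to K_6 ∪ G_3(7). -/

import Mathlib

/-- A 3-graph: a finite vertex set together with a finite set of edges
(intended to be 3-element subsets of the vertex set). -/
structure ThreeGraph where
  verts : Finset ℕ
  edges : Finset (Finset ℕ)

namespace ThreeGraph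

/-- `G` is a genuine 3-uniform hypergraph: every edge is a 3-element subset of the vertex set. -/
def IsValid (G : ThreeGraph) : Prop :=
  ∀ e ∈ G.edges, e.card = 3 ∧ e ⊆ G.verts

/-- `H.ContainsCopy F` means `F ⊆ H`: there is an injective map of the vertices of `F`
into those of `H` carrying every edge of `F` to an edge of `H`. -/
def ContainsCopy (H F : ThreeGraph) : Prop :=
  ∃ f : ℕ → ℕ, Set.InjOn f ↑F.verts ∧ (∀ v ∈ F.verts, f v ∈ H.verts) ∧
    ∀ e ∈ F.edges, e.image f ∈ H.edges

/-- `H.Free F` : `H` contains no copy of `F`. -/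
def Free (H F : ThreeGraph) : Prop := ¬ H.ContainsCopy F

/-- `IsoCopy F H` : `H` is isomorphic to `F`. -/
def IsoCopy (F H : ThreeGraph) : Prop :=
  ∃ f : ℕ → ℕ, Set.InjOn f ↑F.verts ∧ F.verts.image f = H.verts ∧
    F.edges.image (Finset.image f) = H.edges

/-- Connectivity: any two vertices are joined by a sequence of vertices in which
consecutive ones lie in a common edge. -/
def Connected (G : ThreeGraph) : Prop :=
  ∀ u ∈ G.verts, ∀ v ∈ G.verts,
    Relation.ReflTransGen (fun a b => ∃ e ∈ G.edges, a ∈ e ∧ b ∈ e) u v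

/-- Shift all vertices by `k`. -/
def shiftBy (G : ThreeGraph) (k : ℕ) : ThreeGraph :=
  ⟨G.verts.image (· + k), G.edges.image (Finset.image (· + k))⟩

/-- Vertex-disjoint union of two 3-graphs. -/
def dUnion (G H : ThreeGraph) : ThreeGraph :=
  ⟨G.verts ∪ (H.shiftBy (G.verts.sup id + 1)).verts,
   G.edges ∪ (H.shiftBy (G.verts.sup id + 1)).edges⟩

end ThreeGraph

/-- The loose 3-uniform path of length 3. -/
def pathP : ThreeGraph :=
  ⟨{0,1,2,3,4,5,6}, {{0,1,2},{2,3,4},{4,5,6}}⟩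

/-- The triangle `C`. -/
def triangleC : ThreeGraph :=
  ⟨{0,1,2,3,4,5}, {{0,1,2},{2,3,4},{4,5,0}}⟩

/-- The matching `M`: two disjoint edges. -/
def matchingM : ThreeGraph :=
  ⟨{0,1,2,3,4,5}, {{0,1,2},{3,4,5}}⟩

/-- `P_2`: two edges sharing exactly one vertex. -/
def pairP2 : ThreeGraph :=
  ⟨{0,1,2,3,4}, {{0,1,2},{2,3,4}}⟩

/-- The complete 3-graph `K_n`. -/
def KK (n : ℕ) : ThreeGraph :=
  ⟨Finset.range n, (Finset.range n).powersetCard 3⟩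

/-- The full star `S_n` with center `0`. -/
def SS (n : ℕ) : ThreeGraph :=
  ⟨Finset.range n, ((Finset.range n).powersetCard 3).filter (fun e => 0 ∈ e)⟩

/-- `G_1(n)` with `x,y,z,v = 0,1,2,3`. -/
def G1 (n : ℕ) : ThreeGraph :=
  ⟨Finset.range n,
   insert {0,1,2}
     (((Finset.range n).powersetCard 3).filter
       (fun h => 3 ∈ h ∧ (h ∩ ({0,1,2} : Finset ℕ)).Nonempty))⟩

/-- `G_2(n)` with `x,y,z = 0,1,2`. -/
def G2 (n : ℕ) : ThreeGraph :=
  ⟨Finset.range n,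
   insert {0,1,2}
     (((Finset.range n).powersetCard 3).filter
       (fun h => (h ∩ ({0,1,2} : Finset ℕ)).card = 2))⟩

/-- `G_3(n)` with `x,y₁,y₂,z₁,z₂ = 0,1,2,3,4`. -/
def G3 (n : ℕ) : ThreeGraph :=
  ⟨Finset.range n,
   ((({0,1,2,3,4} : Finset ℕ).powersetCard 3) \ {{1,2,3},{1,2,4}}) ∪
     ((Finset.range n \ ({0,1,2,3,4} : Finset ℕ)).biUnion (fun w => {{0,3,w},{0,4,w}}))⟩

/-- `K_5^{+t}`: `K_5` on `{0,…,4}` with `a,b = 0,1` and `t` pendant edges `{0,1,v}`. -/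
def K5plus (t : ℕ) : ThreeGraph :=
  ⟨Finset.range (5 + t),
   ((Finset.range 5).powersetCard 3) ∪ ((Finset.Ico 5 (5 + t)).image (fun v => {0,1,v}))⟩

/-- The comet `Co(n)`: a `K_4` on `{0,1,2,3}` and a full star on `{0} ∪ {4,…,n-1}`
with center `0`. -/
def comet (n : ℕ) : ThreeGraph :=
  ⟨Finset.range n,
   (({0,1,2,3} : Finset ℕ).powersetCard 3) ∪
     (((insert 0 (Finset.Ico 4 n)).powersetCard 3).filter (fun e => 0 ∈ e))⟩

/-- `W = V(H) \ U`. -/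
def Wset (H : ThreeGraph) (U : Finset ℕ) : Finset ℕ := H.verts \ U

/-- `W_0`: the vertices of `W` lying in no edge of `H` entirely contained in `W`. -/
def W0set (H : ThreeGraph) (U : Finset ℕ) : Finset ℕ :=
  (Wset H U).filter (fun v => ∀ e ∈ H.edges, e ⊆ Wset H U → v ∉ e)

/-- `W_1 = W \ W_0`. -/
def W1set (H : ThreeGraph) (U : Finset ℕ) : Finset ℕ :=
  Wset H U \ W0set H U

/-- `H_1`: the edges of `H` meeting both `U` and `W_1`. -/
def H1set (H : ThreeGraph) (U : Finset ℕ) : Finset (Finset ℕ) :=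
  H.edges.filter (fun e => (e ∩ U).Nonempty ∧ (e ∩ W1set H U).Nonempty)

/-- `H[U]`: the edges of `H` entirely contained in `U`. -/
def HUset (H : ThreeGraph) (U : Finset ℕ) : Finset (Finset ℕ) :=
  H.edges.filter (fun e => e ⊆ U)

/-- The family `L₁₃`. -/
def L13 : List ThreeGraph :=
  [SS 13, ((KK 6).dUnion (KK 6)).dUnion (KK 1), comet 13, (KK 6).dUnion (SS 7),
   (KK 6).dUnion (G1 7), (KK 6).dUnion (G2 7)]

namespace FT

/-! ### Exhaustive search on seven vertices -/

/-- exactly one bit set -/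
def oneBit (m : ℕ) : Bool := !(Nat.beq m 0) && Nat.beq (Nat.land m (m - 1)) 0

/-- `a, b, c` is a loose path with middle edge `b` -/
def pth (a b c : ℕ) : Bool :=
  oneBit (Nat.land a b) && oneBit (Nat.land b c) && Nat.beq (Nat.land a c) 0

/-- some ordering of the three edges is a loose path -/
def isP (a b c : ℕ) : Bool := pth a b c || pth b a c || pth a c b

/-- the three edges form a triangle -/
def isC (a b c : ℕ) : Bool :=
  oneBit (Nat.land a b) && oneBit (Nat.land b c) && oneBit (Nat.land a c) &&
    Nat.beq (Nat.land (Nat.land a b) c) 0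

/-- the loose path or the triangle -/
def isPC (a b c : ℕ) : Bool := isP a b c || isC a b c

/-- `full` is inside target `t` -/
def inT (L : List ℕ) (t : ℕ) : Bool := L.all (fun m => Nat.testBit t m)

/-- Exhaustive search: `I` are the chosen edges, `cand` the undecided ones. -/
def search (bad : ℕ → ℕ → ℕ → Bool) (tg : List ℕ) : ℕ → List ℕ → List ℕ → Bool
  | 0, _, _ => false
  | k + 1, I, cand =>
    Nat.ble (I.length + cand.length) 11 || tg.any (inT (I ++ cand)) ||
      match cand with
      | [] => false
      | c :: rest =>
        search bad tg k (c :: I) (rest.filter (fun d => I.all (fun i => !(bad c d i)))) &&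
        search bad tg k I rest

/-- all three-element subsets of seven vertices as bit masks -/
def tm : List ℕ := [7, 11, 19, 35, 67, 13, 21, 37, 69, 25, 41, 73, 49, 81, 97, 14, 22, 38, 70, 26,
  42, 74, 50, 82, 98, 28, 44, 76, 52, 84, 100, 56, 88, 104, 112]

/-- edges compatible with all pairs of `I` -/
def start (bad : ℕ → ℕ → ℕ → Bool) (I : List ℕ) : List ℕ :=
  tm.filter (fun d => !(I.contains d) && I.all (fun a => I.all (fun b => !(bad a b d))))

theorem search_sound (bad : ℕ → ℕ → ℕ → Bool) (tg : List ℕ) (F : Finset ℕ)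
    (hbad : ∀ a ∈ F, ∀ b ∈ F, ∀ c ∈ F, bad a b c = true → False) (hF : 12 ≤ F.card) :
    ∀ (k : ℕ) (I cand : List ℕ), search bad tg k I cand = true → (∀ i ∈ I, i ∈ F) →
      (∀ m ∈ F, m ∈ I ∨ m ∈ cand) → ∃ t ∈ tg, ∀ m ∈ F, Nat.testBit t m = true := by
  intro k
  induction k with
  | zero => intro I cand h; simp [search] at h
  | succ k ih =>
    intro I cand h hI hc
    have hsub : F ⊆ (I ++ cand).toFinset := by
      intro m hm
      simp only [List.mem_toFinset, List.mem_append]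
      exact hc m hm
    have hcard : F.card ≤ I.length + cand.length := by
      calc F.card ≤ _ := Finset.card_le_card hsub
        _ ≤ _ := List.toFinset_card_le _
        _ = _ := by simp
    unfold search at h
    rw [Bool.or_eq_true, Bool.or_eq_true] at h
    rcases h with (h | h) | h
    · have := Nat.le_of_ble_eq_true h
      omega
    · rw [List.any_eq_true] at h
      obtain ⟨t, ht, h⟩ := h
      refine ⟨t, ht, fun m hm => ?_⟩
      unfold inT at h
      rw [List.all_eq_true] at h
      exact h m (by simpa using hc m hm)
    · cases cand with
      | nil => simp at h
      | cons c rest =>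
        rw [Bool.and_eq_true] at h
        by_cases hcF : c ∈ F
        · refine ih _ _ h.1 ?_ ?_
          · intro i hi
            rcases List.mem_cons.1 hi with rfl | hi
            · exact hcF
            · exact hI i hi
          · intro m hm
            rcases hc m hm with hm' | hm'
            · left; exact List.mem_cons_of_mem _ hm'
            · rcases List.mem_cons.1 hm' with rfl | hm'
              · left; exact List.mem_cons_self
              · right
                rw [List.mem_filter]
                refine ⟨hm', ?_⟩
                rw [List.all_eq_true]
                intro i hi
                by_contra hb
                have hb' : bad c m i = true := by simpa using hb
                exact hbad c hcF m hm i (hI i hi) hb'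
        · refine ih _ _ h.2 hI ?_
          intro m hm
          rcases hc m hm with hm' | hm'
          · left; exact hm'
          · rcases List.mem_cons.1 hm' with rfl | hm'
            · exact absurd hm hcF
            · right; exact hm'

theorem search_start (bad : ℕ → ℕ → ℕ → Bool) (tg : List ℕ) (F : Finset ℕ)
    (hbad : ∀ a ∈ F, ∀ b ∈ F, ∀ c ∈ F, bad a b c = true → False) (hF : 12 ≤ F.card)
    (hsub : ∀ m ∈ F, m ∈ tm) (I : List ℕ) (hI : ∀ i ∈ I, i ∈ F)
    (h : search bad tg 40 I (start bad I) = true) :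
    ∃ t ∈ tg, ∀ m ∈ F, Nat.testBit t m = true := by
  refine search_sound bad tg F hbad hF 40 I _ h hI ?_
  intro m hm
  by_cases hmI : m ∈ I
  · left; exact hmI
  right
  unfold start
  rw [List.mem_filter]
  refine ⟨hsub m hm, ?_⟩
  rw [Bool.and_eq_true]
  refine ⟨by simpa using hmI, ?_⟩
  simp only [List.all_eq_true]
  intro a ha b hb
  by_contra hb'
  exact hbad a (hI a ha) b (hI b hb) m hm (by simpa using hb')

/-- targets for the first triangle search: code, index of the pattern, permutation -/
def tgA : List (ℕ × ℕ × List ℕ) := [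
  (10182602731058530642048, 1, [3, 0, 1, 2, 4, 5, 6]),
  (737869763120221153408, 3, [0, 3, 4, 1, 2, 5, 6]),
  (737869765594084567168, 3, [0, 3, 4, 1, 5, 2, 6]),
  (11363194349576885135488, 3, [0, 3, 4, 1, 5, 6, 2]),
  (1918461384112476809344, 2, [0, 1, 2, 3, 4, 5, 6]),
  (9592306920562453145728, 3, [0, 3, 1, 4, 2, 5, 6]),
  (147573952624412092544, 4, [0, 1, 2, 3, 4, 5, 6]),
  (1328165573616399313024, 3, [3, 0, 4, 1, 2, 5, 6]),
  (1328166699653677992064, 3, [3, 0, 4, 5, 1, 2, 6]),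
  (4837621739842491736672384, 3, [3, 0, 4, 5, 1, 6, 2]),
  (4835850853537040749316224, 3, [3, 0, 1, 2, 4, 5, 6]),
  (4837031445158033004972160, 1, [0, 3, 1, 4, 2, 5, 6]),
  (1267650602146690785609179488384, 3, [3, 4, 0, 5, 6, 1, 2]),
  (10035028796061039749248, 3, [0, 1, 3, 4, 5, 2, 6])]

set_option maxRecDepth 100000 in
theorem searchA : search isP (tgA.map Prod.fst) 40 [35, 14, 21, 67]
    (start isP [35, 14, 21, 67]) = true := by
  decide +kernel

set_option maxRecDepth 100000 in
theorem searchB : search isP (tgA.map Prod.fst) 40 [35, 14, 21, 73]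
    (start isP [35, 14, 21, 73]) = true := by
  decide +kernel

set_option maxRecDepth 100000 in
theorem searchF : search isPC [158458753062771198453921360000] 40 [7, 25]
    (start isPC [7, 25]) = true := by
  decide +kernel

end FT

namespace FT

/-! ### Basic notions -/

/-- every edge has three elements -/
def Uni (E : Finset (Finset ℕ)) : Prop := ∀ e ∈ E, e.card = 3

/-- no loose path of length three -/
def PF (E : Finset (Finset ℕ)) : Prop :=
  ∀ e ∈ E, ∀ f ∈ E, ∀ g ∈ E, (e ∩ f).card = 1 → (f ∩ g).card = 1 → e ∩ g = ∅ → False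

/-- no triangle -/
def CF (E : Finset (Finset ℕ)) : Prop :=
  ∀ e ∈ E, ∀ f ∈ E, ∀ g ∈ E, (e ∩ f).card = 1 → (f ∩ g).card = 1 → (e ∩ g).card = 1 →
    e ∩ f ∩ g = ∅ → False

/-- edges inside `A` -/
def ES (E : Finset (Finset ℕ)) (A : Finset ℕ) : Finset (Finset ℕ) := E.filter (fun e => e ⊆ A)

theorem mem_ES {E : Finset (Finset ℕ)} {A e : Finset ℕ} : e ∈ ES E A ↔ e ∈ E ∧ e ⊆ A := by
  simp [ES]

theorem Uni.mono {E F : Finset (Finset ℕ)} (h : Uni E) (hF : F ⊆ E) : Uni F :=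
  fun e he => h e (hF he)

theorem PF.mono {E F : Finset (Finset ℕ)} (h : PF E) (hF : F ⊆ E) : PF F :=
  fun e he f hf g hg => h e (hF he) f (hF hf) g (hF hg)

theorem CF.mono {E F : Finset (Finset ℕ)} (h : CF E) (hF : F ⊆ E) : CF F :=
  fun e he f hf g hg => h e (hF he) f (hF hf) g (hF hg)

theorem ES_sub (E : Finset (Finset ℕ)) (A : Finset ℕ) : ES E A ⊆ E := Finset.filter_subset _ _

/-- vertices of a bit mask -/
def S7 (m : ℕ) : Finset ℕ := (Finset.range 7).filter (fun i => Nat.testBit m i = true)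

theorem S7_inter (a b : ℕ) : S7 a ∩ S7 b = S7 (Nat.land a b) := by
  ext i
  simp only [S7, Finset.mem_inter, Finset.mem_filter]
  have : Nat.testBit (Nat.land a b) i = (Nat.testBit a i && Nat.testBit b i) :=
    Nat.testBit_and a b i
  rw [this, Bool.and_eq_true]
  tauto

theorem S7_one : ∀ m < 128, oneBit m = true → (S7 m).card = 1 := by decide +kernel

theorem S7_zero : S7 0 = ∅ := by decide +kernel

theorem tm_lt : ∀ m ∈ tm, m < 128 := by decide

theorem S7_tm : ∀ s ∈ (Finset.range 7).powersetCard 3, ∃ m ∈ tm, S7 m = s := by decide +kernel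

/-- image of a bit mask -/
def im (φ : ℕ → ℕ) (m : ℕ) : Finset ℕ := (S7 m).image φ

theorem S7_sub (m : ℕ) : S7 m ⊆ Finset.range 7 := Finset.filter_subset _ _

theorem im_inter (φ : ℕ → ℕ) (hφ : Set.InjOn φ (Finset.range 7)) (a b : ℕ) :
    im φ a ∩ im φ b = im φ (Nat.land a b) := by
  unfold im
  rw [← S7_inter, Finset.image_inter_of_injOn]
  refine hφ.mono ?_
  intro x hx
  rcases hx with hx | hx
  · exact S7_sub _ hx
  · exact S7_sub _ hx

theorem im_card (φ : ℕ → ℕ) (hφ : Set.InjOn φ (Finset.range 7)) (a : ℕ) :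
    (im φ a).card = (S7 a).card :=
  Finset.card_image_of_injOn (hφ.mono (by exact_mod_cast S7_sub a))

theorem im_one (φ : ℕ → ℕ) (hφ : Set.InjOn φ (Finset.range 7)) {a b : ℕ} (ha : a < 128)
    (h : oneBit (Nat.land a b) = true) : (im φ a ∩ im φ b).card = 1 := by
  rw [im_inter φ hφ, im_card φ hφ]
  refine S7_one _ (lt_of_le_of_lt ?_ ha) h
  exact Nat.and_le_left

theorem im_zero (φ : ℕ → ℕ) (hφ : Set.InjOn φ (Finset.range 7)) {a b : ℕ}
    (h : Nat.beq (Nat.land a b) 0 = true) : im φ a ∩ im φ b = ∅ := by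
  rw [im_inter φ hφ, Nat.eq_of_beq_eq_true h]
  simp [im, S7_zero]

theorem pth_false {E : Finset (Finset ℕ)} (hP : PF E) (φ : ℕ → ℕ)
    (hφ : Set.InjOn φ (Finset.range 7)) {a b c : ℕ} (ha : a < 128) (hb : b < 128)
    (h : pth a b c = true) (hae : im φ a ∈ E) (hbe : im φ b ∈ E) (hce : im φ c ∈ E) : False := by
  unfold pth at h
  simp only [Bool.and_eq_true] at h
  exact hP _ hae _ hbe _ hce (im_one φ hφ ha h.1.1) (im_one φ hφ hb h.1.2) (im_zero φ hφ h.2)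

theorem isP_false {E : Finset (Finset ℕ)} (hP : PF E) (φ : ℕ → ℕ)
    (hφ : Set.InjOn φ (Finset.range 7)) {a b c : ℕ} (ha : a < 128) (hb : b < 128) (hc : c < 128)
    (h : isP a b c = true) (hae : im φ a ∈ E) (hbe : im φ b ∈ E) (hce : im φ c ∈ E) : False := by
  unfold isP at h
  simp only [Bool.or_eq_true] at h
  rcases h with (h | h) | h
  · exact pth_false hP φ hφ ha hb h hae hbe hce
  · exact pth_false hP φ hφ hb ha h hbe hae hce
  · exact pth_false hP φ hφ ha hc h hae hce hbe

theorem isPC_false {E : Finset (Finset ℕ)} (hP : PF E) (hC : CF E) (φ : ℕ → ℕ)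
    (hφ : Set.InjOn φ (Finset.range 7)) {a b c : ℕ} (ha : a < 128) (hb : b < 128) (hc : c < 128)
    (h : isPC a b c = true) (hae : im φ a ∈ E) (hbe : im φ b ∈ E) (hce : im φ c ∈ E) : False := by
  unfold isPC at h
  simp only [Bool.or_eq_true] at h
  rcases h with h | h
  · exact isP_false hP φ hφ ha hb hc h hae hbe hce
  · unfold isC at h
    simp only [Bool.and_eq_true] at h
    refine hC _ hae _ hbe _ hce (im_one φ hφ ha h.1.1.1) (im_one φ hφ hb h.1.1.2)
      (im_one φ hφ ha h.1.2) ?_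
    rw [im_inter φ hφ]
    exact im_zero φ hφ h.2

theorem exists_mask {φ : ℕ → ℕ} {e : Finset ℕ} (hφ : Set.InjOn φ (Finset.range 7))
    (he : e.card = 3) (hs : e ⊆ (Finset.range 7).image φ) : ∃ m ∈ tm, im φ m = e := by
  obtain ⟨s, hs', rfl⟩ := Finset.subset_image_iff.1 hs
  have hc : s.card = 3 := by
    rw [← he, Finset.card_image_of_injOn (hφ.mono (by exact_mod_cast hs'))]
  obtain ⟨m, hm, rfl⟩ := S7_tm s (Finset.mem_powersetCard.2 ⟨by exact_mod_cast hs', hc⟩)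
  exact ⟨m, hm, rfl⟩

theorem seven (E : Finset (Finset ℕ)) (φ : ℕ → ℕ) (hφ : Set.InjOn φ (Finset.range 7))
    (hU : Uni E) (hE : ∀ e ∈ E, e ⊆ (Finset.range 7).image φ) (bad : ℕ → ℕ → ℕ → Bool)
    (tg : List ℕ)
    (hbad : ∀ a ∈ tm, ∀ b ∈ tm, ∀ c ∈ tm, bad a b c = true → im φ a ∈ E → im φ b ∈ E →
      im φ c ∈ E → False)
    (I : List ℕ) (hI : ∀ i ∈ I, i ∈ tm ∧ im φ i ∈ E) (h12 : 12 ≤ E.card)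
    (hs : search bad tg 40 I (start bad I) = true) :
    ∃ t ∈ tg, ∀ e ∈ E, ∃ m ∈ tm, e = im φ m ∧ Nat.testBit t m = true := by
  classical
  let F : Finset ℕ := tm.toFinset.filter (fun m => im φ m ∈ E)
  have hF : ∀ m, m ∈ F ↔ m ∈ tm ∧ im φ m ∈ E := by
    intro m; simp [F]
  have hcard : E.card ≤ F.card := by
    calc E.card ≤ (F.image (im φ)).card := by
          refine Finset.card_le_card ?_
          intro e he
          obtain ⟨m, hm, rfl⟩ := exists_mask hφ (hU e he) (hE e he)
          exact Finset.mem_image_of_mem _ ((hF m).2 ⟨hm, he⟩)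
      _ ≤ F.card := Finset.card_image_le
  obtain ⟨t, ht, h⟩ := search_start bad tg F
    (fun a ha b hb c hc hb' => hbad a ((hF a).1 ha).1 b ((hF b).1 hb).1 c ((hF c).1 hc).1 hb'
      ((hF a).1 ha).2 ((hF b).1 hb).2 ((hF c).1 hc).2) (h12.trans hcard)
    (fun m hm => ((hF m).1 hm).1) I (fun i hi => (hF i).2 (hI i hi)) hs
  refine ⟨t, ht, fun e he => ?_⟩
  obtain ⟨m, hm, rfl⟩ := exists_mask hφ (hU e he) (hE e he)
  exact ⟨m, hm, rfl, h m ((hF m).2 ⟨hm, he⟩)⟩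

/-- the four patterns on seven vertices -/
def pat : ℕ → ThreeGraph
  | 1 => G1 7
  | 2 => G2 7
  | 3 => G3 7
  | _ => K5plus 2

/-- the part of `E` inside `A` embeds into `Y` -/
def Emb (E : Finset (Finset ℕ)) (A : Finset ℕ) (Y : ThreeGraph) : Prop :=
  ∃ g : ℕ → ℕ, Set.InjOn g A ∧ (∀ v ∈ A, g v ∈ Y.verts) ∧ ∀ e ∈ ES E A, e.image g ∈ Y.edges

/-- the permutation given by a list -/
def pf (p : List ℕ) (i : ℕ) : ℕ := p.getD i 0

theorem tgA_ok : ∀ x ∈ tgA, (∀ m ∈ tm, Nat.testBit x.1 m = true →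
    (S7 m).image (pf x.2.2) ∈ (pat x.2.1).edges) := by
  decide +kernel

theorem tgA_inj : ∀ x ∈ tgA, (∀ i ∈ Finset.range 7, ∀ j ∈ Finset.range 7,
    pf x.2.2 i = pf x.2.2 j → i = j) := by
  decide +kernel

theorem tgA_verts : ∀ x ∈ tgA, (∀ i ∈ Finset.range 7,
    pf x.2.2 i ∈ (pat x.2.1).verts) := by
  decide +kernel

theorem tgA_idx : ∀ x ∈ tgA, x.2.1 ∈ [1, 2, 3, 4] := by
  decide +kernel

theorem sevenEmb (E : Finset (Finset ℕ)) (hU : Uni E) (hP : PF E) (φ : ℕ → ℕ)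
    (hφ : Set.InjOn φ (Finset.range 7)) (I : List ℕ)
    (hs : search isP (tgA.map Prod.fst) 40 I (start isP I) = true)
    (hI : ∀ i ∈ I, i ∈ tm ∧ im φ i ∈ E)
    (h12 : 12 ≤ (ES E ((Finset.range 7).image φ)).card) :
    ∃ i ∈ [1, 2, 3, 4], Emb E ((Finset.range 7).image φ) (pat i) := by
  have hP' := hP.mono (ES_sub E ((Finset.range 7).image φ))
  obtain ⟨t, ht, h⟩ := seven (ES E ((Finset.range 7).image φ)) φ hφ (hU.mono (ES_sub _ _))
    (fun e he => (mem_ES.1 he).2) isP (tgA.map Prod.fst)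
    (fun a ha b hb c hc => isP_false hP' φ hφ (tm_lt a ha) (tm_lt b hb) (tm_lt c hc)) I
    (fun i hi => ⟨(hI i hi).1, mem_ES.2 ⟨(hI i hi).2, Finset.image_subset_image (S7_sub i)⟩⟩)
    h12 hs
  obtain ⟨x, hx, rfl⟩ := List.mem_map.1 ht
  refine ⟨x.2.1, tgA_idx x hx, ?_⟩
  have hinv : ∀ i ∈ Finset.range 7, Function.invFunOn φ (Finset.range 7) (φ i) = i := by
    intro i hi
    exact hφ.leftInvOn_invFunOn (by exact_mod_cast hi)
  refine ⟨fun v => pf x.2.2 (Function.invFunOn φ (Finset.range 7) v), ?_, ?_, ?_⟩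
  · intro u hu v hv huv
    obtain ⟨i, hi, rfl⟩ := Finset.mem_image.1 (Finset.mem_coe.1 hu)
    obtain ⟨j, hj, rfl⟩ := Finset.mem_image.1 (Finset.mem_coe.1 hv)
    simp only [hinv i hi, hinv j hj] at huv
    rw [tgA_inj x hx i hi j hj huv]
  · intro u hu
    obtain ⟨i, hi, rfl⟩ := Finset.mem_image.1 hu
    simp only [hinv i hi]
    exact tgA_verts x hx i hi
  · intro e he
    obtain ⟨m, hm, rfl, hb⟩ := h e he
    have := tgA_ok x hx m hm hb
    convert this using 1
    unfold im
    rw [Finset.image_image]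
    refine Finset.image_congr ?_
    intro i hi
    simp only [Function.comp, hinv i (S7_sub m hi)]

theorem injOn7 {a b c d e f g : ℕ} (h : [a, b, c, d, e, f, g].Nodup) :
    Set.InjOn (pf [a, b, c, d, e, f, g]) (Finset.range 7) := by
  intro i hi j hj hij
  have hi' : i < 7 := Finset.mem_range.1 (Finset.mem_coe.1 hi)
  have hj' : j < 7 := Finset.mem_range.1 (Finset.mem_coe.1 hj)
  unfold pf at hij
  rw [List.getD_eq_getElem _ _ (by simpa using hi'),
    List.getD_eq_getElem _ _ (by simpa using hj')] at hij
  exact (h.getElem_inj_iff).1 hij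

theorem range7_image (a b c d e f g : ℕ) :
    (Finset.range 7).image (pf [a, b, c, d, e, f, g]) = {a, b, c, d, e, f, g} := by
  have : Finset.range 7 = {0, 1, 2, 3, 4, 5, 6} := by decide
  rw [this]
  simp [pf, Finset.image_insert]

theorem im_eq (a b c d e f g : ℕ) (m i j k : ℕ) (h : S7 m = {i, j, k}) :
    im (pf [a, b, c, d, e, f, g]) m = {pf [a, b, c, d, e, f, g] i, pf [a, b, c, d, e, f, g] j,
      pf [a, b, c, d, e, f, g] k} := by
  unfold im
  rw [h]
  simp [Finset.image_insert]

/-- Lemma on seven vertices with a triangle. -/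
theorem seven_tri {E : Finset (Finset ℕ)} (hU : Uni E) (hP : PF E)
    {x1 x2 x3 y1 y2 y3 w : ℕ} (hn : [x1, x2, x3, y1, y2, y3, w].Nodup)
    (h3 : {x1, x2, y3} ∈ E) (h1 : {x2, x3, y1} ∈ E) (h2 : {x1, x3, y2} ∈ E)
    (hw : {x1, x2, w} ∈ E ∨ {x1, y1, w} ∈ E)
    (h12 : 12 ≤ (ES E {x1, x2, x3, y1, y2, y3, w}).card) :
    ∃ i ∈ [1, 2, 3, 4], Emb E {x1, x2, x3, y1, y2, y3, w} (pat i) := by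
  rw [← range7_image] at h12 ⊢
  have e35 := im_eq x1 x2 x3 y1 y2 y3 w 35 0 1 5 (by decide +kernel)
  have e14 := im_eq x1 x2 x3 y1 y2 y3 w 14 1 2 3 (by decide +kernel)
  have e21 := im_eq x1 x2 x3 y1 y2 y3 w 21 0 2 4 (by decide +kernel)
  have e67 := im_eq x1 x2 x3 y1 y2 y3 w 67 0 1 6 (by decide +kernel)
  have e73 := im_eq x1 x2 x3 y1 y2 y3 w 73 0 3 6 (by decide +kernel)
  rcases hw with hw | hw
  · refine sevenEmb E hU hP _ (injOn7 hn) _ searchA ?_ h12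
    intro i hi
    simp only [List.mem_cons, List.not_mem_nil, or_false] at hi
    rcases hi with rfl | rfl | rfl | rfl
    · exact ⟨by decide, by rw [e35]; exact h3⟩
    · exact ⟨by decide, by rw [e14]; exact h1⟩
    · exact ⟨by decide, by rw [e21]; exact h2⟩
    · exact ⟨by decide, by rw [e67]; exact hw⟩
  · refine sevenEmb E hU hP _ (injOn7 hn) _ searchB ?_ h12
    intro i hi
    simp only [List.mem_cons, List.not_mem_nil, or_false] at hi
    rcases hi with rfl | rfl | rfl | rfl
    · exact ⟨by decide, by rw [e35]; exact h3⟩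
    · exact ⟨by decide, by rw [e14]; exact h1⟩
    · exact ⟨by decide, by rw [e21]; exact h2⟩
    · exact ⟨by decide, by rw [e73]; exact hw⟩

theorem star_mask : ∀ m ∈ tm, Nat.testBit 158458753062771198453921360000 m = true → 0 ∈ S7 m := by
  decide +kernel

/-- Lemma on seven vertices without triangle. -/
theorem seven_free {E : Finset (Finset ℕ)} (hU : Uni E) (hP : PF E) (hC : CF E)
    {c a b d e s t : ℕ} (hn : [c, a, b, d, e, s, t].Nodup)
    (h3 : {c, a, b} ∈ E) (h1 : {c, d, e} ∈ E)
    (h12 : 12 ≤ (ES E {c, a, b, d, e, s, t}).card) :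
    ∀ e' ∈ ES E {c, a, b, d, e, s, t}, c ∈ e' := by
  rw [← range7_image] at h12 ⊢
  have e7 := im_eq c a b d e s t 7 0 1 2 (by decide +kernel)
  have e25 := im_eq c a b d e s t 25 0 3 4 (by decide +kernel)
  have hφ := injOn7 hn
  set φ := pf [c, a, b, d, e, s, t] with hφdef
  have hP' := hP.mono (ES_sub E ((Finset.range 7).image φ))
  have hC' := hC.mono (ES_sub E ((Finset.range 7).image φ))
  obtain ⟨t', ht, h⟩ := seven (ES E ((Finset.range 7).image φ)) φ hφ (hU.mono (ES_sub _ _))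
    (fun e he => (mem_ES.1 he).2) isPC [158458753062771198453921360000]
    (fun a ha b hb c hc => isPC_false hP' hC' φ hφ (tm_lt a ha) (tm_lt b hb) (tm_lt c hc)) [7, 25]
    (by
      intro i hi
      refine ⟨?_, mem_ES.2 ⟨?_, Finset.image_subset_image (S7_sub i)⟩⟩
      · simp only [List.mem_cons, List.not_mem_nil, or_false] at hi
        rcases hi with rfl | rfl <;> decide
      · simp only [List.mem_cons, List.not_mem_nil, or_false] at hi
        rcases hi with rfl | rfl
        · rw [e7]; exact h3
        · rw [e25]; exact h1)
    h12 searchF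
  rw [List.mem_singleton] at ht
  subst ht
  intro e' he'
  obtain ⟨m, hm, rfl, hb⟩ := h e' he'
  have := star_mask m hm hb
  exact Finset.mem_image.2 ⟨0, this, by simp [hφdef, pf]⟩

end FT

namespace FT

/-! ### Toolkit -/

theorem card_inter_one {e f : Finset ℕ} {c : ℕ} (h1 : c ∈ e) (h2 : c ∈ f)
    (h : ∀ z ∈ e, z ∈ f → z = c) : (e ∩ f).card = 1 := by
  rw [Finset.card_eq_one]
  refine ⟨c, ?_⟩
  ext z
  simp only [Finset.mem_inter, Finset.mem_singleton]
  constructor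
  · rintro ⟨h3, h4⟩; exact h z h3 h4
  · rintro rfl; exact ⟨h1, h2⟩

/-- path rule in membership form -/
theorem PF.m {E : Finset (Finset ℕ)} (hP : PF E) {e f g : Finset ℕ} (he : e ∈ E) (hf : f ∈ E)
    (hg : g ∈ E) (c d : ℕ) (h1 : c ∈ e) (h2 : c ∈ f) (h3 : ∀ z ∈ e, z ∈ f → z = c)
    (h4 : d ∈ f) (h5 : d ∈ g) (h6 : ∀ z ∈ f, z ∈ g → z = d) (h7 : ∀ z ∈ e, z ∉ g) : False := by
  refine hP e he f hf g hg (card_inter_one h1 h2 h3) (card_inter_one h4 h5 h6) ?_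
  ext z
  simp only [Finset.mem_inter, Finset.notMem_empty, iff_false, not_and]
  exact h7 z

theorem exists_other {e : Finset ℕ} (he : e.card = 3) {v : ℕ} (hv : v ∈ e) :
    ∃ x y, x ≠ y ∧ x ≠ v ∧ y ≠ v ∧ e = {v, x, y} := by
  have : (e.erase v).card = 2 := by rw [Finset.card_erase_of_mem hv, he]
  obtain ⟨x, y, hxy, h⟩ := Finset.card_eq_two.1 this
  have hx : x ∈ e.erase v := by rw [h]; simp
  have hy : y ∈ e.erase v := by rw [h]; simp
  refine ⟨x, y, hxy, (Finset.mem_erase.1 hx).1, (Finset.mem_erase.1 hy).1, ?_⟩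
  rw [← h, Finset.insert_erase hv]

theorem exists_third {e : Finset ℕ} (he : e.card = 3) {v x : ℕ} (hv : v ∈ e) (hx : x ∈ e)
    (hvx : x ≠ v) : ∃ y, x ≠ y ∧ y ≠ v ∧ e = {v, x, y} := by
  obtain ⟨a, b, hab, hav, hbv, rfl⟩ := exists_other he hv
  simp only [Finset.mem_insert, Finset.mem_singleton] at hx
  rcases hx with rfl | rfl | rfl
  · exact absurd rfl hvx
  · exact ⟨b, hab, hbv, rfl⟩
  · refine ⟨a, hab.symm, hav, ?_⟩
    rw [Finset.pair_comm]

theorem card3 {a b c : ℕ} (h1 : a ≠ b) (h2 : a ≠ c) (h3 : b ≠ c) :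
    ({a, b, c} : Finset ℕ).card = 3 := by
  rw [Finset.card_eq_three]; exact ⟨a, b, c, h1, h2, h3, rfl⟩

theorem card3_ne {a b c : ℕ} (h : ({a, b, c} : Finset ℕ).card = 3) : a ≠ b ∧ a ≠ c ∧ b ≠ c := by
  refine ⟨?_, ?_, ?_⟩
  · rintro rfl
    have : ({a, a, c} : Finset ℕ).card ≤ 2 := by simpa using Finset.card_le_two
    omega
  · rintro rfl
    have : ({a, b, a} : Finset ℕ) = {a, b} := by ext; simp; tauto
    have h2 : ({a, b} : Finset ℕ).card ≤ 2 := Finset.card_le_two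
    rw [this] at h; omega
  · rintro rfl
    have : ({a, b, b} : Finset ℕ) = {a, b} := by ext; simp
    have h2 : ({a, b} : Finset ℕ).card ≤ 2 := Finset.card_le_two
    rw [this] at h; omega

/-- two edges with a common vertex outside `h` -/
theorem badstep {E : Finset (Finset ℕ)} (hP : PF E) (hC : CF E) (hU : Uni E) {e f h : Finset ℕ}
    {v : ℕ} (he : e ∈ E) (hf : f ∈ E) (hh : h ∈ E) (hve : v ∈ e) (hvf : v ∈ f) (hvh : v ∉ h)
    (hef : ∀ z ∈ e, z ∈ f → z = v) (h1 : (e ∩ h).card = 1) : ∀ z ∈ f, z ≠ v → z ∈ h := by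
  have h2 : f ∩ h ⊆ f.erase v := by
    intro z hz
    rw [Finset.mem_inter] at hz
    refine Finset.mem_erase.2 ⟨?_, hz.1⟩
    rintro rfl; exact hvh hz.2
  have h3 : (f.erase v).card = 2 := by rw [Finset.card_erase_of_mem hvf, hU f hf]
  have h4 := Finset.card_le_card h2
  have h5 : (f ∩ h).card = 2 := by
    by_contra hne
    have hcase : (f ∩ h).card = 0 ∨ (f ∩ h).card = 1 := by omega
    rcases hcase with h0 | h0
    · refine hP h hh e he f hf (by rw [Finset.inter_comm]; exact h1)
        (card_inter_one hve hvf hef) ?_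
      rw [Finset.inter_comm]; exact Finset.card_eq_zero.1 h0
    · refine hC h hh e he f hf (by rw [Finset.inter_comm]; exact h1)
        (card_inter_one hve hvf hef) (by rw [Finset.inter_comm]; exact h0) ?_
      ext z
      simp only [Finset.mem_inter, Finset.notMem_empty, iff_false]
      rintro ⟨⟨hz1, hz2⟩, hz3⟩
      have := hef z hz2 hz3
      subst this
      exact hvh hz1
  have h6 : f ∩ h = f.erase v := Finset.eq_of_subset_of_card_le h2 (by omega)
  intro z hz hzv
  have : z ∈ f ∩ h := by rw [h6]; exact Finset.mem_erase.2 ⟨hzv, hz⟩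
  exact (Finset.mem_inter.1 this).2

/-- degree -/
def deg (E : Finset (Finset ℕ)) (v : ℕ) : ℕ := (E.filter (fun e => v ∈ e)).card

/-- codegree -/
def codeg (E : Finset (Finset ℕ)) (u v : ℕ) : ℕ := (E.filter (fun e => u ∈ e ∧ v ∈ e)).card

theorem sum_deg {E : Finset (Finset ℕ)} {V : Finset ℕ} (hU : Uni E) (hV : ∀ e ∈ E, e ⊆ V) :
    ∑ v ∈ V, deg E v = 3 * E.card := by
  have h := Finset.sum_card_bipartiteAbove_eq_sum_card_bipartiteBelow
    (s := V) (t := E) (fun v e => v ∈ e)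
  unfold Finset.bipartiteAbove Finset.bipartiteBelow at h
  unfold deg
  rw [h, mul_comm, ← smul_eq_mul, ← Finset.sum_const]
  refine Finset.sum_congr rfl ?_
  intro e he
  have : V.filter (fun v => v ∈ e) = e := by
    ext z; simp only [Finset.mem_filter]
    exact ⟨fun h => h.2, fun h => ⟨hV e he h, h⟩⟩
  rw [this, hU e he]

theorem sum_codeg {E : Finset (Finset ℕ)} {A : Finset ℕ} {v : ℕ} (hU : Uni E)
    (hV : ∀ e ∈ E, v ∈ e → e.erase v ⊆ A) (hvA : v ∉ A) :
    ∑ u ∈ A, codeg E u v = 2 * deg E v := by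
  have h := Finset.sum_card_bipartiteAbove_eq_sum_card_bipartiteBelow
    (s := A) (t := E.filter (fun e => v ∈ e)) (fun u e => u ∈ e)
  unfold Finset.bipartiteAbove Finset.bipartiteBelow at h
  unfold deg codeg
  rw [mul_comm, ← smul_eq_mul, ← Finset.sum_const]
  have h2 : ∑ u ∈ A, (E.filter (fun e => u ∈ e ∧ v ∈ e)).card =
      ∑ u ∈ A, ((E.filter (fun e => v ∈ e)).filter (fun e => u ∈ e)).card := by
    refine Finset.sum_congr rfl ?_
    intro u _
    congr 1
    rw [Finset.filter_filter]
    ext e; simp only [Finset.mem_filter]; tauto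
  rw [h2, h]
  refine Finset.sum_congr rfl ?_
  intro e he
  rw [Finset.mem_filter] at he
  have : A.filter (fun u => u ∈ e) = e.erase v := by
    ext z; simp only [Finset.mem_filter, Finset.mem_erase]
    constructor
    · rintro ⟨h1, h2⟩
      refine ⟨?_, h2⟩
      rintro rfl; exact hvA h1
    · rintro ⟨h1, h2⟩
      exact ⟨hV e he.1 he.2 (Finset.mem_erase.2 ⟨h1, h2⟩), h2⟩
  rw [this, Finset.card_erase_of_mem he.2, hU e he.1]

/-- edges meeting `A` -/
def hit (E : Finset (Finset ℕ)) (A : Finset ℕ) : Finset (Finset ℕ) :=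
  E.filter (fun e => ¬ Disjoint e A)

/-- edges avoiding `A` -/
def avoid (E : Finset (Finset ℕ)) (A : Finset ℕ) : Finset (Finset ℕ) :=
  E.filter (fun e => Disjoint e A)

theorem avoid_sub (E : Finset (Finset ℕ)) (A : Finset ℕ) : avoid E A ⊆ E :=
  Finset.filter_subset _ _

theorem card_hit_avoid (E : Finset (Finset ℕ)) (A : Finset ℕ) :
    E.card = (avoid E A).card + (hit E A).card :=
  (Finset.card_filter_add_card_filter_not (s := E) (fun e => Disjoint e A)).symm

theorem mem_avoid {E : Finset (Finset ℕ)} {A e : Finset ℕ} :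
    e ∈ avoid E A ↔ e ∈ E ∧ Disjoint e A := by simp [avoid]

theorem mem_hit {E : Finset (Finset ℕ)} {A e : Finset ℕ} :
    e ∈ hit E A ↔ e ∈ E ∧ ∃ z ∈ e, z ∈ A := by
  simp [hit, Finset.not_disjoint_iff]

theorem avoid_vert {E : Finset (Finset ℕ)} {A V : Finset ℕ} (hV : ∀ e ∈ E, e ⊆ V) :
    ∀ e ∈ avoid E A, e ⊆ V \ A := by
  intro e he
  rw [mem_avoid] at he
  exact Finset.subset_sdiff.2 ⟨hV e he.1, he.2⟩

/-- a family without two edges meeting in exactly one vertex has at most `n` edges -/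
theorem noP2_card : ∀ (n : ℕ) (V : Finset ℕ) (E : Finset (Finset ℕ)), V.card = n → Uni E →
    (∀ e ∈ E, e ⊆ V) → (∀ e ∈ E, ∀ f ∈ E, (e ∩ f).card ≠ 1) → E.card ≤ n := by
  intro n
  induction n using Nat.strong_induction_on with
  | _ n ih =>
  intro V E hn hU hV hE
  by_cases hd : ∃ v ∈ V, deg E v ≤ 1
  · obtain ⟨v, hv, hdv⟩ := hd
    have hlt : (V \ {v}).card = n - 1 := by
      rw [Finset.card_sdiff_of_subset (by simpa using hv), hn]; simp
    have hpos : 0 < V.card := Finset.card_pos.2 ⟨v, hv⟩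
    have := ih (n - 1) (by omega) (V \ {v}) (avoid E {v}) hlt (hU.mono (avoid_sub _ _))
      (avoid_vert hV) (fun e he f hf => hE e (avoid_sub _ _ he) f (avoid_sub _ _ hf))
    have h2 := card_hit_avoid E {v}
    have h3 : (hit E {v}).card = deg E v := by
      unfold hit deg
      congr 1
      ext e; simp
    omega
  · push Not at hd
    have hmeet : ∀ e ∈ E, ∀ f ∈ E, ∀ z, z ∈ e → z ∈ f → e ≠ f → (e ∩ f).card = 2 := by
      intro e he f hf z hze hzf hne
      have h1 := hE e he f hf
      have h0 : 0 < (e ∩ f).card := Finset.card_pos.2 ⟨z, Finset.mem_inter.2 ⟨hze, hzf⟩⟩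
      have h3 : (e ∩ f).card ≤ e.card := Finset.card_le_card Finset.inter_subset_left
      have h4 : (e ∩ f).card ≠ 3 := by
        intro h5
        have h6 : e ∩ f = e := Finset.eq_of_subset_of_card_le Finset.inter_subset_left
          (by rw [h5, hU e he])
        have h7 : e ∩ f = f := Finset.eq_of_subset_of_card_le Finset.inter_subset_right
          (by rw [h5, hU f hf])
        exact hne (h6.symm.trans h7)
      rw [hU e he] at h3
      omega
    have key : ∀ v ∈ V, deg E v ≤ 3 := by
      intro v hv
      by_contra hlt
      push Not at hlt
      -- at least four edges at `v`
      have hne : (E.filter (fun e => v ∈ e)).Nonempty := by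
        rw [← Finset.card_pos]; unfold deg at hlt; omega
      obtain ⟨e1, he1⟩ := hne
      rw [Finset.mem_filter] at he1
      obtain ⟨a, b, hab, hav, hbv, rfl⟩ := exists_other (hU e1 he1.1) he1.2
      -- a second edge
      have hsplit : E.filter (fun e => v ∈ e) ⊆ insert {v, a, b}
          ((E.filter (fun e => v ∈ e ∧ a ∈ e ∧ b ∉ e)) ∪
            (E.filter (fun e => v ∈ e ∧ b ∈ e ∧ a ∉ e))) := by
        intro f hf
        rw [Finset.mem_filter] at hf
        by_cases hfe : f = {v, a, b}
        · rw [hfe]; exact Finset.mem_insert_self _ _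
        · refine Finset.mem_insert_of_mem ?_
          have h2 := hmeet _ he1.1 f hf.1 v (by simp) hf.2 (Ne.symm hfe)
          simp only [Finset.mem_union, Finset.mem_filter]
          by_cases ha : a ∈ f <;> by_cases hb : b ∈ f
          · exfalso; apply hfe
            symm
            refine Finset.eq_of_subset_of_card_le ?_ ?_
            · intro z hz; simp only [Finset.mem_insert, Finset.mem_singleton] at hz
              rcases hz with rfl | rfl | rfl
              · exact hf.2
              · exact ha
              · exact hb
            · rw [hU f hf.1, hU _ he1.1]
          · left; exact ⟨hf.1, hf.2, ha, hb⟩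
          · right; exact ⟨hf.1, hf.2, hb, ha⟩
          · exfalso
            have : ({v, a, b} ∩ f : Finset ℕ) ⊆ {v} := by
              intro z hz
              simp only [Finset.mem_inter, Finset.mem_insert, Finset.mem_singleton] at hz ⊢
              rcases hz with ⟨rfl | rfl | rfl, h3⟩
              · rfl
              · exact absurd h3 ha
              · exact absurd h3 hb
            have := Finset.card_le_card this
            rw [Finset.card_singleton] at this; omega
      -- a pair of codegree at least three is impossible
      have hcod : ∀ p q c d e : ℕ, {p, q, c} ∈ E → {p, q, d} ∈ E → {p, q, e} ∈ E → c ≠ d →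
          c ≠ e → d ≠ e → False := by
        intro p q c d e hc hd' he hcd hce hde
        have n1 := card3_ne (hU _ hc)
        have n2 := card3_ne (hU _ hd')
        have n3 := card3_ne (hU _ he)
        have hcV : c ∈ V := hV _ hc (by simp)
        have h2 := hd c hcV
        have : ∃ f ∈ E.filter (fun e => c ∈ e), f ≠ {p, q, c} := by
          by_contra hcon
          push Not at hcon
          have : E.filter (fun e => c ∈ e) ⊆ {{p, q, c}} := by
            intro f hf; rw [Finset.mem_singleton]; exact hcon f hf
          have := Finset.card_le_card this
          unfold deg at h2
          rw [Finset.card_singleton] at this; omega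
        obtain ⟨f, hf, hfne⟩ := this
        rw [Finset.mem_filter] at hf
        obtain ⟨s, t, hst, hsc, htc, rfl⟩ := exists_other (hU f hf.1) hf.2
        have m1 := hmeet _ hf.1 _ hc c (by simp) (by simp) hfne
        have aux : ∀ s t, s ≠ t → s ≠ c → t ≠ c → {c, s, t} ∈ E → (s = p ∨ s = q) →
            {c, s, t} ≠ ({p, q, c} : Finset ℕ) → False := by
          intro s t hst hsc htc hf hs hfne
          have ht : t ≠ p ∧ t ≠ q := by
            constructor
            · rintro rfl
              rcases hs with rfl | rfl
              · exact hst rfl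
              · apply hfne; ext; simp; tauto
            · rintro rfl
              rcases hs with rfl | rfl
              · apply hfne; ext; simp; tauto
              · exact hst rfl
          have k1 := hE _ hf _ hd'
          have k2 := hE _ hf _ he
          have htd : t = d := by
            by_contra htd
            apply k1
            rcases hs with rfl | rfl
            · exact card_inter_one (c := s) (by simp) (by simp) (by grind)
            · exact card_inter_one (c := s) (by simp) (by simp) (by grind)
          have hte : t = e := by
            by_contra htd
            apply k2
            rcases hs with rfl | rfl
            · exact card_inter_one (c := s) (by simp) (by simp) (by grind)
            · exact card_inter_one (c := s) (by simp) (by simp) (by grind)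
          exact hde (htd.symm.trans hte)
        by_cases hs : s = p ∨ s = q
        · exact aux s t hst hsc htc hf.1 hs hfne
        · by_cases ht : t = p ∨ t = q
          · refine aux t s hst.symm htc hsc ?_ ht ?_
            · rw [Finset.pair_comm]; exact hf.1
            · rw [Finset.pair_comm]; exact hfne
          · have : ({c, s, t} ∩ {p, q, c} : Finset ℕ) ⊆ {c} := by
              intro z hz
              simp only [Finset.mem_inter, Finset.mem_insert, Finset.mem_singleton] at hz ⊢
              grind
            have := Finset.card_le_card this
            rw [Finset.card_singleton] at this; omega
      have hA : ∀ a b, {v, a, b} ∈ E → a ≠ b → a ≠ v → b ≠ v →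
          (E.filter (fun e => v ∈ e ∧ a ∈ e ∧ b ∉ e)).card ≤ 1 := by
        intro a b he1 hab hav hbv
        rw [Finset.card_le_one]
        intro f hf g hg
        rw [Finset.mem_filter] at hf hg
        obtain ⟨s, has, hsv, rfl⟩ := exists_third (hU _ hf.1) hf.2.1 hf.2.2.1 hav
        obtain ⟨t, hat, htv, rfl⟩ := exists_third (hU _ hg.1) hg.2.1 hg.2.2.1 hav
        by_contra hne
        refine hcod v a b s t he1 hf.1 hg.1 ?_ ?_ ?_
        · rintro rfl; exact hf.2.2.2 (by simp)
        · rintro rfl; exact hg.2.2.2 (by simp)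
        · rintro rfl; exact hne rfl
      have c1 := hA a b he1.1 hab hav hbv
      have c2 := hA b a (by rw [Finset.pair_comm]; exact he1.1) hab.symm hbv hav
      have c3 := Finset.card_le_card hsplit
      have c4 := Finset.card_insert_le ({v, a, b} : Finset ℕ)
        ((E.filter (fun e => v ∈ e ∧ a ∈ e ∧ b ∉ e)) ∪
            (E.filter (fun e => v ∈ e ∧ b ∈ e ∧ a ∉ e)))
      have c5 := Finset.card_union_le (E.filter (fun e => v ∈ e ∧ a ∈ e ∧ b ∉ e))
            (E.filter (fun e => v ∈ e ∧ b ∈ e ∧ a ∉ e))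
      unfold deg at hlt
      omega
    have hs := sum_deg hU hV
    have hle : ∑ v ∈ V, deg E v ≤ ∑ v ∈ V, 3 := Finset.sum_le_sum key
    simp only [Finset.sum_const, smul_eq_mul] at hle
    omega

end FT

namespace FT

/-! ### Triangle-free case without a large flower -/

/-- three edges through `v` otherwise disjoint -/
def M3 (E : Finset (Finset ℕ)) (v : ℕ) : Prop :=
  ∃ e ∈ E, ∃ f ∈ E, ∃ g ∈ E, v ∈ e ∧ v ∈ f ∧ v ∈ g ∧ (∀ z ∈ e, z ∈ f → z = v) ∧
    (∀ z ∈ e, z ∈ g → z = v) ∧ (∀ z ∈ f, z ∈ g → z = v)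

theorem pick_codeg {E : Finset (Finset ℕ)} (hU : Uni E) {u v : ℕ} (huv : u ≠ v) (S : Finset ℕ)
    (hS : S.card < codeg E u v) : ∃ x, x ∉ S ∧ x ≠ u ∧ x ≠ v ∧ {u, v, x} ∈ E := by
  by_contra hcon
  push Not at hcon
  have : E.filter (fun e => u ∈ e ∧ v ∈ e) ⊆ S.image (fun x => {u, v, x}) := by
    intro e he
    rw [Finset.mem_filter] at he
    obtain ⟨y, h1, h2, rfl⟩ := exists_third (hU e he.1) he.2.1 he.2.2 huv.symm
    rw [Finset.mem_image]
    refine ⟨y, ?_, rfl⟩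
    by_contra hy
    exact hcon y hy h2 h1.symm he.1
  have h1 := Finset.card_le_card this
  have h2 : (S.image (fun x => ({u, v, x} : Finset ℕ))).card ≤ S.card := Finset.card_image_le
  unfold codeg at hS
  omega

theorem codeg_comm (E : Finset (Finset ℕ)) (u v : ℕ) : codeg E u v = codeg E v u := by
  unfold codeg; congr 1; ext e; simp only [Finset.mem_filter]; tauto

theorem eq3 {e : Finset ℕ} (he : e.card = 3) {a b c : ℕ} (ha : a ∈ e) (hb : b ∈ e) (hc : c ∈ e)
    (h1 : a ≠ b) (h2 : a ≠ c) (h3 : b ≠ c) : e = {a, b, c} := by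
  symm
  refine Finset.eq_of_subset_of_card_le ?_ ?_
  · intro z hz; simp only [Finset.mem_insert, Finset.mem_singleton] at hz
    rcases hz with rfl | rfl | rfl <;> assumption
  · rw [he, card3 h1 h2 h3]

theorem avoidS {E : Finset (Finset ℕ)} (hP : PF E) (hC : CF E) (hU : Uni E) {u v x : ℕ}
    {e h : Finset ℕ} (he : e ∈ E) (hh : h ∈ E) (hf : {u, v, x} ∈ E) (hve : v ∈ e) (hue : u ∉ e)
    (hvh : v ∉ h) (huh : u ∉ h) (hxh : x ∈ h) (hxe : x ∉ e) : ∀ z ∈ e, z ≠ v → z ∈ h := by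
  refine badstep hP hC hU hf he hh (by simp) hve hvh ?_ ?_
  · intro z hz hze
    simp only [Finset.mem_insert, Finset.mem_singleton] at hz
    grind
  · refine card_inter_one (c := x) (by simp) hxh ?_
    intro z hz hze
    simp only [Finset.mem_insert, Finset.mem_singleton] at hz
    grind

theorem extra_sub {E : Finset (Finset ℕ)} (hP : PF E) (hC : CF E) (hU : Uni E) {u v : ℕ}
    {e e' : Finset ℕ} (huv : u ≠ v) (h5 : 5 ≤ codeg E u v)
    (he : e ∈ E) (he' : e' ∈ E) (hve : v ∈ e) (hue : u ∉ e) (hue' : u ∈ e') (hve' : v ∉ e') :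
    ∀ z ∈ e, z ≠ v → z ∈ e' := by
  have hc : ((e.erase v) ∪ (e'.erase u)).card < codeg E u v := by
    have := Finset.card_union_le (e.erase v) (e'.erase u)
    rw [Finset.card_erase_of_mem hve, Finset.card_erase_of_mem hue', hU _ he, hU _ he'] at this
    omega
  obtain ⟨x, hx, hxu, hxv, hf⟩ := pick_codeg hU huv _ hc
  simp only [Finset.mem_union, Finset.mem_erase] at hx
  push Not at hx
  have hxe : x ∉ e := fun h => hx.1 hxv h
  have hxe' : x ∉ e' := fun h => hx.2 hxu h
  refine badstep hP hC hU hf he he' (by simp) hve hve' ?_ ?_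
  · intro z hz hze
    simp only [Finset.mem_insert, Finset.mem_singleton] at hz
    grind
  · refine card_inter_one (c := u) (by simp) hue' ?_
    intro z hz hze
    simp only [Finset.mem_insert, Finset.mem_singleton] at hz
    grind

theorem deg_le_of_sub {E : Finset (Finset ℕ)} {x : ℕ} (S : Finset (Finset ℕ)) 
    (h : ∀ g ∈ E, x ∈ g → g ∈ S) : deg E x ≤ S.card := by
  unfold deg
  refine Finset.card_le_card ?_
  intro g hg
  rw [Finset.mem_filter] at hg
  exact h g hg.1 hg.2

theorem nm3 {a b c d : ℕ} (h1 : a ≠ b) (h2 : a ≠ c) (h3 : a ≠ d) : a ∉ ({b, c, d} : Finset ℕ) := by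
  simp only [Finset.mem_insert, Finset.mem_singleton, not_or]; exact ⟨h1, h2, h3⟩

theorem caseA_both {E : Finset (Finset ℕ)} {V : Finset ℕ} (hP : PF E) (hC : CF E) (hU : Uni E)
    (hV : ∀ e ∈ E, e ⊆ V) (hd : ∀ x ∈ V, 3 ≤ deg E x) {u v : ℕ}
    {e e' : Finset ℕ} (huv : u ≠ v) (h5 : 5 ≤ codeg E u v)
    (he : e ∈ E) (he' : e' ∈ E) (hve : v ∈ e) (hue : u ∉ e) (hue' : u ∈ e') (hve' : v ∉ e') :
    False := by
  obtain ⟨y, z, hyz, hyv, hzv, rfl⟩ := exists_other (hU e he) hve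
  have s1 := extra_sub hP hC hU huv h5 he he' hve hue hue' hve'
  have hyu : y ≠ u := by rintro rfl; exact hue (by simp)
  have hzu : z ≠ u := by rintro rfl; exact hue (by simp)
  have hy' : y ∈ e' := s1 y (by simp) hyv
  have hz' : z ∈ e' := s1 z (by simp) hzv
  have he3 := eq3 (hU _ he') hue' hy' hz' hyu.symm hzu.symm hyz
  subst he3
  have hc : ({y, z} : Finset ℕ).card < codeg E u v := by
    have : ({y, z} : Finset ℕ).card ≤ 2 := Finset.card_le_two
    omega
  obtain ⟨x, hx, hxu, hxv, hf⟩ := pick_codeg hU huv _ hc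
  simp only [Finset.mem_insert, Finset.mem_singleton, not_or] at hx
  have hxe : x ∉ ({v, y, z} : Finset ℕ) := nm3 (by grind) (by grind) (by grind)
  have hxe' : x ∉ ({u, y, z} : Finset ℕ) := nm3 (by grind) (by grind) (by grind)
  have := hd x (hV _ hf (by simp))
  have h2 := deg_le_of_sub (E := E) (x := x) {{u, v, x}, {x, y, z}} ?_
  · have : ({{u, v, x}, {x, y, z}} : Finset (Finset ℕ)).card ≤ 2 := Finset.card_le_two
    omega
  intro g hg hxg
  simp only [Finset.mem_insert, Finset.mem_singleton]
  by_cases hug : u ∈ g <;> by_cases hvg : v ∈ g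
  · left; exact eq3 (hU _ hg) hug hvg hxg huv hxu.symm hxv.symm
  · exfalso
    have k := extra_sub hP hC hU huv.symm (by rw [codeg_comm]; exact h5) hg he hug hvg hve hue
    exact hxe (k x hxg hxu)
  · exfalso
    have k := extra_sub hP hC hU huv h5 hg he' hvg hug hue' hve'
    exact hxe' (k x hxg hxv)
  · right
    have k := avoidS hP hC hU he hg hf hve hue hvg hug hxg hxe
    exact eq3 (hU _ hg) hxg (k y (by simp) hyv) (k z (by simp) hzv) hx.1 hx.2 hyz

set_option maxHeartbeats 1000000 in
theorem caseA_one {E : Finset (Finset ℕ)} {V : Finset ℕ} (hP : PF E) (hC : CF E) (hU : Uni E)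
    (hV : ∀ e ∈ E, e ⊆ V) (hd : ∀ x ∈ V, 3 ≤ deg E x) {a b : ℕ}
    {e : Finset ℕ} (hab : b ≠ a) (h5 : 5 ≤ codeg E b a) (hM : ¬ M3 E a)
    (hb : ∀ g ∈ E, b ∈ g → a ∈ g)
    (he : e ∈ E) (hve : a ∈ e) (hue : b ∉ e) : False := by
  have share : ∀ e ∈ E, ∀ f ∈ E, a ∈ e → a ∈ f → b ∉ e → b ∉ f → ∃ z ∈ e, z ∈ f ∧ z ≠ a := by
    intro e he f hf hae haf hbe hbf
    by_contra hcon
    push Not at hcon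
    have hc : ((e.erase a) ∪ (f.erase a)).card < codeg E b a := by
      have := Finset.card_union_le (e.erase a) (f.erase a)
      rw [Finset.card_erase_of_mem hae, Finset.card_erase_of_mem haf, hU _ he, hU _ hf] at this
      omega
    obtain ⟨x, hx, hxu, hxv, hg⟩ := pick_codeg hU hab _ hc
    simp only [Finset.mem_union, Finset.mem_erase] at hx
    push Not at hx
    have hxe : x ∉ e := fun h => hx.1 hxv h
    have hxe' : x ∉ f := fun h => hx.2 hxv h
    refine hM ⟨e, he, f, hf, _, hg, hae, haf, by simp, hcon, ?_, ?_⟩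
    · intro z hz hze
      simp only [Finset.mem_insert, Finset.mem_singleton] at hze
      grind
    · intro z hz hze
      simp only [Finset.mem_insert, Finset.mem_singleton] at hze
      grind
  obtain ⟨y, z, hyz, hya, hza, rfl⟩ := exists_other (hU e he) hve
  have hyb : y ≠ b := by rintro rfl; exact hue (by simp)
  have hzb : z ≠ b := by rintro rfl; exact hue (by simp)
  have struct : ∀ x, x ≠ y → x ≠ z → x ≠ a → x ≠ b → {b, a, x} ∈ E → ∀ g ∈ E, x ∈ g →
      g ∈ ({{b, a, x}, {a, x, y}, {a, x, z}, {x, y, z}} : Finset (Finset ℕ)) := by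
    intro x hxy hxz hxa hxb hf g hg hxg
    have hxe : x ∉ ({a, y, z} : Finset ℕ) := nm3 (by grind) (by grind) (by grind)
    simp only [Finset.mem_insert, Finset.mem_singleton]
    by_cases hbg : b ∈ g
    · left; exact eq3 (hU _ hg) hbg (hb g hg hbg) hxg hab hxb.symm hxa.symm
    · by_cases hag : a ∈ g
      · obtain ⟨w, hw1, hw2, hw3⟩ := share _ he g hg (by simp) hag hue hbg
        simp only [Finset.mem_insert, Finset.mem_singleton] at hw1
        rcases hw1 with rfl | rfl | rfl
        · exact absurd rfl hw3
        · right; left; exact eq3 (hU _ hg) hag hxg hw2 hxa.symm hw3.symm hxy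
        · right; right; left; exact eq3 (hU _ hg) hag hxg hw2 hxa.symm hw3.symm hxz
      · right; right; right
        have k := avoidS hP hC hU he hg hf hve hue hag hbg hxg hxe
        exact eq3 (hU _ hg) hxg (k y (by simp) hya) (k z (by simp) hza) hxy hxz hyz
  have two : ∀ x, x ≠ y → x ≠ z → x ≠ a → x ≠ b → {b, a, x} ∈ E →
      ({a, x, y} ∈ E ∨ {a, x, z} ∈ E) ∧ ({x, y, z} ∈ E ∨ ({a, x, y} ∈ E ∧ {a, x, z} ∈ E)) := by
    intro x hxy hxz hxa hxb hf
    have st := struct x hxy hxz hxa hxb hf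
    have h3 := hd x (hV _ hf (by simp))
    have key : ∀ p q : Finset ℕ, (∀ g ∈ E, x ∈ g → g = p ∨ g = q) → False := by
      intro p q hpq
      have h2 := deg_le_of_sub (E := E) (x := x) {p, q} (by
        intro g hg hxg; simpa using hpq g hg hxg)
      have : ({p, q} : Finset (Finset ℕ)).card ≤ 2 := Finset.card_le_two
      omega
    simp only [Finset.mem_insert, Finset.mem_singleton] at st
    constructor
    · by_contra hcon
      push Not at hcon
      refine key {b, a, x} {x, y, z} ?_
      intro g hg hxg
      rcases st g hg hxg with rfl | rfl | rfl | rfl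
      · left; rfl
      · exact absurd hg hcon.1
      · exact absurd hg hcon.2
      · right; rfl
    · by_contra hcon
      push Not at hcon
      by_cases hy : {a, x, y} ∈ E
      · refine key {b, a, x} {a, x, y} ?_
        intro g hg hxg
        rcases st g hg hxg with rfl | rfl | rfl | rfl
        · left; rfl
        · right; rfl
        · exact absurd hg (hcon.2 hy)
        · exact absurd hg hcon.1
      · refine key {b, a, x} {a, x, z} ?_
        intro g hg hxg
        rcases st g hg hxg with rfl | rfl | rfl | rfl
        · left; rfl
        · exact absurd hg hy
        · right; rfl
        · exact absurd hg hcon.1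
  have noxyz : ∀ x x', x ≠ y → x ≠ z → x ≠ a → x ≠ b → {b, a, x} ∈ E →
      x' ≠ y → x' ≠ z → x' ≠ a → x' ≠ b → {b, a, x'} ∈ E → x ≠ x' → {x, y, z} ∉ E := by
    intro x x' hxy hxz hxa hxb hf hxy' hxz' hxa' hxb' hf' hne hin
    have h1 := (two x' hxy' hxz' hxa' hxb' hf').1
    rcases h1 with h1 | h1
    · have k := avoidS hP hC hU h1 hin hf (by simp) (nm3 (by grind) (by grind) (by grind)) (nm3 (by grind) (by grind) (by grind))
        (nm3 (by grind) (by grind) (by grind)) (by simp) (nm3 (by grind) (by grind) (by grind)) x' (by simp) hxa'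
      simp only [Finset.mem_insert, Finset.mem_singleton] at k; grind
    · have k := avoidS hP hC hU h1 hin hf (by simp) (nm3 (by grind) (by grind) (by grind)) (nm3 (by grind) (by grind) (by grind))
        (nm3 (by grind) (by grind) (by grind)) (by simp) (nm3 (by grind) (by grind) (by grind)) x' (by simp) hxa'
      simp only [Finset.mem_insert, Finset.mem_singleton] at k; grind
  obtain ⟨x, hx, hxb, hxa, hf⟩ := pick_codeg hU hab {y, z} (by
    have : ({y, z} : Finset ℕ).card ≤ 2 := Finset.card_le_two
    omega)
  obtain ⟨x', hx', hxb', hxa', hf'⟩ := pick_codeg hU hab {y, z, x} (by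
    have : ({y, z, x} : Finset ℕ).card ≤ 3 := Finset.card_le_three
    omega)
  simp only [Finset.mem_insert, Finset.mem_singleton, not_or] at hx hx'
  have n1 := noxyz x x' hx.1 hx.2 hxa hxb hf hx'.1 hx'.2.1 hxa' hxb' hf' (Ne.symm hx'.2.2)
  have n2 := noxyz x' x hx'.1 hx'.2.1 hxa' hxb' hf' hx.1 hx.2 hxa hxb hf hx'.2.2
  have t1 := ((two x hx.1 hx.2 hxa hxb hf).2.resolve_left n1).1
  have t2 := ((two x' hx'.1 hx'.2.1 hxa' hxb' hf').2.resolve_left n2).2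
  obtain ⟨w, hw1, hw2, hw3⟩ := share _ t1 _ t2 (by simp) (by simp) (nm3 (by grind) (by grind) (by grind)) (nm3 (by grind) (by grind) (by grind))
  simp only [Finset.mem_insert, Finset.mem_singleton] at hw1 hw2
  grind

theorem caseA_none {E : Finset (Finset ℕ)} {V : Finset ℕ} (hP : PF E) (hU : Uni E)
    (hV : ∀ e ∈ E, e ⊆ V) (hn : V.card ≤ 13) {u v : ℕ}
    (huv : u ≠ v) (h8 : 8 ≤ deg E v)
    (h1 : ∀ g ∈ E, u ∈ g → v ∈ g) (h2 : ∀ g ∈ E, v ∈ g → u ∈ g) :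
    E.card + 4 ≤ 2 * V.card := by
  have hcd : codeg E u v = deg E v := by
    unfold codeg deg; congr 1; ext e; simp only [Finset.mem_filter]
    constructor
    · rintro ⟨a, b, c⟩; exact ⟨a, c⟩
    · rintro ⟨a, b⟩; exact ⟨a, h2 e a b, b⟩
  have hpos : 0 < deg E v := by omega
  unfold deg at hpos
  obtain ⟨e0, he0⟩ := Finset.card_pos.1 hpos
  rw [Finset.mem_filter] at he0
  have hvV : v ∈ V := hV _ he0.1 he0.2
  have huV : u ∈ V := hV _ he0.1 (h2 _ he0.1 he0.2)
  have hsub : {u, v} ⊆ V := by intro z; simp; rintro (rfl | rfl) <;> assumption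
  have hcard2 : ({u, v} : Finset ℕ).card = 2 := Finset.card_pair huv
  have hc : (V \ {u, v}).card = V.card - 2 := by
    rw [Finset.card_sdiff_of_subset hsub, hcard2]
  have hge := Finset.card_le_card hsub
  have hle : codeg E u v ≤ V.card - 2 := by
    by_contra hlt
    push Not at hlt
    rw [← hc] at hlt
    obtain ⟨x, hx, hxu, hxv, hf⟩ := pick_codeg hU huv _ hlt
    apply hx
    simp only [Finset.mem_sdiff, Finset.mem_insert, Finset.mem_singleton, not_or]
    exact ⟨hV _ hf (by simp), hxu, hxv⟩
  have hhit : (hit E {u, v}).card ≤ codeg E u v := by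
    unfold codeg
    refine Finset.card_le_card ?_
    intro g hg
    rw [mem_hit] at hg
    rw [Finset.mem_filter]
    obtain ⟨hg1, z, hz1, hz2⟩ := hg
    simp only [Finset.mem_insert, Finset.mem_singleton] at hz2
    rcases hz2 with rfl | rfl
    · exact ⟨hg1, hz1, h1 g hg1 hz1⟩
    · exact ⟨hg1, h2 g hg1 hz1, hz1⟩
  have hav := noP2_card _ (V \ {u, v}) (avoid E {u, v}) rfl (hU.mono (avoid_sub _ _))
    (avoid_vert hV) ?_
  · have := card_hit_avoid E {u, v}
    omega
  · intro h hh h' hh' h1c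
    have sv := avoid_vert hV h hh
    have sv' := avoid_vert hV h' hh'
    rw [mem_avoid] at hh hh'
    have c1 : ((h ∪ h') \ (h ∩ h')).card = 4 := by
      have a1 := Finset.card_union_add_card_inter h h'
      have a2 : (h ∩ h') ⊆ h ∪ h' := fun z hz => Finset.mem_union_left _ (Finset.mem_inter.1 hz).1
      rw [Finset.card_sdiff_of_subset a2]
      have := hU _ hh.1
      have := hU _ hh'.1
      omega
    have s2 : ((h ∪ h') \ (h ∩ h')) ⊆ V \ {u, v} := by
      intro z hz
      rw [Finset.mem_sdiff, Finset.mem_union] at hz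
      rcases hz.1 with hz | hz
      · exact sv hz
      · exact sv' hz
    have c2 : ((V \ {u, v}) \ ((h ∪ h') \ (h ∩ h'))).card < codeg E u v := by
      rw [Finset.card_sdiff_of_subset s2]; omega
    obtain ⟨x, hx, hxu, hxv, hf⟩ := pick_codeg hU huv _ c2
    have hxV : x ∈ V \ {u, v} := by
      simp only [Finset.mem_sdiff, Finset.mem_insert, Finset.mem_singleton, not_or]
      exact ⟨hV _ hf (by simp), hxu, hxv⟩
    have hxs : x ∈ ((h ∪ h') \ (h ∩ h')) := by
      by_contra hcon
      exact hx (Finset.mem_sdiff.2 ⟨hxV, hcon⟩)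
    have aux : ∀ h h' : Finset ℕ, h ∈ E → h' ∈ E → Disjoint h {u, v} → Disjoint h' {u, v} →
        (h ∩ h').card = 1 → x ∈ h → x ∉ h' → False := by
      intro h h' hh hh' d d' h1c hxh hxh'
      rw [Finset.disjoint_right] at d d'
      have du := d (a := u) (by simp)
      have dv := d (a := v) (by simp)
      have du' := d' (a := u) (by simp)
      have dv' := d' (a := v) (by simp)
      refine hP _ hf h hh h' hh' ?_ h1c ?_
      · refine card_inter_one (c := x) (by simp) hxh ?_
        intro z hz hz'
        simp only [Finset.mem_insert, Finset.mem_singleton] at hz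
        grind
      · ext z
        simp only [Finset.mem_inter, Finset.mem_insert, Finset.mem_singleton]
        grind
    simp only [Finset.mem_sdiff, Finset.mem_union, Finset.mem_inter, not_and] at hxs
    rcases hxs.1 with hxh | hxh
    · exact aux h h' hh.1 hh'.1 hh.2 hh'.2 h1c hxh (hxs.2 hxh)
    · refine aux h' h hh'.1 hh.1 hh'.2 hh.2 (by rw [Finset.inter_comm]; exact h1c) hxh ?_
      intro hxh2; exact hxs.2 hxh2 hxh

end FT

namespace FT

theorem caseB_nobad {E : Finset (Finset ℕ)} (hP : PF E) (hC : CF E) (hU : Uni E) {v : ℕ}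
    (h8 : 8 ≤ deg E v) (hcd : ∀ u, u ≠ v → codeg E u v ≤ 4) {e h : Finset ℕ} (he : e ∈ E)
    (hh : h ∈ E) (hve : v ∈ e) (hvh : v ∉ h) : (e ∩ h).card ≠ 1 := by
  intro h1
  obtain ⟨x, hx⟩ := Finset.card_eq_one.1 h1
  have hx1 : x ∈ e ∩ h := by rw [hx]; simp
  rw [Finset.mem_inter] at hx1
  have hxv : x ≠ v := by rintro rfl; exact hvh hx1.2
  obtain ⟨y, hxy, hyv, rfl⟩ := exists_third (hU e he) hve hx1.1 hxv
  have hyh : y ∉ h := by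
    intro hy
    have : y ∈ ({v, x, y} ∩ h : Finset ℕ) := by simp [hy]
    rw [hx] at this
    exact hxy (Finset.mem_singleton.1 this).symm
  -- edges at `v` avoiding `x,y`
  have hav : ∀ f ∈ E, v ∈ f → x ∉ f → y ∉ f → ∀ z ∈ f, z ≠ v → z ∈ h := by
    intro f hf hvf hxf hyf
    refine badstep hP hC hU he hf hh hve hvf hvh ?_ h1
    intro z hz hzf
    simp only [Finset.mem_insert, Finset.mem_singleton] at hz
    grind
  have hone : (E.filter (fun f => v ∈ f ∧ x ∉ f ∧ y ∉ f)).card ≤ 1 := by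
    rw [Finset.card_le_one]
    intro f hf g hg
    rw [Finset.mem_filter] at hf hg
    have aux : ∀ f ∈ E, v ∈ f → x ∉ f → y ∉ f → f = insert v (h.erase x) := by
      intro f hf hvf hxf hyf
      refine Finset.eq_of_subset_of_card_le ?_ ?_
      · intro z hz
        by_cases hzv : z = v
        · subst hzv; exact Finset.mem_insert_self _ _
        · refine Finset.mem_insert_of_mem (Finset.mem_erase.2 ⟨?_, hav f hf hvf hxf hyf z hz hzv⟩)
          rintro rfl; exact hxf hz
      · have := Finset.card_insert_le v (h.erase x)
        rw [Finset.card_erase_of_mem hx1.2, hU h hh] at this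
        rw [hU f hf]; omega
    rw [aux f hf.1 hf.2.1 hf.2.2.1 hf.2.2.2, aux g hg.1 hg.2.1 hg.2.2.1 hg.2.2.2]
  have hsum : deg E v + 1 ≤ codeg E x v + codeg E y v +
      (E.filter (fun f => v ∈ f ∧ x ∉ f ∧ y ∉ f)).card := by
    have s : E.filter (fun e => v ∈ e) ⊆ ((E.filter (fun e => x ∈ e ∧ v ∈ e)) ∪
        (E.filter (fun e => y ∈ e ∧ v ∈ e))) ∪ (E.filter (fun f => v ∈ f ∧ x ∉ f ∧ y ∉ f)) := by
      intro f hf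
      simp only [Finset.mem_union, Finset.mem_filter] at hf ⊢
      tauto
    have s1 := Finset.card_le_card s
    have s2 := Finset.card_union_le ((E.filter (fun e => x ∈ e ∧ v ∈ e)) ∪
        (E.filter (fun e => y ∈ e ∧ v ∈ e))) (E.filter (fun f => v ∈ f ∧ x ∉ f ∧ y ∉ f))
    have s3 := Finset.card_union_add_card_inter (E.filter (fun e => x ∈ e ∧ v ∈ e))
        (E.filter (fun e => y ∈ e ∧ v ∈ e))
    have s4 : 0 < ((E.filter (fun e => x ∈ e ∧ v ∈ e)) ∩
        (E.filter (fun e => y ∈ e ∧ v ∈ e))).card := by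
      refine Finset.card_pos.2 ⟨{v, x, y}, ?_⟩
      simp [he]
    unfold deg codeg
    omega
  have cx := hcd x hxv
  have cy := hcd y hyv
  have hpos : 0 < (E.filter (fun f => v ∈ f ∧ x ∉ f ∧ y ∉ f)).card := by omega
  obtain ⟨f0, hf0⟩ := Finset.card_pos.1 hpos
  rw [Finset.mem_filter] at hf0
  obtain ⟨hf0E, hvf0, hxf0, hyf0⟩ := hf0
  obtain ⟨a, b, hab, hav', hbv', rfl⟩ := exists_other (hU f0 hf0E) hvf0
  have ha := hav _ hf0E hvf0 hxf0 hyf0 a (by simp) hav'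
  have hb := hav _ hf0E hvf0 hxf0 hyf0 b (by simp) hbv'
  have hxa : x ≠ a := by rintro rfl; exact hxf0 (by simp)
  have hxb : x ≠ b := by rintro rfl; exact hxf0 (by simp)
  have hh3 := eq3 (hU h hh) hx1.2 ha hb hxa hxb hab
  obtain ⟨z, hz, hzx, hzv, hzE⟩ := pick_codeg hU hxv {a, b, y} (by
    have : ({a, b, y} : Finset ℕ).card ≤ 3 := Finset.card_le_three
    omega)
  obtain ⟨t, ht, hty, htv, htE⟩ := pick_codeg hU hyv {x, z} (by
    have : ({x, z} : Finset ℕ).card ≤ 2 := Finset.card_le_two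
    omega)
  simp only [Finset.mem_insert, Finset.mem_singleton, not_or] at hz ht
  have k := badstep hP hC hU hzE htE hh (by simp) (by simp) hvh ?_ ?_ y (by simp) hyv
  · exact hyh k
  · intro w hw hw'
    simp only [Finset.mem_insert, Finset.mem_singleton] at hw hw'
    grind
  · refine card_inter_one (c := x) (by simp) hx1.2 ?_
    intro w hw hw'
    rw [hh3] at hw'
    simp only [Finset.mem_insert, Finset.mem_singleton] at hw hw'
    grind

theorem caseB_disj {E : Finset (Finset ℕ)} (hU : Uni E) {v : ℕ}
    (h8 : 8 ≤ deg E v) (hcd : ∀ u, u ≠ v → codeg E u v ≤ 4) (hM : ¬ M3 E v)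
    (hnb : ∀ e ∈ E, ∀ h ∈ E, v ∈ e → v ∉ h → (e ∩ h).card ≠ 1)
    {e h : Finset ℕ} (he : e ∈ E)
    (hh : h ∈ E) (hve : v ∈ e) (hvh : v ∉ h) : ∀ z ∈ e, z ∉ h := by
  have full : ∀ f ∈ E, v ∈ f → ∀ z ∈ f, z ∈ h → ∀ w ∈ f, w ≠ v → w ∈ h := by
    intro f hf hvf z hz hzh w hw hwv
    by_contra hwh
    have hzv : z ≠ v := by rintro rfl; exact hvh hzh
    have hzw : z ≠ w := by rintro rfl; exact hwh hzh
    have := eq3 (hU f hf) hvf hz hw hzv.symm hwv.symm hzw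
    refine hnb f hf h hh hvf hvh (card_inter_one hz hzh ?_)
    intro y hy hyh
    rw [this] at hy
    simp only [Finset.mem_insert, Finset.mem_singleton] at hy
    grind
  intro z hze hzh
  set F := E.filter (fun f => v ∈ f ∧ Disjoint f h) with hF
  have h3 : (E.filter (fun f => v ∈ f ∧ ¬ Disjoint f h)).card ≤ 3 := by
    have : E.filter (fun f => v ∈ f ∧ ¬ Disjoint f h) ⊆
        h.image (fun z => insert v (h.erase z)) := by
      intro f hf
      rw [Finset.mem_filter, Finset.not_disjoint_iff] at hf
      obtain ⟨hfE, hvf, y, hyf, hyh⟩ := hf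
      have hsub : f.erase v ⊆ h := by
        intro w hw
        rw [Finset.mem_erase] at hw
        exact full f hfE hvf y hyf hyh w hw.2 hw.1
      have hc : (h \ f.erase v).card = 1 := by
        rw [Finset.card_sdiff_of_subset hsub, Finset.card_erase_of_mem hvf, hU f hfE, hU h hh]
      obtain ⟨t, ht⟩ := Finset.card_eq_one.1 hc
      rw [Finset.mem_image]
      have htm : t ∈ h \ f.erase v := by rw [ht]; simp
      rw [Finset.mem_sdiff] at htm
      refine ⟨t, htm.1, ?_⟩
      have : h.erase t = f.erase v := by
        symm
        refine Finset.eq_of_subset_of_card_le ?_ ?_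
        · intro w hw
          refine Finset.mem_erase.2 ⟨?_, hsub hw⟩
          rintro rfl; exact htm.2 hw
        · rw [Finset.card_erase_of_mem htm.1, Finset.card_erase_of_mem hvf, hU f hfE, hU h hh]
      rw [this, Finset.insert_erase hvf]
    have h1 := Finset.card_le_card this
    have h2 : (h.image (fun z => insert v (h.erase z))).card ≤ h.card := Finset.card_image_le
    rw [hU h hh] at h2
    omega
  have h5 : 5 ≤ F.card := by
    have : deg E v = F.card + (E.filter (fun f => v ∈ f ∧ ¬ Disjoint f h)).card := by
      unfold deg
      rw [hF, ← Finset.card_filter_add_card_filter_not (s := E.filter (fun e => v ∈ e))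
        (fun f => Disjoint f h), Finset.filter_filter, Finset.filter_filter]
    omega
  have memF : ∀ f ∈ F, f ∈ E ∧ v ∈ f ∧ ∀ z ∈ f, z ∉ h := by
    intro f hf
    rw [hF, Finset.mem_filter, Finset.disjoint_left] at hf
    exact ⟨hf.1, hf.2.1, fun z hz => hf.2.2 hz⟩
  have share : ∀ f ∈ F, ∀ g ∈ F, ∃ z ∈ f, z ∈ g ∧ z ≠ v := by
    intro f hf g hg
    by_contra hcon
    push Not at hcon
    have mf := memF f hf
    have mg := memF g hg
    refine hM ⟨e, he, f, mf.1, g, mg.1, hve, mf.2.1, mg.2.1, ?_, ?_, hcon⟩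
    · intro w hw hwf
      by_contra hwv
      exact mf.2.2 w hwf (full e he hve z hze hzh w hw hwv)
    · intro w hw hwf
      by_contra hwv
      exact mg.2.2 w hwf (full e he hve z hze hzh w hw hwv)
  have miss : ∀ a, a ≠ v → ∃ g ∈ F, a ∉ g := by
    intro a hav
    by_contra hcon
    push Not at hcon
    have : F ⊆ E.filter (fun e => a ∈ e ∧ v ∈ e) := by
      intro g hg
      rw [Finset.mem_filter]
      exact ⟨(memF g hg).1, hcon g hg, (memF g hg).2.1⟩
    have h1 := Finset.card_le_card this
    have h2 := hcd a hav
    unfold codeg at h2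
    omega
  obtain ⟨f, hf⟩ : F.Nonempty := Finset.card_pos.1 (by omega)
  have mf := memF f hf
  obtain ⟨a, b, hab, hav, hbv, rfl⟩ := exists_other (hU f mf.1) mf.2.1
  obtain ⟨g, hg, hag⟩ := miss a hav
  have mg := memF g hg
  have hbg : b ∈ g := by
    obtain ⟨w, hw1, hw2, hw3⟩ := share _ hf g hg
    simp only [Finset.mem_insert, Finset.mem_singleton] at hw1
    grind
  obtain ⟨c, hbc, hcv, rfl⟩ := exists_third (hU g mg.1) mg.2.1 hbg hbv
  have hac : a ≠ c := by rintro rfl; exact hag (by simp)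
  obtain ⟨k, hk, hbk⟩ := miss b hbv
  have mk := memF k hk
  have hak : a ∈ k := by
    obtain ⟨w, hw1, hw2, hw3⟩ := share _ hf k hk
    simp only [Finset.mem_insert, Finset.mem_singleton] at hw1
    grind
  have hck : c ∈ k := by
    obtain ⟨w, hw1, hw2, hw3⟩ := share _ hg k hk
    simp only [Finset.mem_insert, Finset.mem_singleton] at hw1
    grind
  have hk3 := eq3 (hU k mk.1) mk.2.1 hak hck hav.symm hcv.symm hac
  subst hk3
  have : F ⊆ {{v, a, b}, {v, b, c}, {v, a, c}} := by
    intro p hp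
    have mp := memF p hp
    obtain ⟨w1, hw1, hw1p, hw1v⟩ := share _ hf p hp
    obtain ⟨w2, hw2, hw2p, hw2v⟩ := share _ hg p hp
    obtain ⟨w3, hw3, hw3p, hw3v⟩ := share _ hk p hp
    simp only [Finset.mem_insert, Finset.mem_singleton] at hw1 hw2 hw3 ⊢
    have hp3 := hU p mp.1
    by_cases pa : a ∈ p <;> by_cases pb : b ∈ p
    · left; exact eq3 hp3 mp.2.1 pa pb hav.symm hbv.symm hab
    · have pc : c ∈ p := by grind
      right; right; exact eq3 hp3 mp.2.1 pa pc hav.symm hcv.symm hac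
    · have pc : c ∈ p := by grind
      right; left; exact eq3 hp3 mp.2.1 pb pc hbv.symm hcv.symm hbc
    · exfalso; grind
  have h1 := Finset.card_le_card this
  have h2 : ({{v, a, b}, {v, b, c}, {v, a, c}} : Finset (Finset ℕ)).card ≤ 3 :=
    Finset.card_le_three
  omega

theorem deg_mono {E F : Finset (Finset ℕ)} (h : E ⊆ F) (v : ℕ) : deg E v ≤ deg F v :=
  Finset.card_le_card (Finset.filter_subset_filter _ h)

theorem M3.mono {E F : Finset (Finset ℕ)} (h : E ⊆ F) {v : ℕ} (hM : M3 E v) : M3 F v := by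
  obtain ⟨e, he, f, hf, g, hg, r⟩ := hM
  exact ⟨e, h he, f, h hf, g, h hg, r⟩

theorem caseII : ∀ (n : ℕ) (V : Finset ℕ) (E : Finset (Finset ℕ)), V.card = n → n ≤ 13 → Uni E →
    (∀ e ∈ E, e ⊆ V) → PF E → CF E → (∀ v, 8 ≤ deg E v → ¬ M3 E v) → 2 * n + 6 ≤ E.card →
    False := by
  intro n
  induction n using Nat.strong_induction_on with
  | _ n ih =>
  intro V E hn hn13 hU hV hP hC hM hE
  have del : ∀ A, A ⊆ V → A.Nonempty → (hit E A).card ≤ 2 * A.card → False := by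
    intro A hA hne hle
    have hpos := Finset.card_pos.2 hne
    have hAc := Finset.card_le_card hA
    have h1 := card_hit_avoid E A
    have hs := avoid_sub E A
    refine ih (n - A.card) (by omega) (V \ A) (avoid E A) ?_ (by omega) (hU.mono hs)
      (avoid_vert hV) (hP.mono hs) (hC.mono hs) ?_ (by omega)
    · rw [Finset.card_sdiff_of_subset hA, hn]
    · intro v hv hm
      exact hM v (hv.trans (deg_mono hs v)) (hm.mono hs)
  have hd : ∀ x ∈ V, 3 ≤ deg E x := by
    intro x hx
    by_contra hlt
    refine del {x} (by simpa using hx) (by simp) ?_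
    have : (hit E {x}).card = deg E x := by
      unfold hit deg; congr 1; ext e; simp
    rw [this, Finset.card_singleton]; omega
  obtain ⟨v, hvV, h8⟩ : ∃ v ∈ V, 8 ≤ deg E v := by
    by_contra hcon
    push Not at hcon
    have hs := sum_deg hU hV
    have hle : ∑ v ∈ V, deg E v ≤ ∑ v ∈ V, 7 :=
      Finset.sum_le_sum (fun v hv => by have := hcon v hv; omega)
    simp only [Finset.sum_const, smul_eq_mul] at hle
    omega
  by_cases hA : ∃ u, u ≠ v ∧ 5 ≤ codeg E u v
  · obtain ⟨u, huv, h5⟩ := hA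
    by_cases hx1 : ∀ g ∈ E, v ∈ g → u ∈ g
    · by_cases hx2 : ∀ g ∈ E, u ∈ g → v ∈ g
      · have := caseA_none hP hU hV (by omega) huv h8 hx2 hx1
        omega
      · push Not at hx2
        obtain ⟨g, hg, hug, hvg⟩ := hx2
        have hdu : 8 ≤ deg E u := by
          refine h8.trans ?_
          unfold deg
          refine Finset.card_le_card ?_
          intro f hf
          rw [Finset.mem_filter] at hf ⊢
          exact ⟨hf.1, hx1 f hf.1 hf.2⟩
        exact caseA_one hP hC hU hV hd huv.symm (by rw [codeg_comm]; exact h5) (hM u hdu) hx1 hg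
          hug hvg
    · push Not at hx1
      obtain ⟨e, he, hve, hue⟩ := hx1
      by_cases hx2 : ∀ g ∈ E, u ∈ g → v ∈ g
      · exact caseA_one hP hC hU hV hd huv h5 (hM v h8) hx2 he hve hue
      · push Not at hx2
        obtain ⟨g, hg, hug, hvg⟩ := hx2
        exact caseA_both hP hC hU hV hd huv h5 he hg hve hue hug hvg
  · push Not at hA
    have hcd : ∀ u, u ≠ v → codeg E u v ≤ 4 := fun u hu => by have := hA u hu; omega
    have hnb : ∀ e ∈ E, ∀ h ∈ E, v ∈ e → v ∉ h → (e ∩ h).card ≠ 1 :=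
      fun e he h hh hve hvh => caseB_nobad hP hC hU h8 hcd he hh hve hvh
    have hdj : ∀ e ∈ E, ∀ h ∈ E, v ∈ e → v ∉ h → ∀ z ∈ e, z ∉ h :=
      fun e he h hh hve hvh => caseB_disj hU h8 hcd (hM v h8) hnb he hh hve hvh
    set A := V.filter (fun x => ∃ e ∈ E, v ∈ e ∧ x ∈ e) with hAdef
    have hvA : v ∈ A := by
      have hpos : 0 < deg E v := by omega
      unfold deg at hpos
      obtain ⟨e0, he0⟩ := Finset.card_pos.1 hpos
      rw [Finset.mem_filter] at he0
      rw [hAdef, Finset.mem_filter]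
      exact ⟨hvV, e0, he0.1, he0.2, he0.2⟩
    refine del A (Finset.filter_subset _ _) ⟨v, hvA⟩ ?_
    have h1 : (hit E A).card ≤ deg E v := by
      unfold deg
      refine Finset.card_le_card ?_
      intro g hg
      rw [mem_hit] at hg
      obtain ⟨hgE, z, hzg, hzA⟩ := hg
      rw [hAdef, Finset.mem_filter] at hzA
      obtain ⟨_, e, he, hve, hze⟩ := hzA
      rw [Finset.mem_filter]
      refine ⟨hgE, ?_⟩
      by_contra hvg
      exact hdj e he g hgE hve hvg z hze hzg
    have h2 := sum_codeg (A := A.erase v) (v := v) hU (by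
      intro e he hve z hz
      rw [Finset.mem_erase] at hz ⊢
      refine ⟨hz.1, ?_⟩
      rw [hAdef, Finset.mem_filter]
      exact ⟨hV e he hz.2, e, he, hve, hz.2⟩) (by simp)
    have h3 : ∑ u ∈ A.erase v, codeg E u v ≤ ∑ u ∈ A.erase v, 4 :=
      Finset.sum_le_sum (fun u hu => hcd u (Finset.mem_erase.1 hu).1)
    simp only [Finset.sum_const, smul_eq_mul] at h3
    rw [Finset.card_erase_of_mem hvA] at h3
    omega

end FT

namespace FT

/-! ### Triangle-free case with a large flower -/

/-- an edge avoiding `v` meeting an edge at `v` swallows it -/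
def NB (E : Finset (Finset ℕ)) (v : ℕ) : Prop :=
  ∀ e ∈ E, ∀ h ∈ E, v ∈ e → v ∉ h → ∀ z ∈ e, z ∈ h → ∀ w ∈ e, w ≠ v → w ∈ h

theorem NB.mono {E F : Finset (Finset ℕ)} (h : E ⊆ F) {v : ℕ} (hM : NB F v) : NB E v :=
  fun e he g hg => hM e (h he) g (h hg)

theorem NB_of {E : Finset (Finset ℕ)} (hU : Uni E) {v : ℕ}
    (hnb : ∀ e ∈ E, ∀ h ∈ E, v ∈ e → v ∉ h → (e ∩ h).card ≠ 1) : NB E v := by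
  intro f hf h hh hvf hvh z hz hzh w hw hwv
  by_contra hwh
  have hzv : z ≠ v := by rintro rfl; exact hvh hzh
  have hzw : z ≠ w := by rintro rfl; exact hwh hzh
  have := eq3 (hU f hf) hvf hz hw hzv.symm hwv.symm hzw
  refine hnb f hf h hh hvf hvh (card_inter_one hz hzh ?_)
  intro y hy hyh
  rw [this] at hy
  simp only [Finset.mem_insert, Finset.mem_singleton] at hy
  grind

theorem two_petals {E : Finset (Finset ℕ)} (hU : Uni E) {v : ℕ} {p q h : Finset ℕ} (hp : p ∈ E)
    (hq : q ∈ E) (hh : h ∈ E) (hvp : v ∈ p) (hvq : v ∈ q) (hpq : ∀ z ∈ p, z ∈ q → z = v)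
    (h1 : ∀ z ∈ p, z ≠ v → z ∈ h) (h2 : ∀ z ∈ q, z ≠ v → z ∈ h) : False := by
  have hd : Disjoint (p.erase v) (q.erase v) := by
    rw [Finset.disjoint_left]
    intro z hz hz'
    rw [Finset.mem_erase] at hz hz'
    exact hz.1 (hpq z hz.2 hz'.2)
  have hs : p.erase v ∪ q.erase v ⊆ h := by
    intro z hz
    rw [Finset.mem_union, Finset.mem_erase, Finset.mem_erase] at hz
    rcases hz with hz | hz
    · exact h1 z hz.2 hz.1
    · exact h2 z hz.2 hz.1
  have := Finset.card_le_card hs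
  rw [Finset.card_union_of_disjoint hd, Finset.card_erase_of_mem hvp, Finset.card_erase_of_mem hvq,
    hU p hp, hU q hq, hU h hh] at this
  omega

theorem NB_of_M3 {E : Finset (Finset ℕ)} (hP : PF E) (hC : CF E) (hU : Uni E) {v : ℕ}
    (hM : M3 E v) : NB E v := by
  apply NB_of hU
  intro e he h hh hve hvh h1
  -- petals are not bad
  have petal : ∀ p ∈ E, ∀ q ∈ E, ∀ r ∈ E, v ∈ p → v ∈ q → v ∈ r → (∀ z ∈ p, z ∈ q → z = v) →
      (∀ z ∈ p, z ∈ r → z = v) → (∀ z ∈ q, z ∈ r → z = v) → (p ∩ h).card ≠ 1 := by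
    intro p hp q hq r hr hvp hvq hvr hpq hpr hqr hc
    exact two_petals hU hq hr hh hvq hvr hqr (badstep hP hC hU hp hq hh hvp hvq hvh hpq hc)
      (badstep hP hC hU hp hr hh hvp hvr hvh hpr hc)
  obtain ⟨x, hx⟩ := Finset.card_eq_one.1 h1
  have hx1 : x ∈ e ∩ h := by rw [hx]; simp
  rw [Finset.mem_inter] at hx1
  have hxv : x ≠ v := by rintro rfl; exact hvh hx1.2
  obtain ⟨y, hxy, hyv, rfl⟩ := exists_third (hU e he) hve hx1.1 hxv
  -- petals avoiding `x,y` lie in `h`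
  have inh : ∀ p ∈ E, v ∈ p → x ∉ p → y ∉ p → ∀ z ∈ p, z ≠ v → z ∈ h := by
    intro p hp hvp hxp hyp
    refine badstep hP hC hU he hp hh hve hvp hvh ?_ h1
    intro z hz hzp
    simp only [Finset.mem_insert, Finset.mem_singleton] at hz
    grind
  have main : ∀ p ∈ E, ∀ q ∈ E, ∀ r ∈ E, v ∈ p → v ∈ q → v ∈ r → (∀ z ∈ p, z ∈ q → z = v) →
      (∀ z ∈ p, z ∈ r → z = v) → (∀ z ∈ q, z ∈ r → z = v) → x ∉ p → y ∉ p → False := by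
    intro p hp q hq r hr hvp hvq hvr hpq hpr hqr hxp hyp
    have ip := inh p hp hvp hxp hyp
    obtain ⟨a, b, hab, hav, hbv, rfl⟩ := exists_other (hU p hp) hvp
    have hh3 := eq3 (hU h hh) (ip a (by simp) hav) (ip b (by simp) hbv) hx1.2 hab
      (by rintro rfl; exact hxp (by simp)) (by rintro rfl; exact hxp (by simp))
    have nx : ∀ s ∈ E, v ∈ s → (∀ z ∈ ({v, a, b} : Finset ℕ), z ∈ s → z = v) → (s ∩ h).card ≠ 1 →
        x ∉ s := by
      intro s hs hvs hps hc hxs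
      apply hc
      refine card_inter_one hxs hx1.2 ?_
      intro z hz hzh
      rw [hh3] at hzh
      simp only [Finset.mem_insert, Finset.mem_singleton] at hzh hps
      grind
    have hxq := nx q hq hvq hpq (petal q hq _ hp r hr hvq hvp hvr
      (fun z h1 h2 => hpq z h2 h1) hqr hpr)
    have hxr := nx r hr hvr hpr (petal r hr _ hp q hq hvr hvp hvq
      (fun z h1 h2 => hpr z h2 h1) (fun z h1 h2 => hqr z h2 h1) hpq)
    by_cases hyq : y ∈ q
    · have hyr : y ∉ r := fun hyr => hyv (hqr y hyq hyr)
      exact two_petals hU hp hr hh hvp hvr hpr ip (inh r hr hvr hxr hyr)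
    · exact two_petals hU hp hq hh hvp hvq hpq ip (inh q hq hvq hxq hyq)
  obtain ⟨p, hp, q, hq, r, hr, hvp, hvq, hvr, hpq, hpr, hqr⟩ := hM
  have sqp : ∀ z ∈ q, z ∈ p → z = v := fun z h1 h2 => hpq z h2 h1
  have srp : ∀ z ∈ r, z ∈ p → z = v := fun z h1 h2 => hpr z h2 h1
  have srq : ∀ z ∈ r, z ∈ q → z = v := fun z h1 h2 => hqr z h2 h1
  by_cases c1 : x ∉ p ∧ y ∉ p
  · exact main p hp q hq r hr hvp hvq hvr hpq hpr hqr c1.1 c1.2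
  · by_cases c2 : x ∉ q ∧ y ∉ q
    · exact main q hq p hp r hr hvq hvp hvr sqp hqr hpr c2.1 c2.2
    · by_cases c3 : x ∉ r ∧ y ∉ r
      · exact main r hr p hp q hq hvr hvp hvq srp srq hpq c3.1 c3.2
      · have := hpq x; have := hpr x; have := hqr x
        have := hpq y; have := hpr y; have := hqr y
        grind

/-- the situation: `D` is the set of neighbours of `v` and `R` the rest -/
structure Sit (E : Finset (Finset ℕ)) (v : ℕ) (D R : Finset ℕ) : Prop where
  uni : Uni E
  nb : NB E v
  vD : v ∉ D
  vR : v ∉ R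
  dis : Disjoint D R
  vert : ∀ e ∈ E, ∀ z ∈ e, z = v ∨ z ∈ D ∨ z ∈ R
  link : ∀ e ∈ E, v ∈ e → ∀ z ∈ e, z ≠ v → z ∈ D
  nbr : ∀ x ∈ D, ∃ e ∈ E, v ∈ e ∧ x ∈ e

namespace Sit

variable {E : Finset (Finset ℕ)} {v : ℕ} {D R : Finset ℕ}

theorem other (S : Sit E v D R) {x : ℕ} (hx : x ∈ D) : ∃ y ∈ D, x ≠ y ∧ {v, x, y} ∈ E := by
  obtain ⟨e, he, hve, hxe⟩ := S.nbr x hx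
  have hxv : x ≠ v := by rintro rfl; exact S.vD hx
  obtain ⟨y, hxy, hyv, rfl⟩ := exists_third (S.uni e he) hve hxe hxv
  exact ⟨y, S.link _ he (by simp) y (by simp) hyv, hxy, he⟩

/-- `K = h ∩ D` is closed under link adjacency -/
theorem closed (S : Sit E v D R) {h : Finset ℕ} (hh : h ∈ E) (hvh : v ∉ h) {e : Finset ℕ}
    (he : e ∈ E) (hve : v ∈ e) {z : ℕ} (hz : z ∈ e) (hzh : z ∈ h ∩ D) :
    ∀ w ∈ e, w ≠ v → w ∈ h ∩ D := by
  intro w hw hwv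
  rw [Finset.mem_inter] at hzh ⊢
  exact ⟨S.nb e he h hh hve hvh z hz hzh.1 w hw hwv, S.link e he hve w hw hwv⟩

theorem delete (S : Sit E v D R) {h : Finset ℕ} (hh : h ∈ E) (hvh : v ∉ h) :
    Sit (avoid E (h ∩ D)) v (D \ (h ∩ D)) R where
  uni := S.uni.mono (avoid_sub _ _)
  nb := S.nb.mono (avoid_sub _ _)
  vD := fun h => S.vD (Finset.mem_sdiff.1 h).1
  vR := S.vR
  dis := Finset.disjoint_of_subset_left Finset.sdiff_subset S.dis
  vert := by
    intro e he z hz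
    rw [mem_avoid] at he
    rcases S.vert e he.1 z hz with h1 | h1 | h1
    · exact Or.inl h1
    · right; left; exact Finset.mem_sdiff.2 ⟨h1, Finset.disjoint_left.1 he.2 hz⟩
    · exact Or.inr (Or.inr h1)
  link := by
    intro e he hve z hz hzv
    rw [mem_avoid] at he
    exact Finset.mem_sdiff.2 ⟨S.link e he.1 hve z hz hzv, Finset.disjoint_left.1 he.2 hz⟩
  nbr := by
    intro x hx
    rw [Finset.mem_sdiff] at hx
    obtain ⟨e, he, hve, hxe⟩ := S.nbr x hx.1
    refine ⟨e, ?_, hve, hxe⟩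
    rw [mem_avoid]
    refine ⟨he, ?_⟩
    rw [Finset.disjoint_left]
    intro z hz hzK
    apply hx.2
    refine S.closed hh hvh he hve hz hzK x hxe ?_
    rintro rfl; exact S.vD hx.1

theorem Kcard (S : Sit E v D R) {h : Finset ℕ} (hh : h ∈ E) (hvh : v ∉ h)
    (ht : (h ∩ D).Nonempty) : (h ∩ D).card = 2 ∨ (h ∩ D).card = 3 := by
  obtain ⟨x, hx⟩ := ht
  obtain ⟨y, hy, hxy, he⟩ := S.other (Finset.mem_inter.1 hx).2
  have hyv : y ≠ v := by rintro rfl; exact S.vD hy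
  have hyK := S.closed hh hvh he (by simp) (z := x) (by simp) hx y (by simp) hyv
  have h1 : (h ∩ D).card ≤ 3 := by
    rw [← S.uni h hh]; exact Finset.card_le_card Finset.inter_subset_left
  have h2 : 1 < (h ∩ D).card := Finset.one_lt_card.2 ⟨x, hx, y, hyK, hxy⟩
  omega

theorem hit2 (S : Sit E v D R) {h : Finset ℕ} (hh : h ∈ E) (hvh : v ∉ h) {a b : ℕ}
    (hK : h ∩ D = {a, b}) (hab : a ≠ b) : ∀ g ∈ hit E (h ∩ D), g ∈ insert {v, a, b}
      (R.image (fun w => {a, b, w})) := by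
  have ha : a ∈ h ∩ D := by rw [hK]; simp
  have hb : b ∈ h ∩ D := by rw [hK]; simp
  have haD := (Finset.mem_inter.1 ha).2
  have hbD := (Finset.mem_inter.1 hb).2
  have hav : a ≠ v := by rintro rfl; exact S.vD haD
  have hbv : b ≠ v := by rintro rfl; exact S.vD hbD
  have habE : {v, a, b} ∈ E := by
    obtain ⟨y, hy, hxy, he⟩ := S.other haD
    have hyv : y ≠ v := by rintro rfl; exact S.vD hy
    have := S.closed hh hvh he (by simp) (z := a) (by simp) ha y (by simp) hyv
    rw [hK] at this
    simp only [Finset.mem_insert, Finset.mem_singleton] at this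
    rcases this with rfl | rfl
    · exact absurd rfl hxy
    · exact he
  intro g hg
  rw [mem_hit] at hg
  obtain ⟨hgE, z, hzg, hzK⟩ := hg
  rw [Finset.mem_insert]
  by_cases hvg : v ∈ g
  · left
    have hsub := S.closed hh hvh hgE hvg hzg hzK
    refine Finset.eq_of_subset_of_card_le ?_ ?_
    · intro w hw
      by_cases hwv : w = v
      · simp [hwv]
      · have := hsub w hw hwv
        rw [hK] at this
        exact Finset.mem_insert_of_mem this
    · rw [S.uni g hgE, card3 hav.symm hbv.symm hab]
  · right
    have hzv : z ≠ v := by rintro rfl; exact hvg hzg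
    have hze : z ∈ ({v, a, b} : Finset ℕ) := by
      rw [hK] at hzK; exact Finset.mem_insert_of_mem hzK
    have hg' := S.nb _ habE g hgE (by simp) hvg z hze hzg
    have hag := hg' a (by simp) hav
    have hbg := hg' b (by simp) hbv
    obtain ⟨w, hbw, hwa, rfl⟩ := exists_third (S.uni g hgE) hag hbg hab.symm
    rw [Finset.mem_image]
    refine ⟨w, ?_, rfl⟩
    rcases S.vert _ hgE w (by simp) with h1 | h1 | h1
    · subst h1; exact absurd (by simp) hvg
    · exfalso
      obtain ⟨y, hy, hwy, he⟩ := S.other h1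
      have hyv : y ≠ v := by rintro rfl; exact S.vD hy
      have hyg := S.nb _ he _ hgE (by simp) hvg w (by simp) (by simp) y (by simp) hyv
      have hyK : y ∈ h ∩ D := by
        rw [hK]; simp only [Finset.mem_insert, Finset.mem_singleton] at hyg ⊢
        rcases hyg with h2 | h2 | h2
        · exact Or.inl h2
        · exact Or.inr h2
        · exact absurd h2.symm hwy
      have hwv : w ≠ v := by rintro rfl; exact S.vD h1
      have := S.closed hh hvh he (by simp) (z := y) (by simp) hyK w (by simp) hwv
      rw [hK] at this
      simp only [Finset.mem_insert, Finset.mem_singleton] at this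
      rcases this with h2 | h2
      · exact hwa h2
      · exact hbw h2.symm
    · exact h1

theorem hit2_card (S : Sit E v D R) {h : Finset ℕ} (hh : h ∈ E) (hvh : v ∉ h)
    (hK : (h ∩ D).card = 2) : (hit E (h ∩ D)).card ≤ 1 + R.card := by
  obtain ⟨a, b, hab, hK'⟩ := Finset.card_eq_two.1 hK
  have h1 : hit E (h ∩ D) ⊆ _ := S.hit2 hh hvh hK' hab
  have h2 := Finset.card_le_card h1
  have h3 := Finset.card_insert_le ({v, a, b} : Finset ℕ) (R.image (fun w => {a, b, w}))
  have h4 : (R.image (fun w => ({a, b, w} : Finset ℕ))).card ≤ R.card := Finset.card_image_le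
  omega

theorem hit3 (S : Sit E v D R) {h : Finset ℕ} (hh : h ∈ E) (hvh : v ∉ h)
    (hK : (h ∩ D).card = 3) : ∀ g ∈ hit E (h ∩ D), (v ∈ g ∧ g ⊆ insert v h) ∨ g = h := by
  have hKh : h ∩ D = h := Finset.eq_of_subset_of_card_le Finset.inter_subset_left
    (by rw [hK, S.uni h hh])
  intro g hg
  rw [mem_hit] at hg
  obtain ⟨hgE, z, hzg, hzK⟩ := hg
  by_cases hvg : v ∈ g
  · left
    refine ⟨hvg, ?_⟩
    intro w hw
    by_cases hwv : w = v
    · simp [hwv]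
    · exact Finset.mem_insert_of_mem
        (Finset.mem_inter.1 (S.closed hh hvh hgE hvg hzg hzK w hw hwv)).1
  · right
    obtain ⟨w, hw, hzw, he⟩ := S.other (Finset.mem_inter.1 hzK).2
    have hwv : w ≠ v := by rintro rfl; exact S.vD hw
    have hwg := S.nb _ he g hgE (by simp) hvg z (by simp) hzg w (by simp) hwv
    have hwK := S.closed hh hvh he (by simp) (z := z) (by simp) hzK w (by simp) hwv
    rw [hKh] at hzK hwK
    obtain ⟨t, hwt, htz, hht⟩ := exists_third (S.uni h hh) hzK hwK hzw.symm
    have hth : t ∈ h := by rw [hht]; simp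
    have htK : t ∈ h ∩ D := by rw [hKh]; exact hth
    have htv : t ≠ v := by rintro rfl; exact hvh hth
    obtain ⟨s, hs, hts, he'⟩ := S.other (Finset.mem_inter.1 htK).2
    have hsv : s ≠ v := by rintro rfl; exact S.vD hs
    have hsK := S.closed hh hvh he' (by simp) (z := t) (by simp) htK s (by simp) hsv
    rw [hKh] at hsK
    have hsg : s ∈ g := by
      rw [hht] at hsK
      simp only [Finset.mem_insert, Finset.mem_singleton] at hsK
      rcases hsK with rfl | rfl | rfl
      · exact hzg
      · exact hwg
      · exact absurd rfl hts
    have htg := S.nb _ he' g hgE (by simp) hvg s (by simp) hsg t (by simp) htv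
    rw [hht]
    exact eq3 (S.uni g hgE) hzg hwg htg hzw htz.symm hwt

theorem hit3_card (S : Sit E v D R) {h : Finset ℕ} (hh : h ∈ E) (hvh : v ∉ h)
    (hK : (h ∩ D).card = 3) : (hit E (h ∩ D)).card ≤ 4 := by
  have h1 : hit E (h ∩ D) ⊆ (insert v h).powersetCard 3 := by
    intro g hg
    have hgE := (mem_hit.1 hg).1
    rw [Finset.mem_powersetCard]
    refine ⟨?_, S.uni g hgE⟩
    rcases S.hit3 hh hvh hK g hg with h2 | h2
    · exact h2.2
    · rw [h2]; exact Finset.subset_insert _ _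
  have h2 := Finset.card_le_card h1
  rw [Finset.card_powersetCard, Finset.card_insert_of_notMem hvh, S.uni h hh] at h2
  exact h2

/-- edges at `v` -/
theorem star_card (S : Sit E v D R) : deg E v ≤ D.card.choose 2 := by
  unfold deg
  have : E.filter (fun e => v ∈ e) ⊆ (D.powersetCard 2).image (fun p => insert v p) := by
    intro e he
    rw [Finset.mem_filter] at he
    rw [Finset.mem_image]
    refine ⟨e.erase v, ?_, Finset.insert_erase he.2⟩
    rw [Finset.mem_powersetCard, Finset.card_erase_of_mem he.2, S.uni e he.1]
    refine ⟨?_, rfl⟩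
    intro z hz
    rw [Finset.mem_erase] at hz
    exact S.link e he.1 he.2 z hz.2 hz.1
  have h1 := Finset.card_le_card this
  have h2 : ((D.powersetCard 2).image (fun p => insert v p)).card ≤ _ := Finset.card_image_le
  rw [Finset.card_powersetCard] at h2
  omega

theorem noTouch_sub (S : Sit E v D R) (ht : ∀ h ∈ E, v ∉ h → ¬ (h ∩ D).Nonempty) :
    ∀ h ∈ E, v ∉ h → h ⊆ R := by
  intro h hh hvh z hz
  rcases S.vert h hh z hz with h1 | h1 | h1
  · subst h1; exact absurd hz hvh
  · exact absurd ⟨z, Finset.mem_inter.2 ⟨hz, h1⟩⟩ (ht h hh hvh)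
  · exact h1

theorem noTouch_card (S : Sit E v D R) (ht : ∀ h ∈ E, v ∉ h → ¬ (h ∩ D).Nonempty) :
    E.card ≤ D.card.choose 2 + (ES E R).card := by
  have h1 := S.star_card
  have h2 := Finset.card_filter_add_card_filter_not (s := E) (fun e => v ∈ e)
  have h3 : (E.filter (fun e => ¬ v ∈ e)).card ≤ (ES E R).card := by
    refine Finset.card_le_card ?_
    intro h hh
    rw [Finset.mem_filter] at hh
    rw [mem_ES]
    exact ⟨hh.1, S.noTouch_sub ht h hh.1 hh.2⟩
  unfold deg at h1
  omega

end Sit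

/-- recursive upper bound -/
def Bd (r q : ℕ) : ℕ → ℕ
  | 0 => q
  | 1 => q
  | 2 => 1 + r + q
  | (d + 3) => max ((d + 3).choose 2 + q) (max (Bd r q (d + 1) + 1 + r) (Bd r q d + 4))

theorem Sit.bound (r q : ℕ) : ∀ (d : ℕ) (E : Finset (Finset ℕ)) (v : ℕ) (D R : Finset ℕ),
    Sit E v D R → D.card = d → R.card ≤ r → (ES E R).card ≤ q → E.card ≤ Bd r q d := by
  intro d
  induction d using Nat.strong_induction_on with
  | _ d ih =>
  intro E v D R S hD hR hq
  by_cases ht : ∀ h ∈ E, v ∉ h → ¬ (h ∩ D).Nonempty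
  · have h1 := S.noTouch_card ht
    rw [hD] at h1
    rcases d with _ | _ | _ | d
    · simp [Bd] at h1 ⊢; omega
    · simp [Bd] at h1 ⊢; omega
    · simp [Bd] at h1 ⊢; omega
    · have h1' : E.card ≤ (d + 3).choose 2 + (ES E R).card := h1
      refine le_trans ?_ (le_max_left _ _); omega
  · push Not at ht
    obtain ⟨h, hh, hvh, hne⟩ := ht
    have hle : (h ∩ D).card ≤ D.card := Finset.card_le_card Finset.inter_subset_right
    have hD' : (D \ (h ∩ D)).card = d - (h ∩ D).card := by
      rw [Finset.card_sdiff_of_subset Finset.inter_subset_right, hD]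
    have hES : (ES (avoid E (h ∩ D)) R).card ≤ q := by
      refine le_trans (Finset.card_le_card ?_) hq
      intro e he
      rw [mem_ES] at he ⊢
      exact ⟨avoid_sub _ _ he.1, he.2⟩
    have hca := card_hit_avoid E (h ∩ D)
    have hrec := fun hlt => ih (d - (h ∩ D).card) hlt (avoid E (h ∩ D)) v (D \ (h ∩ D)) R
      (S.delete hh hvh) hD' hR hES
    rcases S.Kcard hh hvh hne with h2 | h3
    · have c := S.hit2_card hh hvh h2
      have b := hrec (by omega)
      rw [h2] at b
      rcases d with _ | _ | _ | d
      · omega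
      · omega
      · simp [Bd] at b ⊢; omega
      · refine le_trans ?_ ((le_max_left _ _).trans (le_max_right _ _))
        rw [show d + 3 - 2 = d + 1 by omega] at b
        omega
    · have c := S.hit3_card hh hvh h3
      have b := hrec (by omega)
      rw [h3] at b
      rcases d with _ | _ | _ | d
      · omega
      · omega
      · omega
      · refine le_trans ?_ ((le_max_right _ _).trans (le_max_right _ _))
        rw [show d + 3 - 3 = d by omega] at b
        omega

/-- one step with a touching edge, then the bound -/
theorem Sit.touch {E : Finset (Finset ℕ)} {v : ℕ} {D R : Finset ℕ} (S : Sit E v D R) {r q d : ℕ}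
    (hD : D.card = d) (hR : R.card ≤ r) (hq : (ES E R).card ≤ q) {h : Finset ℕ} (hh : h ∈ E)
    (hvh : v ∉ h) (hne : (h ∩ D).Nonempty) :
    E.card ≤ max (Bd r q (d - 2) + 1 + r) (Bd r q (d - 3) + 4) := by
  have hD' : (D \ (h ∩ D)).card = d - (h ∩ D).card := by
    rw [Finset.card_sdiff_of_subset Finset.inter_subset_right, hD]
  have hES : (ES (avoid E (h ∩ D)) R).card ≤ q := by
    refine le_trans (Finset.card_le_card ?_) hq
    intro e he
    rw [mem_ES] at he ⊢
    exact ⟨avoid_sub _ _ he.1, he.2⟩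
  have hca := card_hit_avoid E (h ∩ D)
  have hrec := Sit.bound r q (d - (h ∩ D).card) (avoid E (h ∩ D)) v (D \ (h ∩ D)) R
      (S.delete hh hvh) hD' hR hES
  rcases S.Kcard hh hvh hne with h2 | h3
  · have c := S.hit2_card hh hvh h2
    rw [h2] at hrec
    refine le_trans ?_ (le_max_left _ _); omega
  · have c := S.hit3_card hh hvh h3
    rw [h3] at hrec
    refine le_trans ?_ (le_max_right _ _); omega

end FT

namespace FT

theorem ES_card_le {E : Finset (Finset ℕ)} (hU : Uni E) (R : Finset ℕ) :
    (ES E R).card ≤ R.card.choose 3 := by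
  rw [← Finset.card_powersetCard]
  refine Finset.card_le_card ?_
  intro e he
  rw [mem_ES] at he
  rw [Finset.mem_powersetCard]
  exact ⟨he.2, hU e he.1⟩

/-- possible outcomes in the triangle-free case -/
def FreeOut (E : Finset (Finset ℕ)) (V : Finset ℕ) : Prop :=
  ∃ v ∈ V, (∀ e ∈ E, v ∈ e) ∨
    (∃ T ⊆ V, v ∉ T ∧ T.card = 3 ∧
      ∀ e ∈ E, e = T ∨ (v ∈ e ∧ (e ⊆ insert v T ∨ Disjoint e T))) ∨
    (∃ R ⊆ V, v ∉ R ∧ R.card = 4 ∧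
      ∀ e ⊆ V, e.card = 3 → (e ∈ E ↔ (v ∈ e ∧ Disjoint e R) ∨ e ⊆ R))

/-- triangle-free edge sets on seven vertices: few edges or a star -/
theorem free7 {E : Finset (Finset ℕ)} (hU : Uni E) (hP : PF E) (hC : CF E) {A : Finset ℕ}
    (hA : A.card = 7) (h12 : 12 ≤ (ES E A).card) : ∃ c ∈ A, ∀ e ∈ ES E A, c ∈ e := by
  by_cases hE : ∀ e ∈ ES E A, ∀ f ∈ ES E A, (e ∩ f).card ≠ 1
  · have := noP2_card 7 A (ES E A) hA (hU.mono (ES_sub _ _)) (fun e he => (mem_ES.1 he).2) hE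
    omega
  · push Not at hE
    obtain ⟨e, he, f, hf, h1⟩ := hE
    rw [mem_ES] at he hf
    obtain ⟨c, hc⟩ := Finset.card_eq_one.1 h1
    have hcm : c ∈ e ∩ f := by rw [hc]; simp
    rw [Finset.mem_inter] at hcm
    have honly : ∀ z ∈ e, z ∈ f → z = c := by
      intro z hz hz'
      have : z ∈ e ∩ f := Finset.mem_inter.2 ⟨hz, hz'⟩
      rw [hc] at this; exact Finset.mem_singleton.1 this
    have hun : (e ∪ f).card = 5 := by
      have := Finset.card_union_add_card_inter e f
      rw [hU e he.1, hU f hf.1] at this; omega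
    have hus : e ∪ f ⊆ A := Finset.union_subset he.2 hf.2
    have hrest : (A \ (e ∪ f)).card = 2 := by
      rw [Finset.card_sdiff_of_subset hus]; omega
    obtain ⟨s, t, hst, hst'⟩ := Finset.card_eq_two.1 hrest
    have hs : s ∈ A \ (e ∪ f) := by rw [hst']; simp
    have ht : t ∈ A \ (e ∪ f) := by rw [hst']; simp
    obtain ⟨a, b, hab, hac, hbc, rfl⟩ := exists_other (hU e he.1) hcm.1
    obtain ⟨p, q, hpq, hpc, hqc, rfl⟩ := exists_other (hU f hf.1) hcm.2
    have hAe : A = {c, a, b, p, q, s, t} := by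
      have h1 : A = (A \ ({c, a, b} ∪ {c, p, q})) ∪ ({c, a, b} ∪ {c, p, q}) :=
        (Finset.sdiff_union_of_subset hus).symm
      rw [hst'] at h1
      rw [h1]
      ext z; simp only [Finset.mem_union, Finset.mem_insert, Finset.mem_singleton]; tauto
    have hn : [c, a, b, p, q, s, t].Nodup := by
      simp only [Finset.mem_sdiff, Finset.mem_union, Finset.mem_insert,
        Finset.mem_singleton, not_or] at hs ht
      have o1 := honly a (by simp)
      have o2 := honly b (by simp)
      simp only [Finset.mem_insert, Finset.mem_singleton] at o1 o2
      simp only [List.nodup_cons, List.mem_cons, List.not_mem_nil, not_or, or_false,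
        not_false_eq_true, List.nodup_nil, and_true]
      grind
    refine ⟨c, he.2 (by simp), ?_⟩
    rw [hAe] at h12 ⊢
    exact seven_free hU hP hC hn he.1 hf.1 h12

theorem deg_card_le {E : Finset (Finset ℕ)} (hU : Uni E) {A : Finset ℕ} {c : ℕ}
    (hA : ∀ e ∈ E, e ⊆ A ∧ c ∈ e) : E.card ≤ (A.card - 1).choose 2 := by
  by_cases hne : E.Nonempty
  · obtain ⟨e0, he0⟩ := hne
    have hcA : c ∈ A := (hA e0 he0).1 (hA e0 he0).2
    have : E ⊆ ((A.erase c).powersetCard 2).image (fun p => insert c p) := by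
      intro e he
      rw [Finset.mem_image]
      refine ⟨e.erase c, ?_, Finset.insert_erase (hA e he).2⟩
      rw [Finset.mem_powersetCard, Finset.card_erase_of_mem (hA e he).2, hU e he]
      exact ⟨Finset.erase_subset_erase _ (hA e he).1, rfl⟩
    have h1 := Finset.card_le_card this
    have h2 : (((A.erase c).powersetCard 2).image (fun p => insert c p)).card ≤ _ :=
      Finset.card_image_le
    rw [Finset.card_powersetCard, Finset.card_erase_of_mem hcA] at h2
    omega
  · rw [Finset.not_nonempty_iff_eq_empty] at hne
    simp [hne]

theorem caseI {E : Finset (Finset ℕ)} {V : Finset ℕ} (hn : V.card = 13) (hU : Uni E)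
    (hV : ∀ e ∈ E, e ⊆ V) (hP : PF E) (hC : CF E) (hE : 32 ≤ E.card) {v : ℕ} (h8 : 8 ≤ deg E v)
    (hM : M3 E v) : FreeOut E V := by
  have hNB := NB_of_M3 hP hC hU hM
  obtain ⟨p, hp, q, hq, r, hr, hvp, hvq, hvr, hpq, hpr, hqr⟩ := hM
  have hvV : v ∈ V := hV p hp hvp
  set D := (V.erase v).filter (fun x => ∃ e ∈ E, v ∈ e ∧ x ∈ e) with hD
  set R := (V.erase v) \ D with hR
  have hDs : D ⊆ V.erase v := Finset.filter_subset _ _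
  have hRs : R ⊆ V.erase v := Finset.sdiff_subset
  have memD : ∀ e ∈ E, v ∈ e → ∀ z ∈ e, z ≠ v → z ∈ D := by
    intro e he hve z hz hzv
    rw [hD, Finset.mem_filter, Finset.mem_erase]
    exact ⟨⟨hzv, hV e he hz⟩, e, he, hve, hz⟩
  have S : Sit E v D R := by
    refine ⟨hU, hNB, fun h => (Finset.mem_erase.1 (hDs h)).1 rfl,
      fun h => (Finset.mem_erase.1 (hRs h)).1 rfl, Finset.disjoint_sdiff, ?_, memD, ?_⟩
    · intro e he z hz
      by_cases hzv : z = v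
      · exact Or.inl hzv
      · by_cases hzD : z ∈ D
        · exact Or.inr (Or.inl hzD)
        · exact Or.inr (Or.inr (Finset.mem_sdiff.2
            ⟨Finset.mem_erase.2 ⟨hzv, hV e he hz⟩, hzD⟩))
    · intro x hx
      rw [hD, Finset.mem_filter] at hx
      exact hx.2
  have hsum : D.card + R.card = 12 := by
    rw [hR, Finset.card_sdiff_of_subset hDs, Finset.card_erase_of_mem hvV, hn]
    have := Finset.card_le_card hDs
    rw [Finset.card_erase_of_mem hvV, hn] at this
    omega
  have hd6 : 6 ≤ D.card := by
    have hs : (p.erase v ∪ q.erase v) ∪ r.erase v ⊆ D := by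
      intro z hz
      simp only [Finset.mem_union, Finset.mem_erase] at hz
      rcases hz with (hz | hz) | hz
      · exact memD p hp hvp z hz.2 hz.1
      · exact memD q hq hvq z hz.2 hz.1
      · exact memD r hr hvr z hz.2 hz.1
    have := Finset.card_le_card hs
    rw [Finset.card_union_of_disjoint, Finset.card_union_of_disjoint,
      Finset.card_erase_of_mem hvp, Finset.card_erase_of_mem hvq, Finset.card_erase_of_mem hvr,
      hU p hp, hU q hq, hU r hr] at this
    · exact this
    · rw [Finset.disjoint_left]
      intro z hz hz'
      rw [Finset.mem_erase] at hz hz'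
      exact hz.1 (hpq z hz.2 hz'.2)
    · rw [Finset.disjoint_left]
      intro z hz hz'
      rw [Finset.mem_union, Finset.mem_erase, Finset.mem_erase] at hz
      rw [Finset.mem_erase] at hz'
      rcases hz with hz | hz
      · exact hz.1 (hpr z hz.2 hz'.2)
      · exact hz.1 (hqr z hz.2 hz'.2)
  have hESR := ES_card_le hU R
  have hq0 : ∀ r, R.card = r → (ES E R).card ≤ r.choose 3 := by
    intro r hr; rw [← hr]; exact hESR
  have hD12 : D.card ≤ 12 := by omega
  by_cases ht : ∀ h ∈ E, v ∉ h → ¬ (h ∩ D).Nonempty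
  · have hc := S.noTouch_card ht
    have hsub := S.noTouch_sub ht
    have hR3 : ∀ h ∈ E, v ∉ h → 3 ≤ R.card := by
      intro h hh hvh
      rw [← hU h hh]; exact Finset.card_le_card (hsub h hh hvh)
    by_cases h10 : 10 ≤ D.card
    · refine ⟨v, hvV, Or.inl ?_⟩
      intro e he
      by_contra hve
      have := hR3 e he hve
      omega
    · have hRV : R ⊆ V := hRs.trans (Finset.erase_subset _ _)
      have star : ∀ e ∈ E, v ∈ e → Disjoint e R := by
        intro e he hve
        rw [Finset.disjoint_left]
        intro z hz hzR
        have hzv : z ≠ v := by rintro rfl; exact S.vR hzR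
        exact Finset.disjoint_left.1 S.dis (memD e he hve z hz hzv) hzR
      have hcases : D.card = 6 ∨ D.card = 7 ∨ D.card = 8 ∨ D.card = 9 := by omega
      rcases hcases with h | h | h | h
      · exfalso
        have hRc : R.card = 6 := by omega
        have hAc : (insert v R).card = 7 := by
          rw [Finset.card_insert_of_notMem S.vR, hRc]
        have hle : (ES E R).card ≤ (ES E (insert v R)).card := by
          refine Finset.card_le_card ?_
          intro e he
          rw [mem_ES] at he ⊢
          exact ⟨he.1, he.2.trans (Finset.subset_insert _ _)⟩
        rw [h] at hc
        have h15 : Nat.choose 6 2 = 15 := by decide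
        rw [h15] at hc
        obtain ⟨c, hcA, hcs⟩ := free7 hU hP hC hAc (by omega)
        have := deg_card_le (E := ES E (insert v R)) (A := insert v R) (c := c)
          (hU.mono (ES_sub _ _)) (fun e he => ⟨(mem_ES.1 he).2, hcs e he⟩)
        rw [hAc] at this
        have h15' : Nat.choose (7 - 1) 2 = 15 := by decide
        rw [h15'] at this
        omega
      · exfalso
        have := hq0 5 (by omega)
        rw [h] at hc
        have h1 : Nat.choose 7 2 = 21 := by decide
        have h2 : Nat.choose 5 3 = 10 := by decide
        omega
      · have hRc : R.card = 4 := by omega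
        refine ⟨v, hvV, Or.inr (Or.inr ⟨R, hRV, S.vR, hRc, ?_⟩)⟩
        have h1 : Nat.choose 8 2 = 28 := by decide
        have h2 : Nat.choose 4 3 = 4 := by decide
        -- all candidate edges
        set C := ((D.powersetCard 2).image (fun p => insert v p)) ∪ R.powersetCard 3 with hCdef
        have hEC : E ⊆ C := by
          intro e he
          rw [hCdef, Finset.mem_union]
          by_cases hve : v ∈ e
          · left
            rw [Finset.mem_image]
            refine ⟨e.erase v, ?_, Finset.insert_erase hve⟩
            rw [Finset.mem_powersetCard, Finset.card_erase_of_mem hve, hU e he]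
            refine ⟨?_, rfl⟩
            intro z hz
            rw [Finset.mem_erase] at hz
            exact memD e he hve z hz.2 hz.1
          · right
            rw [Finset.mem_powersetCard]
            exact ⟨hsub e he hve, hU e he⟩
        have hCc : C.card ≤ 32 := by
          have k1 := Finset.card_union_le ((D.powersetCard 2).image (fun p => insert v p))
            (R.powersetCard 3)
          have k2 : ((D.powersetCard 2).image (fun p => insert v p)).card ≤ _ :=
            Finset.card_image_le
          rw [Finset.card_powersetCard] at k1 k2
          rw [h] at k2
          rw [hRc] at k1
          rw [hCdef]
          omega
        have hEq : E = C := Finset.eq_of_subset_of_card_le hEC (by omega)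
        intro e heV he3
        constructor
        · intro he
          by_cases hve : v ∈ e
          · exact Or.inl ⟨hve, star e he hve⟩
          · exact Or.inr (hsub e he hve)
        · intro hh
          rw [hEq, hCdef, Finset.mem_union]
          rcases hh with ⟨hve, hd⟩ | hh
          · left
            rw [Finset.mem_image]
            refine ⟨e.erase v, ?_, Finset.insert_erase hve⟩
            rw [Finset.mem_powersetCard, Finset.card_erase_of_mem hve, he3]
            refine ⟨?_, rfl⟩
            intro z hz
            rw [Finset.mem_erase] at hz
            by_contra hzD
            exact Finset.disjoint_left.1 hd hz.2 (Finset.mem_sdiff.2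
              ⟨Finset.mem_erase.2 ⟨hz.1, heV hz.2⟩, hzD⟩)
          · right
            rw [Finset.mem_powersetCard]
            exact ⟨hh, he3⟩
      · have hRc : R.card = 3 := by omega
        refine ⟨v, hvV, Or.inr (Or.inl ⟨R, hRV, S.vR, hRc, ?_⟩)⟩
        intro e he
        by_cases hve : v ∈ e
        · exact Or.inr ⟨hve, Or.inr (star e he hve)⟩
        · left
          exact Finset.eq_of_subset_of_card_le (hsub e he hve) (by rw [hRc, hU e he])
  · push Not at ht
    obtain ⟨h, hh, hvh, hne⟩ := ht
    have hcases : D.card = 6 ∨ D.card = 7 ∨ D.card = 8 ∨ D.card = 9 ∨ D.card = 10 ∨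
      11 ≤ D.card := by omega
    rcases hcases with hd | hd | hd | hd | hd | hd
    · exfalso
      have S' := S.delete hh hvh
      have h1 := S'.star_card
      have hD' : (D \ (h ∩ D)).card = 6 - (h ∩ D).card := by
        rw [Finset.card_sdiff_of_subset Finset.inter_subset_right, hd]
      -- edges at `v`
      have hsp : deg E v ≤ deg (avoid E (h ∩ D)) v +
          ((hit E (h ∩ D)).filter (fun e => v ∈ e)).card := by
        unfold deg
        rw [← Finset.card_union_of_disjoint]
        · refine Finset.card_le_card ?_
          intro e he
          simp only [Finset.mem_union, Finset.mem_filter, hit, avoid] at he ⊢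
          tauto
        · rw [Finset.disjoint_left]
          intro e he he'
          simp only [Finset.mem_filter, hit, avoid] at he he'
          tauto
      have hK : ((hit E (h ∩ D)).filter (fun e => v ∈ e)).card ≤ (h ∩ D).card.choose 2 := by
        have : (hit E (h ∩ D)).filter (fun e => v ∈ e) ⊆
            ((h ∩ D).powersetCard 2).image (fun p => insert v p) := by
          intro e he
          rw [Finset.mem_filter, mem_hit] at he
          obtain ⟨⟨heE, z, hze, hzK⟩, hve⟩ := he
          rw [Finset.mem_image]
          refine ⟨e.erase v, ?_, Finset.insert_erase hve⟩
          rw [Finset.mem_powersetCard, Finset.card_erase_of_mem hve, hU e heE]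
          refine ⟨?_, rfl⟩
          intro w hw
          rw [Finset.mem_erase] at hw
          exact S.closed hh hvh heE hve hze hzK w hw.2 hw.1
        have k1 := Finset.card_le_card this
        have k2 : (((h ∩ D).powersetCard 2).image (fun p => insert v p)).card ≤ _ :=
          Finset.card_image_le
        rw [Finset.card_powersetCard] at k2
        omega
      have c1 : Nat.choose 4 2 = 6 := by decide
      have c2 : Nat.choose 3 2 = 3 := by decide
      have c3 : Nat.choose 2 2 = 1 := by decide
      rcases S.Kcard hh hvh hne with h2 | h3
      · rw [hD', h2] at h1; rw [h2] at hK
        norm_num at h1 hK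
        omega
      · rw [hD', h3] at h1; rw [h3] at hK
        norm_num at h1 hK
        omega
    · exfalso
      have := S.touch (r := 5) (q := 10) hd (by omega) (hq0 5 (by omega)) hh hvh hne
      have e : max (Bd 5 10 (7 - 2) + 1 + 5) (Bd 5 10 (7 - 3) + 4) ≤ 31 := by decide +kernel
      omega
    · exfalso
      have := S.touch (r := 4) (q := 4) hd (by omega) (hq0 4 (by omega)) hh hvh hne
      have e : max (Bd 4 4 (8 - 2) + 1 + 4) (Bd 4 4 (8 - 3) + 4) ≤ 31 := by decide +kernel
      omega
    · exfalso
      have := S.touch (r := 3) (q := 1) hd (by omega) (hq0 3 (by omega)) hh hvh hne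
      have e : max (Bd 3 1 (9 - 2) + 1 + 3) (Bd 3 1 (9 - 3) + 4) ≤ 31 := by decide +kernel
      omega
    · exfalso
      have := S.touch (r := 2) (q := 0) hd (by omega) (hq0 2 (by omega)) hh hvh hne
      have e : max (Bd 2 0 (10 - 2) + 1 + 2) (Bd 2 0 (10 - 3) + 4) ≤ 31 := by decide +kernel
      omega
    · have hR1 : R.card ≤ 1 := by omega
      by_cases hon : ∀ g ∈ E, v ∉ g → g = h
      · refine ⟨v, hvV, Or.inr (Or.inl ⟨h, hV h hh, hvh, hU h hh, ?_⟩)⟩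
        intro e he
        by_cases hve : v ∈ e
        · right
          refine ⟨hve, ?_⟩
          by_cases hdj : Disjoint e h
          · exact Or.inr hdj
          · left
            rw [Finset.not_disjoint_iff] at hdj
            obtain ⟨z, hze, hzh⟩ := hdj
            intro w hw
            by_cases hwv : w = v
            · simp [hwv]
            · exact Finset.mem_insert_of_mem (hNB e he h hh hve hvh z hze hzh w hw hwv)
        · exact Or.inl (hon e he hve)
      · exfalso
        push Not at hon
        obtain ⟨g, hg, hvg, hgh⟩ := hon
        have hESq : (ES E R).card ≤ 0 := by
          refine hESR.trans ?_
          have : R.card = 0 ∨ R.card = 1 := by omega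
          rcases this with h | h <;> rw [h] <;> decide
        have hga : g ∈ avoid E (h ∩ D) := by
          rw [mem_avoid]
          refine ⟨hg, ?_⟩
          by_contra hnd
          have hgh' : g ∈ hit E (h ∩ D) := by
            rw [mem_hit]
            rw [Finset.not_disjoint_iff] at hnd
            exact ⟨hg, hnd⟩
          rcases S.Kcard hh hvh hne with h2 | h3
          · obtain ⟨a, b, hab, hK⟩ := Finset.card_eq_two.1 h2
            have k1 := S.hit2 hh hvh hK hab g hgh'
            obtain ⟨z, hz⟩ := hne
            have k2 := S.hit2 hh hvh hK hab h (mem_hit.2 ⟨hh, z, (Finset.mem_inter.1 hz).1, hz⟩)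
            rw [Finset.mem_insert, Finset.mem_image] at k1 k2
            rcases k1 with k1 | ⟨w, hw, k1⟩
            · rw [k1] at hvg; exact hvg (by simp)
            · rcases k2 with k2 | ⟨w', hw', k2⟩
              · rw [k2] at hvh; exact hvh (by simp)
              · have := Finset.card_le_one.1 hR1 w hw w' hw'
                subst this
                exact hgh (k1.symm.trans k2)
          · rcases S.hit3 hh hvh h3 g hgh' with k | k
            · exact hvg k.1
            · exact hgh k
        have S' := S.delete hh hvh
        have hne' : (g ∩ (D \ (h ∩ D))).Nonempty := by
          by_contra hemp
          rw [Finset.not_nonempty_iff_eq_empty] at hemp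
          have hgR : g ⊆ R := by
            intro z hz
            rcases S'.vert g hga z hz with h1 | h1 | h1
            · subst h1; exact absurd hz hvg
            · exfalso
              have : z ∈ g ∩ (D \ (h ∩ D)) := Finset.mem_inter.2 ⟨hz, h1⟩
              rw [hemp] at this; simp at this
            · exact h1
          have := Finset.card_le_card hgR
          rw [hU g hg] at this; omega
        have hD' : (D \ (h ∩ D)).card = D.card - (h ∩ D).card := by
          rw [Finset.card_sdiff_of_subset Finset.inter_subset_right]
        have hESq' : (ES (avoid E (h ∩ D)) R).card ≤ 0 := by
          refine le_trans (Finset.card_le_card ?_) hESq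
          intro e he
          rw [mem_ES] at he ⊢
          exact ⟨avoid_sub _ _ he.1, he.2⟩
        have hca := card_hit_avoid E (h ∩ D)
        have hb := S'.touch (r := 1) (q := 0) rfl hR1 hESq' hga hvg hne'
        have hhit : (hit E (h ∩ D)).card ≤ 4 := by
          rcases S.Kcard hh hvh hne with h2 | h3
          · have := S.hit2_card hh hvh h2; omega
          · exact S.hit3_card hh hvh h3
        have hdd : (D \ (h ∩ D)).card = 8 ∨ (D \ (h ∩ D)).card = 9 ∨
            (D \ (h ∩ D)).card = 10 := by
          rcases S.Kcard hh hvh hne with h2 | h3 <;> omega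
        have hmain : (D \ (h ∩ D)).card = 10 → False := by
          intro h10
          -- then `R` is empty and `K` has two elements
          have hK2 : (h ∩ D).card = 2 := by
            rcases S.Kcard hh hvh hne with h2 | h3 <;> omega
          have hR0 : R.card = 0 := by omega
          have : h ∩ D = h := by
            refine Finset.inter_eq_left.2 ?_
            intro z hz
            rcases S.vert h hh z hz with h1 | h1 | h1
            · subst h1; exact absurd hz hvh
            · exact h1
            · rw [Finset.card_eq_zero.1 hR0] at h1; simp at h1
          rw [this, hU h hh] at hK2
          omega
        have e8 : max (Bd 1 0 (8 - 2) + 1 + 1) (Bd 1 0 (8 - 3) + 4) ≤ 27 := by decide +kernel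
        have e9 : max (Bd 1 0 (9 - 2) + 1 + 1) (Bd 1 0 (9 - 3) + 4) ≤ 27 := by decide +kernel
        rcases hdd with hdd | hdd | hdd
        · rw [hdd] at hb; omega
        · rw [hdd] at hb; omega
        · exact hmain hdd

theorem caseFree {E : Finset (Finset ℕ)} {V : Finset ℕ} (hn : V.card = 13) (hU : Uni E)
    (hV : ∀ e ∈ E, e ⊆ V) (hP : PF E) (hC : CF E) (hE : 32 ≤ E.card) : FreeOut E V := by
  by_cases h : ∃ v, 8 ≤ deg E v ∧ M3 E v
  · obtain ⟨v, h8, hM⟩ := h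
    exact caseI hn hU hV hP hC hE h8 hM
  · push Not at h
    exact absurd (caseII 13 V E hn le_rfl hU hV hP hC h hE) id

end FT

namespace FT

/-! ### Graphs containing a triangle -/

/-- a loose triangle -/
structure Tri (E : Finset (Finset ℕ)) (x1 x2 x3 y1 y2 y3 : ℕ) : Prop where
  nd : [x1, x2, x3, y1, y2, y3].Nodup
  h3 : {x1, x2, y3} ∈ E
  h1 : {x2, x3, y1} ∈ E
  h2 : {x1, x3, y2} ∈ E

theorem perm3 {a b c : ℕ} {E : Finset (Finset ℕ)} (h : {a, b, c} ∈ E) :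
    {b, a, c} ∈ E ∧ {a, c, b} ∈ E ∧ {c, b, a} ∈ E ∧ {b, c, a} ∈ E ∧ {c, a, b} ∈ E := by
  have e1 : ({b, a, c} : Finset ℕ) = {a, b, c} := by ext; simp; tauto
  have e2 : ({a, c, b} : Finset ℕ) = {a, b, c} := by ext; simp; tauto
  have e3 : ({c, b, a} : Finset ℕ) = {a, b, c} := by ext; simp; tauto
  have e4 : ({b, c, a} : Finset ℕ) = {a, b, c} := by ext; simp; tauto
  have e5 : ({c, a, b} : Finset ℕ) = {a, b, c} := by ext; simp; tauto
  rw [e1, e2, e3, e4, e5]; exact ⟨h, h, h, h, h⟩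

namespace Tri

variable {E : Finset (Finset ℕ)} {x1 x2 x3 y1 y2 y3 : ℕ}

theorem rot (T : Tri E x1 x2 x3 y1 y2 y3) : Tri E x2 x3 x1 y2 y3 y1 := by
  refine ⟨?_, T.h1, ?_, (perm3 T.h3).1⟩
  · have := T.nd
    simp only [List.nodup_cons, List.mem_cons, List.not_mem_nil, not_or, or_false,
      not_false_eq_true, List.nodup_nil, and_true] at this ⊢
    grind
  · exact (perm3 T.h2).1

theorem ne (T : Tri E x1 x2 x3 y1 y2 y3) : (x1 ≠ x2 ∧ x1 ≠ x3 ∧ x1 ≠ y1 ∧ x1 ≠ y2 ∧ x1 ≠ y3) ∧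
    (x2 ≠ x3 ∧ x2 ≠ y1 ∧ x2 ≠ y2 ∧ x2 ≠ y3) ∧ (x3 ≠ y1 ∧ x3 ≠ y2 ∧ x3 ≠ y3) ∧
    (y1 ≠ y2 ∧ y1 ≠ y3) ∧ y2 ≠ y3 := by
  have := T.nd
  simp only [List.nodup_cons, List.mem_cons, List.not_mem_nil, not_or, or_false,
    not_false_eq_true, List.nodup_nil, and_true] at this
  exact this

/-- explicit path -/
theorem path {E : Finset (Finset ℕ)} (hP : PF E) {a b c d e f g : ℕ} (h1 : {a, b, c} ∈ E)
    (h2 : {c, d, e} ∈ E) (h3 : {e, f, g} ∈ E) (hn : [a, b, c, d, e, f, g].Nodup) : False := by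
  simp only [List.nodup_cons, List.mem_cons, List.not_mem_nil, not_or, or_false,
    not_false_eq_true, List.nodup_nil, and_true] at hn
  refine hP.m h1 h2 h3 c e (by simp) (by simp) ?_ (by simp) (by simp) ?_ ?_
  · intro z hz hz'
    simp only [Finset.mem_insert, Finset.mem_singleton] at hz hz'
    grind
  · intro z hz hz'
    simp only [Finset.mem_insert, Finset.mem_singleton] at hz hz'
    grind
  · intro z hz hz'
    simp only [Finset.mem_insert, Finset.mem_singleton] at hz hz'
    grind

/-- an edge through a triangle vertex and two outer vertices is impossible -/
theorem one (T : Tri E x1 x2 x3 y1 y2 y3) (hP : PF E) {s t : ℕ} (hst : s ≠ t)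
    (hs : s ∉ ({x1, x2, x3, y1, y2, y3} : Finset ℕ))
    (ht : t ∉ ({x1, x2, x3, y1, y2, y3} : Finset ℕ)) :
    {s, t, x1} ∉ E ∧ {s, t, y3} ∉ E := by
  have ne := T.ne
  simp only [Finset.mem_insert, Finset.mem_singleton, not_or] at hs ht
  have p3 := perm3 T.h3
  constructor
  · intro h
    refine path hP h (p3.2.1) T.h1 ?_
    simp only [List.nodup_cons, List.mem_cons, List.not_mem_nil, not_or, or_false,
      not_false_eq_true, List.nodup_nil, and_true]
    grind
  · intro h
    refine path hP h (p3.2.2.2.2) T.h1 ?_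
    simp only [List.nodup_cons, List.mem_cons, List.not_mem_nil, not_or, or_false,
      not_false_eq_true, List.nodup_nil, and_true]
    grind

/-- forbidden pairs -/
theorem two (T : Tri E x1 x2 x3 y1 y2 y3) (hP : PF E) {w : ℕ}
    (hw : w ∉ ({x1, x2, x3, y1, y2, y3} : Finset ℕ)) :
    {w, y1, y2} ∉ E ∧ {w, y2, x1} ∉ E ∧ {w, y1, x2} ∉ E := by
  have ne := T.ne
  simp only [Finset.mem_insert, Finset.mem_singleton, not_or] at hw
  refine ⟨?_, ?_, ?_⟩
  · intro h
    refine path hP (perm3 h).2.1 (perm3 T.h1).2.2.1 (perm3 T.h3).1 ?_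
    simp only [List.nodup_cons, List.mem_cons, List.not_mem_nil, not_or, or_false,
      not_false_eq_true, List.nodup_nil, and_true]
    grind
  · intro h
    refine path hP h (perm3 T.h3).2.1 T.h1 ?_
    simp only [List.nodup_cons, List.mem_cons, List.not_mem_nil, not_or, or_false,
      not_false_eq_true, List.nodup_nil, and_true]
    grind
  · intro h
    refine path hP h (perm3 T.h3).2.2.2.1 T.h2 ?_
    simp only [List.nodup_cons, List.mem_cons, List.not_mem_nil, not_or, or_false,
      not_false_eq_true, List.nodup_nil, and_true]
    grind

theorem setrot (x1 x2 x3 y1 y2 y3 : ℕ) : ({x2, x3, x1, y2, y3, y1} : Finset ℕ) =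
    {x1, x2, x3, y1, y2, y3} := by
  ext z; simp only [Finset.mem_insert, Finset.mem_singleton]; tauto

theorem card6 (T : Tri E x1 x2 x3 y1 y2 y3) :
    ({x1, x2, x3, y1, y2, y3} : Finset ℕ).card = 6 := by
  have := List.toFinset_card_of_nodup T.nd
  simpa using this

set_option maxHeartbeats 2000000 in
/-- classification of the edges leaving the triangle -/
theorem cls (T : Tri E x1 x2 x3 y1 y2 y3) (hU : Uni E) (hP : PF E) {w : ℕ} {e : Finset ℕ}
    (hw : w ∉ ({x1, x2, x3, y1, y2, y3} : Finset ℕ)) (he : e ∈ E) (hwe : w ∈ e)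
    (hm : ∃ z ∈ e, z ∈ ({x1, x2, x3, y1, y2, y3} : Finset ℕ)) :
    e = {x1, x2, w} ∨ e = {x2, x3, w} ∨ e = {x3, x1, w} ∨ e = {x1, y1, w} ∨ e = {x2, y2, w} ∨
      e = {x3, y3, w} := by
  have T' := T.rot
  have T'' := T'.rot
  obtain ⟨s, hse, hsU⟩ := hm
  have hsw : s ≠ w := by rintro rfl; exact hw hsU
  obtain ⟨t, hst, htw, rfl⟩ := exists_third (hU e he) hwe hse hsw
  have htU : t ∈ ({x1, x2, x3, y1, y2, y3} : Finset ℕ) := by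
    by_contra ht
    have o1 := T.one hP htw.symm hw ht
    have o2 := T'.one hP htw.symm (by rw [setrot]; exact hw) (by rw [setrot]; exact ht)
    have o3 := T''.one hP htw.symm (by rw [setrot, setrot]; exact hw)
      (by rw [setrot, setrot]; exact ht)
    have he' := (perm3 he).2.1
    simp only [Finset.mem_insert, Finset.mem_singleton] at hsU
    rcases hsU with rfl | rfl | rfl | rfl | rfl | rfl
    · exact o1.1 he'
    · exact o2.1 he'
    · exact o3.1 he'
    · exact o2.2 he'
    · exact o3.2 he'
    · exact o1.2 he'
  have o1 := T.two hP hw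
  have o2 := T'.two hP (by rw [setrot]; exact hw)
  have o3 := T''.two hP (by rw [setrot, setrot]; exact hw)
  have he' := (perm3 he).2.1
  have q1 : ∀ a b c : ℕ, ({a, b, c} : Finset ℕ) = {b, c, a} := by intros; ext; simp; tauto
  have q2 : ∀ a b c : ℕ, ({a, b, c} : Finset ℕ) = {c, b, a} := by intros; ext; simp; tauto
  simp only [Finset.mem_insert, Finset.mem_singleton] at hsU htU
  rcases hsU with h | h | h | h | h | h <;> rcases htU with h' | h' | h' | h' | h' | h' <;>
    rw [h, h'] at he he' <;> first
      | (exfalso; exact hst (h.trans h'.symm))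
      | (exfalso; first
          | with_reducible exact absurd he o1.1 | with_reducible exact absurd he o1.2.1 | with_reducible exact absurd he o1.2.2
          | with_reducible exact absurd he o2.1 | with_reducible exact absurd he o2.2.1 | with_reducible exact absurd he o2.2.2
          | with_reducible exact absurd he o3.1 | with_reducible exact absurd he o3.2.1 | with_reducible exact absurd he o3.2.2
          | with_reducible exact absurd he' o1.1 | with_reducible exact absurd he' o1.2.1 | with_reducible exact absurd he' o1.2.2
          | with_reducible exact absurd he' o2.1 | with_reducible exact absurd he' o2.2.1 | with_reducible exact absurd he' o2.2.2
          | with_reducible exact absurd he' o3.1 | with_reducible exact absurd he' o3.2.1 | with_reducible exact absurd he' o3.2.2)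
      | (rw [h, h']; first
          | with_reducible exact Or.inl (q1 _ _ _) | with_reducible exact Or.inl (q2 _ _ _)
          | with_reducible exact Or.inr (Or.inl (q1 _ _ _)) | with_reducible exact Or.inr (Or.inl (q2 _ _ _))
          | with_reducible exact Or.inr (Or.inr (Or.inl (q1 _ _ _)))
          | with_reducible exact Or.inr (Or.inr (Or.inl (q2 _ _ _)))
          | with_reducible exact Or.inr (Or.inr (Or.inr (Or.inl (q1 _ _ _))))
          | with_reducible exact Or.inr (Or.inr (Or.inr (Or.inl (q2 _ _ _))))
          | with_reducible exact Or.inr (Or.inr (Or.inr (Or.inr (Or.inl (q1 _ _ _)))))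
          | with_reducible exact Or.inr (Or.inr (Or.inr (Or.inr (Or.inl (q2 _ _ _)))))
          | with_reducible exact Or.inr (Or.inr (Or.inr (Or.inr (Or.inr (q1 _ _ _)))))
          | with_reducible exact Or.inr (Or.inr (Or.inr (Or.inr (Or.inr (q2 _ _ _))))))

/-- edges disjoint from the triangle do not meet the attached vertices -/
theorem sep1 (T : Tri E x1 x2 x3 y1 y2 y3) (hP : PF E) {w s t : ℕ}
    (hw : w ∉ ({x1, x2, x3, y1, y2, y3} : Finset ℕ)) (hws : w ≠ s) (hwt : w ≠ t) (hst : s ≠ t)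
    (hs : s ∉ ({x1, x2, x3, y1, y2, y3} : Finset ℕ))
    (ht : t ∉ ({x1, x2, x3, y1, y2, y3} : Finset ℕ)) (h : {s, t, w} ∈ E)
    (he : {x1, x2, w} ∈ E ∨ {x1, y1, w} ∈ E) : False := by
  have ne := T.ne
  simp only [Finset.mem_insert, Finset.mem_singleton, not_or] at hs ht hw
  rcases he with he | he
  · refine path hP h (perm3 he).2.2.2.2 T.h1 ?_
    simp only [List.nodup_cons, List.mem_cons, List.not_mem_nil, not_or, or_false,
      not_false_eq_true, List.nodup_nil, and_true]
    grind
  · refine path hP h (perm3 he).2.2.1 T.h3 ?_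
    simp only [List.nodup_cons, List.mem_cons, List.not_mem_nil, not_or, or_false,
      not_false_eq_true, List.nodup_nil, and_true]
    grind

/-- conflicts between attached edges -/
theorem conf (T : Tri E x1 x2 x3 y1 y2 y3) (hP : PF E) {w w' : ℕ} (hww : w ≠ w')
    (hw : w ∉ ({x1, x2, x3, y1, y2, y3} : Finset ℕ))
    (hw' : w' ∉ ({x1, x2, x3, y1, y2, y3} : Finset ℕ)) :
    ({x1, x2, w} ∈ E → {x3, y3, w'} ∈ E → False) ∧
    ({x1, y1, w} ∈ E → {x2, y2, w'} ∈ E → False) := by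
  have ne := T.ne
  simp only [Finset.mem_insert, Finset.mem_singleton, not_or] at hw hw'
  constructor
  · intro h h'
    refine path hP (perm3 h).2.2.2.2 (perm3 T.h1).2.1 h' ?_
    simp only [List.nodup_cons, List.mem_cons, List.not_mem_nil, not_or, or_false,
      not_false_eq_true, List.nodup_nil, and_true]
    grind
  · intro h h'
    refine path hP (perm3 h).2.2.1 (perm3 T.h3).2.1 h' ?_
    simp only [List.nodup_cons, List.mem_cons, List.not_mem_nil, not_or, or_false,
      not_false_eq_true, List.nodup_nil, and_true]
    grind

theorem emb1 (T : Tri E x1 x2 x3 y1 y2 y3) (hU : Uni E) (hP : PF E) {w : ℕ}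
    (hw : w ∉ ({x1, x2, x3, y1, y2, y3} : Finset ℕ))
    (he : {x1, x2, w} ∈ E ∨ {x1, y1, w} ∈ E)
    (h12 : 12 ≤ (ES E (insert w {x1, x2, x3, y1, y2, y3})).card) :
    ∃ i ∈ [1, 2, 3, 4], Emb E (insert w {x1, x2, x3, y1, y2, y3}) (pat i) := by
  have hs : (insert w {x1, x2, x3, y1, y2, y3} : Finset ℕ) = {x1, x2, x3, y1, y2, y3, w} := by
    ext z; simp only [Finset.mem_insert, Finset.mem_singleton]; tauto
  have hn : [x1, x2, x3, y1, y2, y3, w].Nodup := by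
    have ne := T.ne
    simp only [Finset.mem_insert, Finset.mem_singleton, not_or] at hw
    simp only [List.nodup_cons, List.mem_cons, List.not_mem_nil, not_or, or_false,
      not_false_eq_true, List.nodup_nil, and_true]
    grind
  rw [hs] at h12 ⊢
  exact seven_tri hU hP hn T.h3 T.h1 T.h2 he h12

/-- reduce any attached edge to the two standard shapes -/
theorem std (T : Tri E x1 x2 x3 y1 y2 y3) (hU : Uni E) (hP : PF E) {w : ℕ} {e : Finset ℕ}
    (hw : w ∉ ({x1, x2, x3, y1, y2, y3} : Finset ℕ)) (he : e ∈ E) (hwe : w ∈ e)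
    (hm : ∃ z ∈ e, z ∈ ({x1, x2, x3, y1, y2, y3} : Finset ℕ)) :
    ∃ a1 a2 a3 b1 b2 b3, Tri E a1 a2 a3 b1 b2 b3 ∧
      ({a1, a2, a3, b1, b2, b3} : Finset ℕ) = {x1, x2, x3, y1, y2, y3} ∧
      ({a1, a2, w} ∈ E ∨ {a1, b1, w} ∈ E) := by
  have T' := T.rot
  have T'' := T'.rot
  have s1 := setrot x1 x2 x3 y1 y2 y3
  have s2 := (setrot x2 x3 x1 y2 y3 y1).trans s1
  rcases T.cls hU hP hw he hwe hm with rfl | rfl | rfl | rfl | rfl | rfl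
  · exact ⟨_, _, _, _, _, _, T, rfl, Or.inl he⟩
  · exact ⟨_, _, _, _, _, _, T', s1, Or.inl he⟩
  · exact ⟨_, _, _, _, _, _, T'', s2, Or.inl he⟩
  · exact ⟨_, _, _, _, _, _, T, rfl, Or.inr he⟩
  · exact ⟨_, _, _, _, _, _, T', s1, Or.inr he⟩
  · exact ⟨_, _, _, _, _, _, T'', s2, Or.inr he⟩

end Tri

/-- singleton or empty -/
def ind (E : Finset (Finset ℕ)) (s : Finset ℕ) : Finset (Finset ℕ) := E.filter (fun e => e = s)

theorem ind_le (E : Finset (Finset ℕ)) (s : Finset ℕ) : (ind E s).card ≤ 1 := by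
  rw [Finset.card_le_one]
  intro a ha b hb
  simp only [ind, Finset.mem_filter] at ha hb
  rw [ha.2, hb.2]

theorem ind_conf {E : Finset (Finset ℕ)} {s t : Finset ℕ} (h : s ∈ E → t ∈ E → False) :
    (ind E s).card + (ind E t).card ≤ 1 := by
  have h1 := ind_le E s
  have h2 := ind_le E t
  by_contra hcon
  obtain ⟨a, ha⟩ := Finset.card_pos.1 (show 0 < (ind E s).card by omega)
  obtain ⟨b, hb⟩ := Finset.card_pos.1 (show 0 < (ind E t).card by omega)
  simp only [ind, Finset.mem_filter] at ha hb
  rw [ha.2] at ha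
  rw [hb.2] at hb
  exact h ha.1 hb.1

/-- edges at `w` meeting `U` -/
def LL (E : Finset (Finset ℕ)) (U : Finset ℕ) (w : ℕ) : Finset (Finset ℕ) :=
  E.filter (fun e => w ∈ e ∧ ¬ Disjoint e U)

theorem mem_LL {E : Finset (Finset ℕ)} {U : Finset ℕ} {w : ℕ} {e : Finset ℕ} :
    e ∈ LL E U w ↔ e ∈ E ∧ w ∈ e ∧ ∃ z ∈ e, z ∈ U := by
  simp [LL, Finset.not_disjoint_iff]

theorem arith_conf {a b c p q r a' b' c' p' q' r' : ℕ} (ha : a ≤ 1) (hb : b ≤ 1) (hc : c ≤ 1)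
    (hp : p ≤ 1) (hq : q ≤ 1) (hr : r ≤ 1)
    (ha' : a' ≤ 1) (hb' : b' ≤ 1) (hc' : c' ≤ 1)
    (h1 : a + p' ≤ 1) (h2 : p + a' ≤ 1) (h3 : b + q' ≤ 1) (h4 : q + b' ≤ 1) (h5 : c + r' ≤ 1)
    (h6 : r + c' ≤ 1) (h7 : p + q' ≤ 1) (h8 : q + p' ≤ 1) (h9 : p + r' ≤ 1) (h10 : r + p' ≤ 1)
    (h11 : q + r' ≤ 1) (h12 : r + q' ≤ 1) (h : 4 ≤ a + b + c + p + q + r) :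
    a' + b' + c' + p' + q' + r' ≤ 2 := by
  have hp2 : p = 0 ∨ p = 1 := by omega
  have hq2 : q = 0 ∨ q = 1 := by omega
  have hr2 : r = 0 ∨ r = 1 := by omega
  rcases hp2 with rfl | rfl <;> rcases hq2 with rfl | rfl <;> rcases hr2 with rfl | rfl <;> omega

theorem Tri.LL_le {E : Finset (Finset ℕ)} {x1 x2 x3 y1 y2 y3 : ℕ} (T : Tri E x1 x2 x3 y1 y2 y3)
    (hU : Uni E) (hP : PF E) {w : ℕ} (hw : w ∉ ({x1, x2, x3, y1, y2, y3} : Finset ℕ)) :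
    (LL E {x1, x2, x3, y1, y2, y3} w).card ≤ (ind E {x1, x2, w}).card + (ind E {x2, x3, w}).card +
      (ind E {x3, x1, w}).card + (ind E {x3, y3, w}).card + (ind E {x1, y1, w}).card +
      (ind E {x2, y2, w}).card := by
  have hs : LL E {x1, x2, x3, y1, y2, y3} w ⊆ ((((ind E {x1, x2, w} ∪ ind E {x2, x3, w}) ∪
      ind E {x3, x1, w}) ∪ ind E {x3, y3, w}) ∪ ind E {x1, y1, w}) ∪ ind E {x2, y2, w} := by
    intro e he
    rw [mem_LL] at he
    have := T.cls hU hP hw he.1 he.2.1 he.2.2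
    simp only [ind, Finset.mem_union, Finset.mem_filter]
    have h1 := he.1
    tauto
  refine (Finset.card_le_card hs).trans ?_
  refine (Finset.card_union_le _ _).trans (Nat.add_le_add_right ?_ _)
  refine (Finset.card_union_le _ _).trans (Nat.add_le_add_right ?_ _)
  refine (Finset.card_union_le _ _).trans (Nat.add_le_add_right ?_ _)
  refine (Finset.card_union_le _ _).trans (Nat.add_le_add_right ?_ _)
  exact Finset.card_union_le _ _

theorem Tri.LL_conf {E : Finset (Finset ℕ)} {x1 x2 x3 y1 y2 y3 : ℕ}
    (T : Tri E x1 x2 x3 y1 y2 y3)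
    (hU : Uni E) (hP : PF E) {w w' : ℕ} (hww : w ≠ w')
    (hw : w ∉ ({x1, x2, x3, y1, y2, y3} : Finset ℕ))
    (hw' : w' ∉ ({x1, x2, x3, y1, y2, y3} : Finset ℕ))
    (h4 : 4 ≤ (LL E {x1, x2, x3, y1, y2, y3} w).card) :
    (LL E {x1, x2, x3, y1, y2, y3} w').card ≤ 2 := by
  have T' := T.rot
  have T'' := T'.rot
  have l := T.LL_le hU hP hw
  have l' := T.LL_le hU hP hw'
  have k1 := T.conf hP hww hw hw'
  have k2 := T'.conf hP hww (by rw [setrot]; exact hw) (by rw [setrot]; exact hw')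
  have k3 := T''.conf hP hww (by rw [setrot, setrot]; exact hw) (by rw [setrot, setrot]; exact hw')
  have m1 := T.conf hP hww.symm hw' hw
  have m2 := T'.conf hP hww.symm (by rw [setrot]; exact hw') (by rw [setrot]; exact hw)
  have m3 := T''.conf hP hww.symm (by rw [setrot, setrot]; exact hw')
    (by rw [setrot, setrot]; exact hw)
  refine l'.trans ?_
  exact arith_conf (ind_le E {x1, x2, w}) (ind_le E {x2, x3, w}) (ind_le E {x3, x1, w})
    (ind_le E {x3, y3, w}) (ind_le E {x1, y1, w}) (ind_le E {x2, y2, w})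
    (ind_le E {x1, x2, w'}) (ind_le E {x2, x3, w'}) (ind_le E {x3, x1, w'})
    (ind_conf k1.1) (ind_conf fun a b => m1.1 b a) (ind_conf k2.1) (ind_conf fun a b => m2.1 b a)
    (ind_conf k3.1) (ind_conf fun a b => m3.1 b a)
    (ind_conf k3.2) (ind_conf fun a b => m3.2 b a)
    (ind_conf fun a b => m2.2 b a) (ind_conf k2.2)
    (ind_conf k1.2) (ind_conf fun a b => m1.2 b a)
    (h4.trans l)

end FT

namespace FT

theorem pat_card : ∀ i ∈ [1, 2, 3, 4], (pat i).edges.card ≤ 13 := by decide +kernel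

theorem Emb.card_le {E : Finset (Finset ℕ)} {A : Finset ℕ} {Y : ThreeGraph} (h : Emb E A Y) :
    (ES E A).card ≤ Y.edges.card := by
  obtain ⟨g, hg, _, hE⟩ := h
  rw [← Finset.card_image_of_injOn (s := ES E A) (f := Finset.image g)]
  · refine Finset.card_le_card ?_
    intro e he
    obtain ⟨f, hf, rfl⟩ := Finset.mem_image.1 he
    exact hE f hf
  · intro e he f hf hef
    have h1 := (mem_ES.1 (Finset.mem_coe.1 he)).2
    have h2 := (mem_ES.1 (Finset.mem_coe.1 hf)).2
    have hi : Set.InjOn g (↑e ∪ ↑f : Set ℕ) := by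
      refine hg.mono ?_
      intro x hx
      rcases hx with hx | hx
      · exact h1 hx
      · exact h2 hx
    ext z
    constructor
    · intro hz
      have : g z ∈ f.image g := by rw [← hef]; exact Finset.mem_image_of_mem g hz
      obtain ⟨y, hy, hyz⟩ := Finset.mem_image.1 this
      have := hg (h2 hy) (h1 hz) hyz
      rwa [← this]
    · intro hz
      have : g z ∈ e.image g := by rw [hef]; exact Finset.mem_image_of_mem g hz
      obtain ⟨y, hy, hyz⟩ := Finset.mem_image.1 this
      have := hg (h1 hy) (h2 hz) hyz
      rwa [← this]

/-- `A` is a union of components -/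
def Closed (E : Finset (Finset ℕ)) (A : Finset ℕ) : Prop := ∀ e ∈ E, e ⊆ A ∨ Disjoint e A

/-- outcome with a seven vertex block -/
def Out7 (E : Finset (Finset ℕ)) (V : Finset ℕ) : Prop :=
  ∃ A ⊆ V, A.card = 7 ∧ Closed E A ∧ ∃ i ∈ [1, 2, 3, 4], Emb E A (pat i)

theorem Tri.sep {E : Finset (Finset ℕ)} {x1 x2 x3 y1 y2 y3 : ℕ} (T : Tri E x1 x2 x3 y1 y2 y3)
    (hU : Uni E) (hP : PF E) {w : ℕ} (hw : w ∉ ({x1, x2, x3, y1, y2, y3} : Finset ℕ))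
    (hL : (LL E {x1, x2, x3, y1, y2, y3} w).Nonempty) {e : Finset ℕ} (he : e ∈ E) (hwe : w ∈ e) :
    ¬ Disjoint e {x1, x2, x3, y1, y2, y3} := by
  intro hd
  obtain ⟨f, hf⟩ := hL
  rw [mem_LL] at hf
  obtain ⟨a1, a2, a3, b1, b2, b3, T', hs, h⟩ := T.std hU hP hw hf.1 hf.2.1 hf.2.2
  obtain ⟨s, t, hst, hsw, htw, rfl⟩ := exists_other (hU e he) hwe
  rw [Finset.disjoint_left] at hd
  refine T'.sep1 hP (w := w) (s := s) (t := t) ?_ hsw.symm htw.symm hst ?_ ?_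
    (perm3 he).2.2.2.1 h
  · rw [hs]; exact hw
  · rw [hs]; exact hd (by simp)
  · rw [hs]; exact hd (by simp)

theorem Tri.attach {E : Finset (Finset ℕ)} {x1 x2 x3 y1 y2 y3 : ℕ}
    (T : Tri E x1 x2 x3 y1 y2 y3)
    (hU : Uni E) (hP : PF E) {w : ℕ} (hw : w ∉ ({x1, x2, x3, y1, y2, y3} : Finset ℕ))
    {e : Finset ℕ} (he : e ∈ LL E {x1, x2, x3, y1, y2, y3} w) :
    e ⊆ insert w {x1, x2, x3, y1, y2, y3} := by
  rw [mem_LL] at he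
  rcases T.cls hU hP hw he.1 he.2.1 he.2.2 with h | h | h | h | h | h <;> rw [h] <;> intro z hz <;>
    simp only [Finset.mem_insert, Finset.mem_singleton] at hz ⊢ <;> tauto

theorem Tri.emb2 {E : Finset (Finset ℕ)} {x1 x2 x3 y1 y2 y3 : ℕ}
    (T : Tri E x1 x2 x3 y1 y2 y3)
    (hU : Uni E) (hP : PF E) {w : ℕ} (hw : w ∉ ({x1, x2, x3, y1, y2, y3} : Finset ℕ))
    (hL : (LL E {x1, x2, x3, y1, y2, y3} w).Nonempty)
    (h12 : 12 ≤ (ES E (insert w {x1, x2, x3, y1, y2, y3})).card) :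
    ∃ i ∈ [1, 2, 3, 4], Emb E (insert w {x1, x2, x3, y1, y2, y3}) (pat i) := by
  obtain ⟨f, hf⟩ := hL
  rw [mem_LL] at hf
  obtain ⟨a1, a2, a3, b1, b2, b3, T', hs, h⟩ := T.std hU hP hw hf.1 hf.2.1 hf.2.2
  rw [← hs] at hw h12 ⊢
  exact T'.emb1 hU hP hw h h12

theorem Tri.thirteen {E : Finset (Finset ℕ)} {x1 x2 x3 y1 y2 y3 : ℕ}
    (T : Tri E x1 x2 x3 y1 y2 y3)
    (hU : Uni E) (hP : PF E) {w : ℕ} (hw : w ∉ ({x1, x2, x3, y1, y2, y3} : Finset ℕ))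
    (hL : (LL E {x1, x2, x3, y1, y2, y3} w).Nonempty) :
    (ES E {x1, x2, x3, y1, y2, y3}).card + (LL E {x1, x2, x3, y1, y2, y3} w).card ≤ 13 := by
  have h1 : (ES E (insert w {x1, x2, x3, y1, y2, y3})).card ≤ 13 := by
    by_contra hcon
    obtain ⟨i, hi, h⟩ := T.emb2 hU hP hw hL (by omega)
    have := h.card_le
    have := pat_card i hi
    omega
  refine le_trans ?_ h1
  rw [← Finset.card_union_of_disjoint]
  · refine Finset.card_le_card ?_
    intro e he
    rcases Finset.mem_union.1 he with he | he
    · rw [mem_ES] at he ⊢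
      exact ⟨he.1, he.2.trans (Finset.subset_insert _ _)⟩
    · exact mem_ES.2 ⟨(mem_LL.1 he).1, T.attach hU hP hw he⟩
  · rw [Finset.disjoint_left]
    intro e he he'
    exact hw ((mem_ES.1 he).2 (mem_LL.1 he').2.1)

theorem choose_small (j : ℕ) (h2 : 2 ≤ j) (h7 : j ≤ 7) : 10 + 3 * j + (7 - j).choose 3 ≤ 31 := by
  interval_cases j <;> decide

theorem tri_dich {E : Finset (Finset ℕ)} {V : Finset ℕ} (hn : V.card = 13) (hU : Uni E)
    (hV : ∀ e ∈ E, e ⊆ V) (hP : PF E) (hE : 32 ≤ E.card) {x1 x2 x3 y1 y2 y3 : ℕ}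
    (T : Tri E x1 x2 x3 y1 y2 y3) :
    Out7 E V ∨ Closed E {x1, x2, x3, y1, y2, y3} := by
  classical
  have h6 := T.card6
  have hsep := fun w hw hL e he hwe => T.sep hU hP (w := w) hw hL (e := e) he hwe
  have hatt := fun w hw e he => T.attach hU hP (w := w) hw (e := e) he
  have hemb := fun w hw hL h => T.emb2 hU hP (w := w) hw hL h
  have h13 := fun w hw hL => T.thirteen hU hP (w := w) hw hL
  have hconf := fun w w' hww hw hw' h => T.LL_conf hU hP (w := w) (w' := w') hww hw hw' h
  have hUV : ({x1, x2, x3, y1, y2, y3} : Finset ℕ) ⊆ V := by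
    have h1 := hV _ T.h1
    have h2 := hV _ T.h2
    have h3 := hV _ T.h3
    intro z hz
    simp only [Finset.insert_subset_iff, Finset.singleton_subset_iff] at h1 h2 h3
    simp only [Finset.mem_insert, Finset.mem_singleton] at hz
    rcases hz with rfl | rfl | rfl | rfl | rfl | rfl
    · exact h2.1
    · exact h1.1
    · exact h1.2.1
    · exact h1.2.2
    · exact h2.2.2
    · exact h3.2.2
  generalize ({x1, x2, x3, y1, y2, y3} : Finset ℕ) = U at *
  set W : Finset ℕ := (V \ U).filter (fun w => (LL E U w).Nonempty) with hW
  have hWm : ∀ w, w ∈ W ↔ w ∈ V ∧ w ∉ U ∧ (LL E U w).Nonempty := by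
    intro w; simp [hW, and_assoc]
  have hsub : ∀ e ∈ E, ¬ Disjoint e U → ∀ z ∈ e, z ∈ U ∨ (z ∈ W ∧ e ∈ LL E U z) := by
    intro e he hd z hz
    by_cases hzU : z ∈ U
    · exact Or.inl hzU
    · have : e ∈ LL E U z := mem_LL.2 ⟨he, hz, Finset.not_disjoint_iff.1 hd⟩
      exact Or.inr ⟨(hWm z).2 ⟨hV e he hz, hzU, ⟨e, this⟩⟩, this⟩
  have hclosed : Closed E (U ∪ W) := by
    intro e he
    by_cases hd : Disjoint e U
    · right
      rw [Finset.disjoint_union_right]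
      refine ⟨hd, Finset.disjoint_left.2 ?_⟩
      intro z hz hzW
      have := (hWm z).1 hzW
      exact hsep z this.2.1 this.2.2 e he hz hd
    · left
      intro z hz
      rcases hsub e he hd z hz with h | h
      · exact Finset.mem_union_left _ h
      · exact Finset.mem_union_right _ h.1
  have hdUW : Disjoint U W := by
    rw [Finset.disjoint_right]; intro z hz; exact ((hWm z).1 hz).2.1
  have hcA : (U ∪ W).card = 6 + W.card := by
    rw [Finset.card_union_of_disjoint hdUW, h6]
  have hAV : U ∪ W ⊆ V := Finset.union_subset hUV (fun z hz => ((hWm z).1 hz).1)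
  have hW7 : W.card ≤ 7 := by
    have := Finset.card_le_card hAV
    omega
  have hav : (avoid E (U ∪ W)).card ≤ (7 - W.card).choose 3 := by
    have h1 : avoid E (U ∪ W) ⊆ ES E (V \ (U ∪ W)) := by
      intro e he
      exact mem_ES.2 ⟨(mem_avoid.1 he).1, avoid_vert hV e he⟩
    have h2 := ES_card_le hU (V \ (U ∪ W))
    rw [Finset.card_sdiff_of_subset hAV, hn, hcA] at h2
    have h3 : 13 - (6 + W.card) = 7 - W.card := by omega
    rw [h3] at h2
    exact (Finset.card_le_card h1).trans h2
  have htot := card_hit_avoid E (U ∪ W)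
  by_cases hj0 : W = ∅
  · right
    rw [hj0, Finset.union_empty] at hclosed
    exact hclosed
  left
  have hpos : 0 < W.card := Finset.card_pos.2 (Finset.nonempty_iff_ne_empty.2 hj0)
  by_cases hj1 : W.card = 1
  · rw [hj1] at hav hcA
    obtain ⟨w, hw⟩ := Finset.card_eq_one.1 hj1
    have hwm := (hWm w).1 (by rw [hw]; simp)
    have hins : insert w U = U ∪ W := by
      rw [hw]; ext z; simp only [Finset.mem_insert, Finset.mem_union, Finset.mem_singleton]; tauto
    refine ⟨U ∪ W, hAV, hcA, hclosed, ?_⟩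
    rw [← hins]
    refine hemb w hwm.2.1 hwm.2.2 ?_
    rw [hins]
    have h20 : (7 - 1).choose 3 = 20 := by decide
    rw [h20] at hav
    have : hit E (U ∪ W) ⊆ ES E (U ∪ W) := by
      intro e he
      rw [mem_hit] at he
      refine mem_ES.2 ⟨he.1, ?_⟩
      rcases hclosed e he.1 with h | h
      · exact h
      · exact absurd h (Finset.not_disjoint_iff.2 he.2)
    have := Finset.card_le_card this
    omega
  exfalso
  have hj2 : 2 ≤ W.card := by omega
  have hhit : (hit E (U ∪ W)).card ≤ (ES E U).card + ∑ w ∈ W, (LL E U w).card := by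
    have : hit E (U ∪ W) ⊆ ES E U ∪ W.biUnion (LL E U) := by
      intro e he
      rw [mem_hit] at he
      have hd : ¬ Disjoint e U := by
        intro hd
        obtain ⟨z, hz, hz'⟩ := he.2
        rcases Finset.mem_union.1 hz' with h | h
        · exact Finset.disjoint_left.1 hd hz h
        · have := (hWm z).1 h
          exact hsep z this.2.1 this.2.2 e he.1 hz hd
      by_cases hs : e ⊆ U
      · exact Finset.mem_union_left _ (mem_ES.2 ⟨he.1, hs⟩)
      · obtain ⟨z, hz, hzU⟩ := Finset.not_subset.1 hs
        rcases hsub e he.1 hd z hz with h | h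
        · exact absurd h hzU
        · exact Finset.mem_union_right _ (Finset.mem_biUnion.2 ⟨z, h.1, h.2⟩)
    refine (Finset.card_le_card this).trans ((Finset.card_union_le _ _).trans ?_)
    exact Nat.add_le_add_left Finset.card_biUnion_le _
  have hch := choose_small W.card hj2 hW7
  have hkey : (ES E U).card + ∑ w ∈ W, (LL E U w).card ≤ 10 + 3 * W.card := by
    by_cases h4 : ∃ w ∈ W, 4 ≤ (LL E U w).card
    · obtain ⟨w, hw, h4⟩ := h4
      have hwm := (hWm w).1 hw
      have h1 : ∑ x ∈ W.erase w, (LL E U x).card ≤ (W.erase w).card • 2 := by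
        refine Finset.sum_le_card_nsmul _ _ _ ?_
        intro x hx
        rw [Finset.mem_erase] at hx
        exact hconf w x hx.1.symm hwm.2.1 ((hWm x).1 hx.2).2.1 h4
      rw [Finset.card_erase_of_mem hw, smul_eq_mul] at h1
      have h2 := Finset.add_sum_erase W (fun x => (LL E U x).card) hw
      have h3 := h13 w hwm.2.1 hwm.2.2
      omega
    · push Not at h4
      by_cases h3 : ∃ w ∈ W, 3 ≤ (LL E U w).card
      · obtain ⟨w, hw, h3⟩ := h3
        have hwm := (hWm w).1 hw
        have h1 : ∑ x ∈ W, (LL E U x).card ≤ W.card • 3 := by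
          refine Finset.sum_le_card_nsmul _ _ _ ?_
          intro x hx
          have := h4 x hx
          omega
        rw [smul_eq_mul] at h1
        have h3 := h13 w hwm.2.1 hwm.2.2
        omega
      · push Not at h3
        have h1 : ∑ x ∈ W, (LL E U x).card ≤ W.card • 2 := by
          refine Finset.sum_le_card_nsmul _ _ _ ?_
          intro x hx
          have := h3 x hx
          omega
        rw [smul_eq_mul] at h1
        obtain ⟨w, hw⟩ := Finset.card_pos.1 hpos
        have hwm := (hWm w).1 hw
        have h3 := h13 w hwm.2.1 hwm.2.2
        have := Finset.card_pos.2 hwm.2.2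
        omega
  omega

theorem one_mem {e f : Finset ℕ} (h : (e ∩ f).card = 1) :
    ∃ x, x ∈ e ∧ x ∈ f ∧ ∀ z ∈ e, z ∈ f → z = x := by
  obtain ⟨x, hx⟩ := Finset.card_eq_one.1 h
  have : x ∈ e ∩ f := by rw [hx]; simp
  rw [Finset.mem_inter] at this
  refine ⟨x, this.1, this.2, ?_⟩
  intro z hz hz'
  have : z ∈ e ∩ f := Finset.mem_inter.2 ⟨hz, hz'⟩
  rw [hx] at this
  exact Finset.mem_singleton.1 this

theorem tri_of_not_CF {E : Finset (Finset ℕ)} (hU : Uni E) (h : ¬ CF E) :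
    ∃ x1 x2 x3 y1 y2 y3, Tri E x1 x2 x3 y1 y2 y3 := by
  unfold CF at h
  push Not at h
  obtain ⟨e, he, f, hf, g, hg, h1, h2, h3, h4⟩ := h
  obtain ⟨a, ha1, ha2, ha⟩ := one_mem h1
  obtain ⟨b, hb1, hb2, hb⟩ := one_mem h2
  obtain ⟨c, hc1, hc2, hc⟩ := one_mem h3
  have hno : ∀ z, z ∈ e → z ∈ f → z ∈ g → False := by
    intro z h1 h2 h3
    have : z ∈ e ∩ f ∩ g := by simp [h1, h2, h3]
    rw [h4.1] at this
    simp at this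
  have hab : a ≠ b := by rintro rfl; exact hno a ha1 ha2 hb2
  have hac : a ≠ c := by rintro rfl; exact hno a ha1 ha2 hc2
  have hbc : b ≠ c := by rintro rfl; exact hno b hc1 hb1 hb2
  obtain ⟨p, hp1, hp2, hpe⟩ := exists_third (hU e he) ha1 hc1 hac.symm
  obtain ⟨q, hq1, hq2, hqe⟩ := exists_third (hU f hf) ha2 hb1 hab.symm
  obtain ⟨r, hr1, hr2, hre⟩ := exists_third (hU g hg) hc2 hb2 hbc
  have hpe' : p ∈ e := by rw [hpe]; simp
  have hqf' : q ∈ f := by rw [hqe]; simp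
  have hrg' : r ∈ g := by rw [hre]; simp
  have h1 : p ∉ f := fun h => hp2 (ha p hpe' h)
  have h2 : p ∉ g := fun h => hp1 (hc p hpe' h).symm
  have h3 : q ∉ e := fun h => hq2 (ha q h hqf')
  have h4 : q ∉ g := fun h => hq1 (hb q hqf' h).symm
  have h5 : r ∉ e := fun h => hr2 (hc r h hrg')
  have h6 : r ∉ f := fun h => hr1 (hb r h hrg').symm
  refine ⟨c, a, b, q, r, p, ?_, ?_, ?_, ?_⟩
  · simp only [List.nodup_cons, List.mem_cons, List.not_mem_nil, not_or, or_false,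
      not_false_eq_true, List.nodup_nil, and_true]
    have n1 : c ≠ q := by rintro rfl; exact h4 hc2
    have n2 : a ≠ r := by rintro rfl; exact h6 ha2
    have n3 : b ≠ p := by rintro rfl; exact h1 hb1
    have n4 : q ≠ r := by rintro rfl; exact h4 hrg'
    have n5 : q ≠ p := by rintro rfl; exact h1 hqf'
    have n6 : r ≠ p := by rintro rfl; exact h2 hrg'
    refine ⟨⟨hac.symm, hbc.symm, n1, hr2.symm, hp1⟩, ⟨hab, hq2.symm, n2, hp2.symm⟩,
      ⟨hq1, hr1, n3⟩, ⟨n4, n5⟩, n6⟩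
  · rw [hpe] at he; exact (perm3 he).1
  · rw [hqe] at hf; exact hf
  · rw [hre] at hg; exact hg

/-- outcome in presence of a triangle -/
def TriOut (E : Finset (Finset ℕ)) (V : Finset ℕ) : Prop :=
  Out7 E V ∨ (∃ U ⊆ V, U.card = 6 ∧ ∃ U' ⊆ V \ U, U'.card = 6 ∧ ∀ e ∈ E, e ⊆ U ∨ e ⊆ U') ∨
    (∃ B ⊆ V, B.card = 7 ∧ Closed E B ∧ ∃ c ∈ B, ∀ e ∈ ES E B, c ∈ e)

theorem Closed.compl {E : Finset (Finset ℕ)} {V A : Finset ℕ} (h : Closed E A)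
    (hV : ∀ e ∈ E, e ⊆ V) : Closed E (V \ A) := by
  intro e he
  rcases h e he with h | h
  · right
    exact Finset.disjoint_of_subset_left h Finset.disjoint_sdiff
  · left
    exact Finset.subset_sdiff.2 ⟨hV e he, h⟩

theorem Closed.card {E : Finset (Finset ℕ)} {V A : Finset ℕ} (h : Closed E A)
    (hV : ∀ e ∈ E, e ⊆ V) : E.card ≤ (ES E A).card + (ES E (V \ A)).card := by
  refine le_trans ?_ (Finset.card_union_le _ _)
  refine Finset.card_le_card ?_
  intro e he
  rcases h e he with h | h
  · exact Finset.mem_union_left _ (mem_ES.2 ⟨he, h⟩)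
  · exact Finset.mem_union_right _ (mem_ES.2 ⟨he, Finset.subset_sdiff.2 ⟨hV e he, h⟩⟩)

theorem caseTri {E : Finset (Finset ℕ)} {V : Finset ℕ} (hn : V.card = 13) (hU : Uni E)
    (hV : ∀ e ∈ E, e ⊆ V) (hP : PF E) (hC : ¬ CF E) (hE : 32 ≤ E.card) : TriOut E V := by
  obtain ⟨x1, x2, x3, y1, y2, y3, T⟩ := tri_of_not_CF hU hC
  have h6 := T.card6
  have hd := tri_dich hn hU hV hP hE T
  have hUV : ({x1, x2, x3, y1, y2, y3} : Finset ℕ) ⊆ V := by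
    have h1 := hV _ T.h1
    have h2 := hV _ T.h2
    have h3 := hV _ T.h3
    intro z hz
    simp only [Finset.insert_subset_iff, Finset.singleton_subset_iff] at h1 h2 h3
    simp only [Finset.mem_insert, Finset.mem_singleton] at hz
    rcases hz with rfl | rfl | rfl | rfl | rfl | rfl
    · exact h2.1
    · exact h1.1
    · exact h1.2.1
    · exact h1.2.2
    · exact h2.2.2
    · exact h3.2.2
  generalize ({x1, x2, x3, y1, y2, y3} : Finset ℕ) = U at *
  rcases hd with hd | hd
  · exact Or.inl hd
  have hB : (V \ U).card = 7 := by rw [Finset.card_sdiff_of_subset hUV, hn, h6]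
  by_cases hC' : CF (ES E (V \ U))
  · right; right
    have h1 := hd.card hV
    have h2 := ES_card_le hU U
    rw [h6] at h2
    have h20 : (6).choose 3 = 20 := by decide
    have hEE : ES (ES E (V \ U)) (V \ U) = ES E (V \ U) := by
      ext e; simp only [mem_ES]; tauto
    obtain ⟨c, hc, h⟩ := free7 (hU.mono (ES_sub E (V \ U))) (hP.mono (ES_sub E (V \ U))) hC' hB
      (by rw [hEE]; omega)
    rw [hEE] at h
    exact ⟨V \ U, Finset.sdiff_subset, hB, hd.compl hV, c, hc, h⟩
  · obtain ⟨a1, a2, a3, b1, b2, b3, T'⟩ := tri_of_not_CF (hU.mono (ES_sub _ _)) hC'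
    have T2 : Tri E a1 a2 a3 b1 b2 b3 :=
      ⟨T'.nd, (mem_ES.1 T'.h3).1, (mem_ES.1 T'.h1).1, (mem_ES.1 T'.h2).1⟩
    rcases tri_dich hn hU hV hP hE T2 with h | h
    · exact Or.inl h
    right; left
    refine ⟨U, hUV, h6, {a1, a2, a3, b1, b2, b3}, ?_, T2.card6, ?_⟩
    · have h1 := (mem_ES.1 T'.h1).2
      have h2 := (mem_ES.1 T'.h2).2
      have h3 := (mem_ES.1 T'.h3).2
      intro z hz
      simp only [Finset.insert_subset_iff, Finset.singleton_subset_iff] at h1 h2 h3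
      simp only [Finset.mem_insert, Finset.mem_singleton] at hz
      rcases hz with rfl | rfl | rfl | rfl | rfl | rfl
      · exact h2.1
      · exact h1.1
      · exact h1.2.1
      · exact h1.2.2
      · exact h2.2.2
      · exact h3.2.2
    · intro e he
      rcases hd e he with h' | h'
      · exact Or.inl h'
      rcases h e he with h'' | h''
      · exact Or.inr h''
      exfalso
      have hc6 := T2.card6
      have hs6 : ({a1, a2, a3, b1, b2, b3} : Finset ℕ) ⊆ V \ U := by
        have h1 := (mem_ES.1 T'.h1).2
        have h2 := (mem_ES.1 T'.h2).2
        have h3 := (mem_ES.1 T'.h3).2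
        intro z hz
        simp only [Finset.insert_subset_iff, Finset.singleton_subset_iff] at h1 h2 h3
        simp only [Finset.mem_insert, Finset.mem_singleton] at hz
        rcases hz with rfl | rfl | rfl | rfl | rfl | rfl
        · exact h2.1
        · exact h1.1
        · exact h1.2.1
        · exact h1.2.2
        · exact h2.2.2
        · exact h3.2.2
      have hsub : e ⊆ (V \ U) \ {a1, a2, a3, b1, b2, b3} :=
        Finset.subset_sdiff.2 ⟨Finset.subset_sdiff.2 ⟨hV e he, h'⟩, h''⟩
      have := Finset.card_le_card hsub
      rw [Finset.card_sdiff_of_subset hs6, hc6, hB, hU e he] at this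
      omega

end FT

namespace FT

/-! ### Embeddings -/

theorem bij1 {A B : Finset ℕ} (h : A.card = B.card) :
    ∃ g : ℕ → ℕ, Set.InjOn g A ∧ A.image g = B := by
  classical
  let e := Finset.equivOfCardEq h
  have key : ∀ x (hx : x ∈ A), (fun x => if hx : x ∈ A then (e ⟨x, hx⟩ : ℕ) else 0) x
      = (e ⟨x, hx⟩ : ℕ) := by
    intro x hx; simp [hx]
  refine ⟨fun x => if hx : x ∈ A then (e ⟨x, hx⟩ : ℕ) else 0, ?_, ?_⟩
  · intro x hx y hy hxy
    rw [key x hx, key y hy] at hxy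
    have := e.injective (Subtype.ext hxy)
    exact congrArg Subtype.val this
  · ext y
    constructor
    · intro hy
      obtain ⟨x, hx, rfl⟩ := Finset.mem_image.1 hy
      rw [dif_pos hx]
      exact (e ⟨x, hx⟩).2
    · intro hy
      refine Finset.mem_image.2 ⟨(e.symm ⟨y, hy⟩ : ℕ), (e.symm ⟨y, hy⟩).2, ?_⟩
      rw [dif_pos (e.symm ⟨y, hy⟩).2]
      simp

theorem glue {A B : Finset ℕ} (hd : Disjoint A B) {g1 g2 : ℕ → ℕ} (h1 : Set.InjOn g1 A)
    (h2 : Set.InjOn g2 B) (h : ∀ x ∈ A, ∀ y ∈ B, g1 x ≠ g2 y) :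
    ∃ f : ℕ → ℕ, Set.InjOn f ↑(A ∪ B) ∧ (∀ x ∈ A, f x = g1 x) ∧ (∀ x ∈ B, f x = g2 x) := by
  classical
  have hA : ∀ x ∈ A, (fun x => if x ∈ A then g1 x else g2 x) x = g1 x := by
    intro x hx; simp [hx]
  have hB : ∀ x ∈ B, (fun x => if x ∈ A then g1 x else g2 x) x = g2 x := by
    intro x hx
    have := Finset.disjoint_right.1 hd hx
    simp [this]
  refine ⟨fun x => if x ∈ A then g1 x else g2 x, ?_, hA, hB⟩
  intro x hx y hy hxy
  rcases Finset.mem_union.1 (Finset.mem_coe.1 hx) with hx | hx <;>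
    rcases Finset.mem_union.1 (Finset.mem_coe.1 hy) with hy | hy
  · rw [hA x hx, hA y hy] at hxy; exact h1 hx hy hxy
  · rw [hA x hx, hB y hy] at hxy; exact absurd hxy (h x hx y hy)
  · rw [hB x hx, hA y hy] at hxy; exact absurd hxy.symm (h y hy x hx)
  · rw [hB x hx, hB y hy] at hxy; exact h2 hx hy hxy

theorem image_of_eq {A : Finset ℕ} {f g : ℕ → ℕ} (h : ∀ x ∈ A, f x = g x) {e : Finset ℕ}
    (he : e ⊆ A) : e.image f = e.image g :=
  Finset.image_congr fun x hx => h x (he hx)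

theorem bij2 {A B A' B' : Finset ℕ} (hd : Disjoint A B) (hd' : Disjoint A' B')
    (hA : A.card = A'.card) (hB : B.card = B'.card) :
    ∃ f : ℕ → ℕ, Set.InjOn f ↑(A ∪ B) ∧ A.image f = A' ∧ B.image f = B' := by
  obtain ⟨g1, i1, e1⟩ := bij1 hA
  obtain ⟨g2, i2, e2⟩ := bij1 hB
  obtain ⟨f, hf, f1, f2⟩ := glue hd i1 i2 (by
    intro x hx y hy hxy
    have h1 : g1 x ∈ A' := by rw [← e1]; exact Finset.mem_image_of_mem _ hx
    have h2 : g2 y ∈ B' := by rw [← e2]; exact Finset.mem_image_of_mem _ hy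
    rw [hxy] at h1
    exact Finset.disjoint_left.1 hd' h1 h2)
  exact ⟨f, hf, by rw [image_of_eq f1 subset_rfl, e1], by rw [image_of_eq f2 subset_rfl, e2]⟩

theorem bij3 {A B C A' B' C' : Finset ℕ} (hd : Disjoint A B) (hd2 : Disjoint (A ∪ B) C)
    (hd' : Disjoint A' B') (hd2' : Disjoint (A' ∪ B') C')
    (hA : A.card = A'.card) (hB : B.card = B'.card) (hC : C.card = C'.card) :
    ∃ f : ℕ → ℕ, Set.InjOn f ↑(A ∪ B ∪ C) ∧ A.image f = A' ∧ B.image f = B' ∧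
      C.image f = C' := by
  obtain ⟨g1, i1, e1, e1'⟩ := bij2 hd hd' hA hB
  obtain ⟨g2, i2, e2⟩ := bij1 hC
  obtain ⟨f, hf, f1, f2⟩ := glue hd2 i1 i2 (by
    intro x hx y hy hxy
    have h1 : g1 x ∈ A' ∪ B' := by
      rw [← e1, ← e1', ← Finset.image_union]; exact Finset.mem_image_of_mem _ hx
    have h2 : g2 y ∈ C' := by rw [← e2]; exact Finset.mem_image_of_mem _ hy
    rw [hxy] at h1
    exact Finset.disjoint_left.1 hd2' h1 h2)
  exact ⟨f, hf, by rw [image_of_eq f1 Finset.subset_union_left, e1],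
    by rw [image_of_eq f1 Finset.subset_union_right, e1'], by rw [image_of_eq f2 subset_rfl, e2]⟩

theorem img_card {V e : Finset ℕ} {f : ℕ → ℕ} (hf : Set.InjOn f V) (he : e ⊆ V)
    (h3 : e.card = 3) : (e.image f).card = 3 := by
  rw [Finset.card_image_of_injOn (hf.mono (by exact_mod_cast he)), h3]

theorem img_sub {e A A' : Finset ℕ} {f : ℕ → ℕ} (hA : A.image f = A') (he : e ⊆ A) :
    e.image f ⊆ A' := by rw [← hA]; exact Finset.image_subset_image he

theorem img_one {v a : ℕ} {f : ℕ → ℕ} (hA : ({v} : Finset ℕ).image f = {a}) : f v = a := by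
  simpa using hA

/-- star -/
theorem cc_star {H : ThreeGraph} (hval : H.IsValid) (hn : H.verts.card = 13) {v : ℕ}
    (hv : v ∈ H.verts) (h : ∀ e ∈ H.edges, v ∈ e) : (SS 13).ContainsCopy H := by
  have hu : {v} ∪ H.verts.erase v = H.verts := by
    rw [← Finset.insert_eq, Finset.insert_erase hv]
  obtain ⟨f, hf, f1, f2⟩ := bij2 (A := {v}) (B := H.verts.erase v) (A' := {0}) (B' := Finset.Ico 1 13)
    (by simp) (by decide) rfl (by rw [Finset.card_erase_of_mem hv, hn]; rfl)
  have hall : H.verts.image f = Finset.range 13 := by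
    rw [← hu, Finset.image_union, f1, f2]; decide
  rw [hu] at hf
  refine ⟨f, hf, ?_, ?_⟩
  · intro x hx
    have : f x ∈ H.verts.image f := Finset.mem_image_of_mem f hx
    rw [hall] at this
    exact this
  · intro e he
    refine Finset.mem_filter.2 ⟨Finset.mem_powersetCard.2 ⟨img_sub hall (hval e he).2,
      img_card hf (hval e he).2 (hval e he).1⟩, ?_⟩
    rw [← img_one f1]
    exact Finset.mem_image_of_mem f (h e he)

theorem emb_star {E : Finset (Finset ℕ)} {B : Finset ℕ} (hU : Uni E) (hn : B.card = 7) {v : ℕ}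
    (hv : v ∈ B) (h : ∀ e ∈ ES E B, v ∈ e) : Emb E B (SS 7) := by
  have hu : {v} ∪ B.erase v = B := by
    rw [← Finset.insert_eq, Finset.insert_erase hv]
  obtain ⟨f, hf, f1, f2⟩ := bij2 (A := {v}) (B := B.erase v) (A' := {0}) (B' := Finset.Ico 1 7)
    (by simp) (by decide) rfl (by rw [Finset.card_erase_of_mem hv, hn]; rfl)
  have hall : B.image f = Finset.range 7 := by
    rw [← hu, Finset.image_union, f1, f2]; decide
  rw [hu] at hf
  refine ⟨f, hf, ?_, ?_⟩
  · intro x hx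
    have : f x ∈ B.image f := Finset.mem_image_of_mem f hx
    rw [hall] at this
    exact this
  · intro e he
    refine Finset.mem_filter.2 ⟨Finset.mem_powersetCard.2 ⟨img_sub hall (mem_ES.1 he).2,
      img_card hf (mem_ES.1 he).2 (hU e (mem_ES.1 he).1)⟩, ?_⟩
    rw [← img_one f1]
    exact Finset.mem_image_of_mem f (h e he)

/-- comet -/
theorem cc_comet {H : ThreeGraph} (hval : H.IsValid) (hn : H.verts.card = 13) {v : ℕ}
    (hv : v ∈ H.verts) {T : Finset ℕ} (hT : T ⊆ H.verts) (hvT : v ∉ T) (h3 : T.card = 3)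
    (h : ∀ e ∈ H.edges, e = T ∨ (v ∈ e ∧ (e ⊆ insert v T ∨ Disjoint e T))) :
    (comet 13).ContainsCopy H := by
  have hsub : {v} ∪ T ⊆ H.verts := Finset.union_subset (by simpa using hv) hT
  have hdv : Disjoint {v} T := by simpa using hvT
  have hu : {v} ∪ T ∪ (H.verts \ ({v} ∪ T)) = H.verts := Finset.union_sdiff_of_subset hsub
  obtain ⟨f, hf, f1, f2, f3⟩ := bij3 (A := {v}) (B := T) (C := H.verts \ ({v} ∪ T)) (A' := {0})
    (B' := {1, 2, 3}) (C' := Finset.Ico 4 13) hdv Finset.disjoint_sdiff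
    (by decide) (by decide) rfl (by rw [h3]; rfl)
    (by rw [Finset.card_sdiff_of_subset hsub, Finset.card_union_of_disjoint hdv, h3, hn]; rfl)
  have hall : H.verts.image f = Finset.range 13 := by
    rw [← hu, Finset.image_union, Finset.image_union, f1, f2, f3]; decide
  rw [hu] at hf
  refine ⟨f, hf, ?_, ?_⟩
  · intro x hx
    have : f x ∈ H.verts.image f := Finset.mem_image_of_mem f hx
    rw [hall] at this
    exact this
  · intro e he
    have hc := img_card hf (hval e he).2 (hval e he).1
    have hvT4 : ({v} ∪ T).image f = {0, 1, 2, 3} := by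
      rw [Finset.image_union, f1, f2]; decide
    have hfv := img_one f1
    rcases h e he with rfl | ⟨hve, hs | hs⟩
    · exact Finset.mem_union_left _ (Finset.mem_powersetCard.2
        ⟨img_sub hvT4 Finset.subset_union_right, hc⟩)
    · exact Finset.mem_union_left _ (Finset.mem_powersetCard.2
        ⟨img_sub hvT4 (by rw [← Finset.insert_eq]; exact hs), hc⟩)
    · refine Finset.mem_union_right _ (Finset.mem_filter.2 ⟨Finset.mem_powersetCard.2
        ⟨?_, hc⟩, ?_⟩)
      · have h4 : ({v} ∪ (H.verts \ ({v} ∪ T))).image f = insert 0 (Finset.Ico 4 13) := by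
          rw [Finset.image_union, f1, f3]; rfl
        refine img_sub h4 ?_
        intro z hz
        have hz1 := (hval e he).2 hz
        have hz2 := Finset.disjoint_left.1 hs hz
        simp only [Finset.mem_union, Finset.mem_sdiff, Finset.mem_singleton]
        tauto
      · rw [← hfv]
        exact Finset.mem_image_of_mem f hve

theorem k4s9_a : ∀ e ∈ (Finset.range 4).powersetCard 3, e ∈ ((KK 4).dUnion (SS 9)).edges := by
  decide +kernel

theorem k4s9_b : ∀ e ∈ (Finset.Ico 4 13).powersetCard 3, 4 ∈ e →
    e ∈ ((KK 4).dUnion (SS 9)).edges := by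
  decide +kernel

theorem k4s9_v : ((KK 4).dUnion (SS 9)).verts = Finset.range 13 := by decide +kernel

theorem k66_a : ∀ e ∈ (Finset.range 6).powersetCard 3,
    e ∈ (((KK 6).dUnion (KK 6)).dUnion (KK 1)).edges := by
  decide +kernel

theorem k66_b : ∀ e ∈ (Finset.Ico 6 12).powersetCard 3,
    e ∈ (((KK 6).dUnion (KK 6)).dUnion (KK 1)).edges := by
  decide +kernel

theorem k66_v : (((KK 6).dUnion (KK 6)).dUnion (KK 1)).verts = Finset.range 13 := by
  decide +kernel

/-- K4 ∪ S9 -/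
theorem cc_k4s9 {H : ThreeGraph} (hval : H.IsValid) (hn : H.verts.card = 13) {v : ℕ}
    (hv : v ∈ H.verts) {T : Finset ℕ} (hT : T ⊆ H.verts) (hvT : v ∉ T) (h3 : T.card = 4)
    (h : ∀ e ∈ H.edges, (v ∈ e ∧ Disjoint e T) ∨ e ⊆ T) :
    ((KK 4).dUnion (SS 9)).ContainsCopy H := by
  have hsub : {v} ∪ T ⊆ H.verts := Finset.union_subset (by simpa using hv) hT
  have hdv : Disjoint {v} T := by simpa using hvT
  have hu : {v} ∪ T ∪ (H.verts \ ({v} ∪ T)) = H.verts := Finset.union_sdiff_of_subset hsub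
  obtain ⟨f, hf, f1, f2, f3⟩ := bij3 (A := {v}) (B := T) (C := H.verts \ ({v} ∪ T)) (A' := {4})
    (B' := Finset.range 4) (C' := Finset.Ico 5 13) hdv Finset.disjoint_sdiff
    (by decide) (by decide) rfl (by rw [h3]; rfl)
    (by rw [Finset.card_sdiff_of_subset hsub, Finset.card_union_of_disjoint hdv, h3, hn]; rfl)
  have hall : H.verts.image f = Finset.range 13 := by
    rw [← hu, Finset.image_union, Finset.image_union, f1, f2, f3]; decide
  rw [hu] at hf
  refine ⟨f, hf, ?_, ?_⟩
  · intro x hx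
    have : f x ∈ H.verts.image f := Finset.mem_image_of_mem f hx
    rw [hall] at this
    rw [k4s9_v]; exact this
  · intro e he
    have hc := img_card hf (hval e he).2 (hval e he).1
    have hfv := img_one f1
    rcases h e he with ⟨hve, hs⟩ | hs
    · refine k4s9_b _ (Finset.mem_powersetCard.2 ⟨?_, hc⟩) ?_
      · have h4 : ({v} ∪ (H.verts \ ({v} ∪ T))).image f = Finset.Ico 4 13 := by
          rw [Finset.image_union, f1, f3]; decide
        refine img_sub h4 ?_
        intro z hz
        have hz1 := (hval e he).2 hz
        have hz2 := Finset.disjoint_left.1 hs hz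
        simp only [Finset.mem_union, Finset.mem_sdiff, Finset.mem_singleton]
        tauto
      · rw [← hfv]
        exact Finset.mem_image_of_mem f hve
    · exact k4s9_a _ (Finset.mem_powersetCard.2 ⟨img_sub f2 hs, hc⟩)

theorem cc_k66 {H : ThreeGraph} (hval : H.IsValid) (hn : H.verts.card = 13) {U U' : Finset ℕ}
    (hU : U ⊆ H.verts) (h6 : U.card = 6) (hU' : U' ⊆ H.verts \ U) (h6' : U'.card = 6)
    (h : ∀ e ∈ H.edges, e ⊆ U ∨ e ⊆ U') :
    (((KK 6).dUnion (KK 6)).dUnion (KK 1)).ContainsCopy H := by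
  have hsub : U ∪ U' ⊆ H.verts := Finset.union_subset hU (hU'.trans Finset.sdiff_subset)
  have hdv : Disjoint U U' := Finset.disjoint_of_subset_right hU' Finset.disjoint_sdiff
  have hu : U ∪ U' ∪ (H.verts \ (U ∪ U')) = H.verts := Finset.union_sdiff_of_subset hsub
  obtain ⟨f, hf, f1, f2, f3⟩ := bij3 (A := U) (B := U') (C := H.verts \ (U ∪ U'))
    (A' := Finset.range 6)
    (B' := Finset.Ico 6 12) (C' := {12}) hdv Finset.disjoint_sdiff
    (by decide) (by decide) (by rw [h6]; rfl) (by rw [h6']; rfl)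
    (by rw [Finset.card_sdiff_of_subset hsub, Finset.card_union_of_disjoint hdv, h6, h6', hn]; rfl)
  have hall : H.verts.image f = Finset.range 13 := by
    rw [← hu, Finset.image_union, Finset.image_union, f1, f2, f3]; decide
  rw [hu] at hf
  refine ⟨f, hf, ?_, ?_⟩
  · intro x hx
    have : f x ∈ H.verts.image f := Finset.mem_image_of_mem f hx
    rw [hall] at this
    rw [k66_v]; exact this
  · intro e he
    have hc := img_card hf (hval e he).2 (hval e he).1
    rcases h e he with hs | hs
    · exact k66_a _ (Finset.mem_powersetCard.2 ⟨img_sub f1 hs, hc⟩)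
    · exact k66_b _ (Finset.mem_powersetCard.2 ⟨img_sub f2 hs, hc⟩)

theorem k6_sup : (KK 6).verts.sup id + 1 = 6 := by decide +kernel

/-- K6 ∪ Y -/
theorem cc_k6 {H : ThreeGraph} (hval : H.IsValid) (hn : H.verts.card = 13) {A : Finset ℕ}
    (hA : A ⊆ H.verts) (h7 : A.card = 7) (hcl : Closed H.edges A) {Y : ThreeGraph}
    (hY : Emb H.edges A Y) : ((KK 6).dUnion Y).ContainsCopy H := by
  obtain ⟨g, hg, gv, ge⟩ := hY
  obtain ⟨g1, i1, e1⟩ := bij1 (A := H.verts \ A) (B := Finset.range 6)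
    (by rw [Finset.card_sdiff_of_subset hA, hn, h7]; rfl)
  have hm : ∀ x ∈ H.verts \ A, g1 x < 6 := by
    intro x hx
    rw [← Finset.mem_range, ← e1]; exact Finset.mem_image_of_mem _ hx
  obtain ⟨f, hf, f1, f2⟩ := glue (A := H.verts \ A) (B := A) (g1 := g1) (g2 := fun x => g x + 6)
    Finset.sdiff_disjoint i1
    (by
      intro x hx y hy hxy
      exact hg hx hy (Nat.add_right_cancel hxy))
    (by
      intro x hx y hy hxy
      have := hm x hx
      omega)
  rw [Finset.sdiff_union_of_subset hA] at hf
  unfold ThreeGraph.dUnion ThreeGraph.shiftBy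
  rw [k6_sup]
  refine ⟨f, hf, ?_, ?_⟩
  · intro x hx
    by_cases hxA : x ∈ A
    · rw [f2 x hxA]
      exact Finset.mem_union_right _ (Finset.mem_image.2 ⟨g x, gv x hxA, rfl⟩)
    · have hx' : x ∈ H.verts \ A := Finset.mem_sdiff.2 ⟨hx, hxA⟩
      rw [f1 x hx']
      exact Finset.mem_union_left _ (Finset.mem_range.2 (hm x hx'))
  · intro e he
    rcases hcl e he with hs | hs
    · refine Finset.mem_union_right _ (Finset.mem_image.2 ⟨e.image g, ge e (mem_ES.2 ⟨he, hs⟩), ?_⟩)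
      rw [image_of_eq f2 hs, Finset.image_image]
      rfl
    · have hs' : e ⊆ H.verts \ A := Finset.subset_sdiff.2 ⟨(hval e he).2, hs⟩
      refine Finset.mem_union_left _ (Finset.mem_powersetCard.2 ⟨?_,
        img_card hf (hval e he).2 (hval e he).1⟩)
      rw [image_of_eq f1 hs']
      exact img_sub e1 hs'

theorem image_inj_of {V e f : Finset ℕ} {g : ℕ → ℕ} (hg : Set.InjOn g V) (h1 : e ⊆ V)
    (h2 : f ⊆ V) (hef : e.image g = f.image g) : e = f := by
  ext z
  constructor
  · intro hz
    have : g z ∈ f.image g := by rw [← hef]; exact Finset.mem_image_of_mem g hz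
    obtain ⟨y, hy, hyz⟩ := Finset.mem_image.1 this
    have := hg (h2 hy) (h1 hz) hyz
    rwa [← this]
  · intro hz
    have : g z ∈ e.image g := by rw [hef]; exact Finset.mem_image_of_mem g hz
    obtain ⟨y, hy, hyz⟩ := Finset.mem_image.1 this
    have := hg (h1 hy) (h2 hz) hyz
    rwa [← this]

/-- an embedding between graphs of the same size is an isomorphism -/
theorem iso_of_cc {H Y : ThreeGraph} (hval : H.IsValid) (hv : Y.verts.card = H.verts.card)
    (he : Y.edges.card ≤ H.edges.card) (h : Y.ContainsCopy H) : ThreeGraph.IsoCopy Y H := by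
  obtain ⟨f, hf, fv, fe⟩ := h
  have himv : H.verts.image f = Y.verts := by
    refine Finset.eq_of_subset_of_card_le ?_ ?_
    · intro y hy
      obtain ⟨x, hx, rfl⟩ := Finset.mem_image.1 hy
      exact fv x hx
    · rw [Finset.card_image_of_injOn hf, hv]
  have hime : H.edges.image (Finset.image f) = Y.edges := by
    refine Finset.eq_of_subset_of_card_le ?_ ?_
    · intro y hy
      obtain ⟨x, hx, rfl⟩ := Finset.mem_image.1 hy
      exact fe x hx
    · rw [Finset.card_image_of_injOn]
      · exact he
      · intro a ha b hb hab
        exact image_inj_of hf (hval a ha).2 (hval b hb).2 hab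
  have hinv : ∀ x ∈ H.verts, Function.invFunOn f H.verts (f x) = x := by
    intro x hx
    exact hf.leftInvOn_invFunOn (by exact_mod_cast hx)
  have hinve : ∀ e ⊆ H.verts, (e.image f).image (Function.invFunOn f H.verts) = e := by
    intro e he
    rw [Finset.image_image]
    have : e.image (Function.invFunOn f H.verts ∘ f) = e.image id :=
      Finset.image_congr fun x hx => hinv x (he hx)
    rw [this, Finset.image_id]
  refine ⟨Function.invFunOn f H.verts, ?_, ?_, ?_⟩
  · rw [← himv]
    intro x hx y hy hxy
    obtain ⟨a, ha, rfl⟩ := Finset.mem_image.1 (Finset.mem_coe.1 hx)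
    obtain ⟨b, hb, rfl⟩ := Finset.mem_image.1 (Finset.mem_coe.1 hy)
    rw [hinv a ha, hinv b hb] at hxy
    rw [hxy]
  · rw [← himv]; exact hinve _ subset_rfl
  · rw [← hime]
    ext e
    constructor
    · intro he
      obtain ⟨a, ha, rfl⟩ := Finset.mem_image.1 he
      obtain ⟨b, hb, rfl⟩ := Finset.mem_image.1 ha
      rw [hinve b (hval b hb).2]; exact hb
    · intro he
      exact Finset.mem_image.2 ⟨e.image f, Finset.mem_image_of_mem _ he, hinve e (hval e he).2⟩

theorem PF_of_free {H : ThreeGraph} (hval : H.IsValid) (hf : H.Free pathP) : PF H.edges := by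
  intro e he f hf' g hg h1 h2 h3
  obtain ⟨c, hc1, hc2, hc⟩ := one_mem h1
  obtain ⟨d, hd1, hd2, hd⟩ := one_mem h2
  have hno : ∀ z, z ∈ e → z ∈ g → False := by
    intro z h1 h2
    have : z ∈ e ∩ g := Finset.mem_inter.2 ⟨h1, h2⟩
    rw [h3] at this
    simp at this
  have hcd : c ≠ d := by rintro rfl; exact hno c hc1 hd2
  obtain ⟨a, b, hab, hac, hbc, hee⟩ := exists_other (hval e he).1 hc1
  obtain ⟨m, hm1, hm2, hfe⟩ := exists_third (hval f hf').1 hc2 hd1 hcd.symm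
  obtain ⟨p, q, hpq, hpd, hqd, hge⟩ := exists_other (hval g hg).1 hd2
  have ma : a ∈ e := by rw [hee]; simp
  have mb : b ∈ e := by rw [hee]; simp
  have mm : m ∈ f := by rw [hfe]; simp
  have mp : p ∈ g := by rw [hge]; simp
  have mq : q ∈ g := by rw [hge]; simp
  have na : a ∉ f := fun h => hac (hc a ma h)
  have nb : b ∉ f := fun h => hbc (hc b mb h)
  have np : p ∉ f := fun h => hpd (hd p h mp)
  have nq : q ∉ f := fun h => hqd (hd q h mq)
  have hn : [a, b, c, m, d, p, q].Nodup := by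
    simp only [List.nodup_cons, List.mem_cons, List.not_mem_nil, not_or, or_false,
      not_false_eq_true, List.nodup_nil, and_true]
    grind
  have hv : pathP.verts = Finset.range 7 := by decide
  apply hf
  refine ⟨pf [a, b, c, m, d, p, q], ?_, ?_, ?_⟩
  · rw [hv]; exact injOn7 hn
  · intro v hv'
    have h5 : pf [a, b, c, m, d, p, q] v ∈ (Finset.range 7).image (pf [a, b, c, m, d, p, q]) :=
      Finset.mem_image_of_mem _ (by rw [← hv]; exact hv')
    rw [range7_image] at h5
    simp only [Finset.mem_insert, Finset.mem_singleton] at h5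
    have Ve := (hval e he).2
    have Vf := (hval f hf').2
    have Vg := (hval g hg).2
    rcases h5 with h5 | h5 | h5 | h5 | h5 | h5 | h5 <;> rw [h5]
    · exact Ve ma
    · exact Ve mb
    · exact Ve hc1
    · exact Vf mm
    · exact Vf hd1
    · exact Vg mp
    · exact Vg mq
  · intro s hs
    simp only [pathP, Finset.mem_insert, Finset.mem_singleton] at hs
    rcases hs with rfl | rfl | rfl
    · have : ({0, 1, 2} : Finset ℕ).image (pf [a, b, c, m, d, p, q]) = {a, b, c} := by
        simp [pf, Finset.image_insert]
      rw [this]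
      rw [hee] at he; exact (perm3 he).2.2.2.1
    · have : ({2, 3, 4} : Finset ℕ).image (pf [a, b, c, m, d, p, q]) = {c, m, d} := by
        simp [pf, Finset.image_insert]
      rw [this]
      rw [hfe] at hf'; exact (perm3 hf').2.1
    · have : ({4, 5, 6} : Finset ℕ).image (pf [a, b, c, m, d, p, q]) = {d, p, q} := by
        simp [pf, Finset.image_insert]
      rw [this]
      rw [hge] at hg; exact hg

theorem card_k4s9 : ((KK 4).dUnion (SS 9)).edges.card = 32 := by decide +kernel

theorem card_k6k5 : ((KK 6).dUnion (K5plus 2)).edges.card = 32 := by decide +kernel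

theorem card_k6g3 : ((KK 6).dUnion (G3 7)).edges.card = 32 := by decide +kernel

theorem vcard_k4s9 : ((KK 4).dUnion (SS 9)).verts.card = 13 := by decide +kernel

theorem vcard_k6k5 : ((KK 6).dUnion (K5plus 2)).verts.card = 13 := by decide +kernel

theorem vcard_k6g3 : ((KK 6).dUnion (G3 7)).verts.card = 13 := by decide +kernel

theorem main_claim (H : ThreeGraph) (hval : H.IsValid) (hn : H.verts.card = 13)
    (hfree : H.Free pathP) (hL : ∀ G ∈ L13, ¬ G.ContainsCopy H) (hE : 32 ≤ H.edges.card) :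
    ThreeGraph.IsoCopy ((KK 4).dUnion (SS 9)) H ∨
      ThreeGraph.IsoCopy ((KK 6).dUnion (K5plus 2)) H ∨
      ThreeGraph.IsoCopy ((KK 6).dUnion (G3 7)) H := by
  have hU : Uni H.edges := fun e he => (hval e he).1
  have hV : ∀ e ∈ H.edges, e ⊆ H.verts := fun e he => (hval e he).2
  have hP := PF_of_free hval hfree
  by_cases hC : CF H.edges
  · obtain ⟨v, hv, h | ⟨T, hT, hvT, h3, h⟩ | ⟨R, hR, hvR, h4, h⟩⟩ := caseFree hn hU hV hP hC hE
    · exact absurd (cc_star hval hn hv h) (hL _ (by simp [L13]))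
    · exact absurd (cc_comet hval hn hv hT hvT h3 h) (hL _ (by simp [L13]))
    · left
      refine iso_of_cc hval (by rw [vcard_k4s9, hn]) (by rw [card_k4s9]; exact hE)
        (cc_k4s9 hval hn hv hR hvR h4 ?_)
      intro e he
      exact (h e (hV e he) (hU e he)).1 he
  · rcases caseTri hn hU hV hP hC hE with h | h | h
    · obtain ⟨A, hA, h7, hcl, i, hi, hemb⟩ := h
      have hcc := cc_k6 hval hn hA h7 hcl hemb
      simp only [List.mem_cons, List.not_mem_nil, or_false] at hi
      rcases hi with rfl | rfl | rfl | rfl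
      · exact absurd hcc (hL _ (by simp [L13, pat]))
      · exact absurd hcc (hL _ (by simp [L13, pat]))
      · right; right
        exact iso_of_cc hval (by rw [vcard_k6g3, hn]) (by rw [card_k6g3]; exact hE) hcc
      · right; left
        exact iso_of_cc hval (by rw [vcard_k6k5, hn]) (by rw [card_k6k5]; exact hE) hcc
    · obtain ⟨U, hUV, h6, U', hU', h6', h⟩ := h
      exact absurd (cc_k66 hval hn hUV h6 hU' h6' h) (hL _ (by simp [L13]))
    · obtain ⟨B, hB, h7, hcl, c, hc, h⟩ := h
      exact absurd (cc_k6 hval hn hB h7 hcl (emb_star hU h7 hc h)) (hL _ (by simp [L13]))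

end FT

namespace FT

/-! ### The extremal example -/

theorem z_valid : ((KK 4).dUnion (SS 9)).IsValid := by
  unfold ThreeGraph.IsValid
  decide +kernel

theorem z_PF : ∀ e ∈ ((KK 4).dUnion (SS 9)).edges, ∀ f ∈ ((KK 4).dUnion (SS 9)).edges,
    (e ∩ f).card = 1 → ∀ g ∈ ((KK 4).dUnion (SS 9)).edges, (f ∩ g).card = 1 → e ∩ g ≠ ∅ := by
  decide +kernel

theorem z_free : ((KK 4).dUnion (SS 9)).Free pathP := by
  rintro ⟨f, hf, _, fe⟩
  have e1 := fe {0, 1, 2} (by decide)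
  have e2 := fe {2, 3, 4} (by decide)
  have e3 := fe {4, 5, 6} (by decide)
  have hsub : ∀ a b : Finset ℕ, a ⊆ pathP.verts → b ⊆ pathP.verts →
      a.image f ∩ b.image f = (a ∩ b).image f := by
    intro a b ha hb
    refine (Finset.image_inter_of_injOn _ _ (hf.mono ?_)).symm
    intro x hx
    rcases hx with hx | hx
    · exact ha hx
    · exact hb hx
  refine z_PF _ e1 _ e2 ?_ _ e3 ?_ ?_
  · rw [hsub _ _ (by decide) (by decide)]
    have : ({0, 1, 2} ∩ {2, 3, 4} : Finset ℕ) = {2} := by decide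
    rw [this]; simp
  · rw [hsub _ _ (by decide) (by decide)]
    have : ({2, 3, 4} ∩ {4, 5, 6} : Finset ℕ) = {4} := by decide
    rw [this]; simp
  · rw [hsub _ _ (by decide) (by decide)]
    have : ({0, 1, 2} ∩ {4, 5, 6} : Finset ℕ) = ∅ := by decide
    rw [this]; simp

theorem z_two : ∀ v ∈ ((KK 4).dUnion (SS 9)).verts,
    2 ≤ (((KK 4).dUnion (SS 9)).edges.filter (fun e => v ∉ e)).card := by
  decide +kernel

theorem z_conn : ∀ v ∈ Finset.Ico 4 13, ∃ e ∈ ((KK 4).dUnion (SS 9)).edges, 4 ∈ e ∧ v ∈ e := by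
  decide +kernel

/-- obstruction for stars and comets -/
theorem z_obs1 {G : ThreeGraph} {p : ℕ} (hp : p ∈ G.verts) (hv : G.verts.card = 13)
    (hG : (G.edges.filter (fun e => p ∉ e)).card ≤ 1) :
    ¬ G.ContainsCopy ((KK 4).dUnion (SS 9)) := by
  rintro ⟨f, hf, fv, fe⟩
  have himv : ((KK 4).dUnion (SS 9)).verts.image f = G.verts := by
    refine Finset.eq_of_subset_of_card_le ?_ ?_
    · intro y hy
      obtain ⟨x, hx, rfl⟩ := Finset.mem_image.1 hy
      exact fv x hx
    · rw [Finset.card_image_of_injOn hf, hv, vcard_k4s9]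
  rw [← himv] at hp
  obtain ⟨u, hu, rfl⟩ := Finset.mem_image.1 hp
  have h2 := z_two u hu
  have hle : (((KK 4).dUnion (SS 9)).edges.filter (fun e => u ∉ e)).card ≤
      (G.edges.filter (fun e => f u ∉ e)).card := by
    refine Finset.card_le_card_of_injOn (Finset.image f) ?_ ?_
    · intro e he
      rw [Finset.mem_coe, Finset.mem_filter] at he ⊢
      refine ⟨fe e he.1, ?_⟩
      intro hm
      obtain ⟨y, hy, hyu⟩ := Finset.mem_image.1 hm
      have := hf ((z_valid e he.1).2 hy) hu hyu
      rw [this] at hy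
      exact he.2 hy
    · intro a ha b hb hab
      rw [Finset.mem_coe, Finset.mem_filter] at ha hb
      exact image_inj_of hf (z_valid a ha.1).2 (z_valid b hb.1).2 hab
  omega

/-- obstruction for small components -/
theorem z_obs2 {G : ThreeGraph} (D : List (Finset ℕ))
    (hD : ∀ v ∈ G.verts, ∃ d ∈ D, v ∈ d)
    (hc : ∀ d ∈ D, d.card ≤ 7 ∧ ∀ e ∈ G.edges, e ⊆ d ∨ e ∩ d = ∅) :
    ¬ G.ContainsCopy ((KK 4).dUnion (SS 9)) := by
  rintro ⟨f, hf, fv, fe⟩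
  have hs : Finset.Ico 4 13 ⊆ ((KK 4).dUnion (SS 9)).verts := by decide +kernel
  obtain ⟨d, hd, h4⟩ := hD (f 4) (fv 4 (hs (by decide)))
  obtain ⟨h7, hcl⟩ := hc d hd
  have hsub : (Finset.Ico 4 13).image f ⊆ d := by
    intro y hy
    obtain ⟨v, hv, rfl⟩ := Finset.mem_image.1 hy
    obtain ⟨e, he, h4e, hve⟩ := z_conn v hv
    rcases hcl _ (fe e he) with h | h
    · exact h (Finset.mem_image_of_mem f hve)
    · have : f 4 ∈ e.image f ∩ d := Finset.mem_inter.2 ⟨Finset.mem_image_of_mem f h4e, h4⟩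
      rw [h] at this
      simp at this
  have hcard := Finset.card_le_card hsub
  rw [Finset.card_image_of_injOn (hf.mono (by exact_mod_cast hs))] at hcard
  have : (Finset.Ico 4 13).card = 9 := by decide
  omega

theorem z_L13 : ∀ G ∈ L13, ¬ G.ContainsCopy ((KK 4).dUnion (SS 9)) := by
  intro G hG
  simp only [L13, List.mem_cons, List.not_mem_nil, or_false] at hG
  rcases hG with rfl | rfl | rfl | rfl | rfl | rfl
  · exact z_obs1 (p := 0) (by decide +kernel) (by decide +kernel) (by decide +kernel)
  · exact z_obs2 [Finset.range 6, Finset.Ico 6 12, {12}] (by decide +kernel) (by decide +kernel)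
  · exact z_obs1 (p := 0) (by decide +kernel) (by decide +kernel) (by decide +kernel)
  · exact z_obs2 [Finset.range 6, Finset.Ico 6 13] (by decide +kernel) (by decide +kernel)
  · exact z_obs2 [Finset.range 6, Finset.Ico 6 13] (by decide +kernel) (by decide +kernel)
  · exact z_obs2 [Finset.range 6, Finset.Ico 6 13] (by decide +kernel) (by decide +kernel)

theorem k6k5_valid : ((KK 6).dUnion (K5plus 2)).IsValid := by
  unfold ThreeGraph.IsValid
  decide +kernel

theorem k6g3_valid : ((KK 6).dUnion (G3 7)).IsValid := by
  unfold ThreeGraph.IsValid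
  decide +kernel

theorem iso_card {F H : ThreeGraph} (hF : F.IsValid) (h : ThreeGraph.IsoCopy F H) :
    H.edges.card = F.edges.card := by
  obtain ⟨f, hf, _, he⟩ := h
  rw [← he, Finset.card_image_of_injOn]
  intro a ha b hb hab
  exact image_inj_of hf (hF a ha).2 (hF b hb).2 hab

theorem iso_32 {H : ThreeGraph} (h : ThreeGraph.IsoCopy ((KK 4).dUnion (SS 9)) H ∨
      ThreeGraph.IsoCopy ((KK 6).dUnion (K5plus 2)) H ∨
      ThreeGraph.IsoCopy ((KK 6).dUnion (G3 7)) H) : H.edges.card = 32 := by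
  rcases h with h | h | h
  · rw [iso_card z_valid h, card_k4s9]
  · rw [iso_card k6k5_valid h, card_k6k5]
  · rw [iso_card k6g3_valid h, card_k6g3]

end FT

/-- The maximum number of edges of a `P`-free 3-graph on 13 vertices not contained
in any member of `L₁₃` equals 32, attained exactly by `K_4 ∪ S_9`, `K_6 ∪ K_5^{+2}`
and `K_6 ∪ G_3(7)`. -/
theorem fifth_order_turan_thirteen :
    IsGreatest {m : ℕ | ∃ H : ThreeGraph, H.IsValid ∧ H.verts.card = 13 ∧
      H.Free pathP ∧ (∀ G ∈ L13, ¬ G.ContainsCopy H) ∧ H.edges.card = m} 32 ∧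
    ∀ H : ThreeGraph, H.IsValid → H.verts.card = 13 → H.Free pathP →
      (∀ G ∈ L13, ¬ G.ContainsCopy H) →
      (H.edges.card = 32 ↔
        (ThreeGraph.IsoCopy ((KK 4).dUnion (SS 9)) H ∨
         ThreeGraph.IsoCopy ((KK 6).dUnion (K5plus 2)) H ∨
         ThreeGraph.IsoCopy ((KK 6).dUnion (G3 7)) H)) := by
  refine ⟨⟨⟨_, FT.z_valid, FT.vcard_k4s9, FT.z_free, FT.z_L13, FT.card_k4s9⟩, ?_⟩, ?_⟩
  · rintro m ⟨H, hval, hn, hfree, hL, rfl⟩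
    by_contra hcon
    have hlt : 32 < H.edges.card := not_le.1 hcon
    have := FT.iso_32 (FT.main_claim H hval hn hfree hL hlt.le)
    omega
  · intro H hval hn hfree hL
    exact ⟨fun h => FT.main_claim H hval hn hfree hL h.ge, FT.iso_32⟩
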